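/- arXiv:2004.04113 — 5 statements merged into one kernel-verified Lean document; each statement's English description precedes it below -/
import Mathlib

section
/- Let (μ₁, μ₂) be an Angelesco system with analytic weights on (Δ₁, Δ₂). Then for every sequence (n⃗(k)) in (ℤ≥0)² with n₁(k) + n₂(k) → ∞ and n₁(k)/(n₁(k)+n₂(k)) → 0, the recurrence coefficients satisfy: b_{n⃗(k),2} → B_{0,2} = (α₂+β₂)/2; b_{n⃗(k),1} → B_{0,1} = ½(α₁ + (α₂+β₂)/2) − ½·√((α₂−α₁)(β₂−α₁)); a_{n⃗(k),2} → A_{0,2} = ((β₂−α₂)/4)² (along indices with n₂(k) ≥ 1); and a_{n⃗(k),1} → 0 (along indices with n₁(k) ≥ 1). -/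
open MeasureTheory

noncomputable section

/-- Left endpoints of the two intervals `Δ₁ = [α₁,β₁]`, `Δ₂ = [α₂,β₂]`. -/
def iLo (α₁ α₂ : ℝ) : Fin 2 → ℝ := fun i => if i = 0 then α₁ else α₂

/-- Right endpoints of the two intervals. -/
def iHi (β₁ β₂ : ℝ) : Fin 2 → ℝ := fun i => if i = 0 then β₁ else β₂

/-- An Angelesco system with analytic weights on `([α₁,β₁],[α₂,β₂])`: densities `f i`
positive on `Δ i` that are restrictions of functions `F i` holomorphic and non-vanishing
on open complex neighborhoods `U i` of `Δ i`. -/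
structure AngelescoSystem (α₁ β₁ α₂ β₂ : ℝ) : Type where
  f : Fin 2 → ℝ → ℝ
  F : Fin 2 → ℂ → ℂ
  U : Fin 2 → Set ℂ
  isOpenU : ∀ i, IsOpen (U i)
  subsetU : ∀ i, (Complex.ofReal '' Set.Icc (iLo α₁ α₂ i) (iHi β₁ β₂ i)) ⊆ U i
  holoF : ∀ i, DifferentiableOn ℂ (F i) (U i)
  neF : ∀ i, ∀ z ∈ U i, F i z ≠ 0
  realF : ∀ i, ∀ x ∈ Set.Icc (iLo α₁ α₂ i) (iHi β₁ β₂ i), F i (x : ℂ) = ((f i x : ℝ) : ℂ)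
  posf : ∀ i, ∀ x ∈ Set.Icc (iLo α₁ α₂ i) (iHi β₁ β₂ i), 0 < f i x

variable {α₁ β₁ α₂ β₂ : ℝ}

/-- The measure `dμᵢ = fᵢ(x) dx` on `Δᵢ` (vanishing off `Δᵢ`). -/
noncomputable def AngelescoSystem.μ (S : AngelescoSystem α₁ β₁ α₂ β₂) (i : Fin 2) :
    Measure ℝ :=
  (volume.restrict (Set.Icc (iLo α₁ α₂ i) (iHi β₁ β₂ i))).withDensity
    fun x => ENNReal.ofReal (S.f i x)

/-- The `i`-th component of a multi-index. -/
def nComp (n : ℕ × ℕ) (i : Fin 2) : ℕ := if i = 0 then n.1 else n.2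

/-- The standard multi-index unit vectors `e⃗₁ = (1,0)`, `e⃗₂ = (0,1)`. -/
def evec (i : Fin 2) : ℕ × ℕ := if i = 0 then (1, 0) else (0, 1)

/-- `P` is the family of (monic) type II multiple orthogonal polynomials of `S`. -/
def IsTypeII (S : AngelescoSystem α₁ β₁ α₂ β₂) (P : ℕ × ℕ → Polynomial ℝ) : Prop :=
  ∀ n : ℕ × ℕ, (P n).Monic ∧ (P n).natDegree = n.1 + n.2 ∧
    ∀ i : Fin 2, ∀ l : ℕ, l < nComp n i → (∫ x, (P n).eval x * x ^ l ∂ S.μ i) = 0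

/-- The recurrence coefficient `a_{n⃗,j}`. -/
noncomputable def acoef (S : AngelescoSystem α₁ β₁ α₂ β₂) (P : ℕ × ℕ → Polynomial ℝ)
    (n : ℕ × ℕ) (j : Fin 2) : ℝ :=
  (∫ x, (P n).eval x * x ^ nComp n j ∂ S.μ j)
    / ∫ x, (P (n - evec j)).eval x * x ^ (nComp n j - 1) ∂ S.μ j

/-- The recurrence coefficient `b_{n⃗,j}`. -/
noncomputable def bcoef (S : AngelescoSystem α₁ β₁ α₂ β₂) (P : ℕ × ℕ → Polynomial ℝ)
    (n : ℕ × ℕ) (j : Fin 2) : ℝ :=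
  (P n).coeff (n.1 + n.2 - 1) - (P (n + evec j)).coeff (n.1 + n.2)

section SignChanges
open Polynomial Set

/-- Every nonzero real polynomial is divisible by a product of distinct linear factors with
roots in `(a, b)` that turns it into a polynomial of constant sign on `(a, b)`. -/
lemma exists_finset_constant_sign (a b : ℝ) (G : ℝ[X]) (hG : G ≠ 0) :
    ∃ s : Finset ℝ, (∀ x ∈ s, x ∈ Ioo a b) ∧ (∏ y ∈ s, (X - C y)) ∣ G ∧
      ((∀ x ∈ Ioo a b, 0 ≤ (G * ∏ y ∈ s, (X - C y)).eval x) ∨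
       (∀ x ∈ Ioo a b, (G * ∏ y ∈ s, (X - C y)).eval x ≤ 0)) := by
  induction hd : G.natDegree using Nat.strong_induction_on generalizing G with
  | _ d ih =>
  by_cases hroot : ∃ y ∈ Ioo a b, G.eval y = 0
  · obtain ⟨y, hy, hGy⟩ := hroot
    obtain ⟨G₁, hG₁⟩ := dvd_iff_isRoot.mpr hGy
    have hG₁0 : G₁ ≠ 0 := by rintro rfl; exact hG (by simpa using hG₁)
    have hdeg : G₁.natDegree < d := by
      rw [← hd, hG₁, natDegree_mul (X_sub_C_ne_zero y) hG₁0, natDegree_X_sub_C]; omega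
    obtain ⟨s, hs, hdvd, hsign⟩ := ih _ hdeg G₁ hG₁0 rfl
    by_cases hys : y ∈ s
    · refine ⟨s.erase y, fun x hx => hs x (Finset.mem_of_mem_erase hx), ?_, ?_⟩
      · have : (∏ z ∈ s.erase y, (X - C z)) ∣ ∏ z ∈ s, (X - C z) :=
          Finset.prod_dvd_prod_of_subset _ _ _ (Finset.erase_subset _ _)
        exact (this.trans hdvd).trans ⟨X - C y, by rw [hG₁, mul_comm]⟩
      · have : G * ∏ z ∈ s.erase y, (X - C z) = G₁ * ∏ z ∈ s, (X - C z) := by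
          rw [hG₁, ← Finset.mul_prod_erase s _ hys]; ring
        rwa [this]
    · refine ⟨insert y s, ?_, ?_, ?_⟩
      · intro x hx
        rcases Finset.mem_insert.mp hx with rfl | hx
        · exact hy
        · exact hs x hx
      · rw [Finset.prod_insert hys, hG₁]
        exact mul_dvd_mul_left _ hdvd
      · have : G * ∏ z ∈ insert y s, (X - C z)
            = (X - C y) ^ 2 * (G₁ * ∏ z ∈ s, (X - C z)) := by
          rw [hG₁, Finset.prod_insert hys]; ring
        rw [this]
        refine hsign.imp (fun h x hx => ?_) (fun h x hx => ?_)
        · rw [eval_mul]; exact mul_nonneg (by simpa using sq_nonneg (x - y)) (h x hx)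
        · rw [eval_mul]
          exact mul_nonpos_of_nonneg_of_nonpos (by simpa using sq_nonneg (x - y)) (h x hx)
  · push Not at hroot
    refine ⟨∅, by simp, by simp, ?_⟩
    simp only [Finset.prod_empty, mul_one]
    by_contra! h
    obtain ⟨⟨x, hx, hx0⟩, ⟨z, hz, hz0⟩⟩ := h
    have := isPreconnected_Ioo.intermediate_value hx hz (G.continuous.continuousOn)
      ⟨hx0.le, hz0.le⟩
    obtain ⟨y, hy, hy0⟩ := this
    exact hroot y hy hy0

lemma intervalIntegrable_eval_mul {a b : ℝ} (hab : a < b) {w : ℝ → ℝ}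
    (hw : ContinuousOn w (Icc a b)) {u : ℝ → ℝ} (hu : ContinuousOn u (Icc a b)) :
    IntervalIntegrable (fun x => u x * w x) volume a b := by
  apply ContinuousOn.intervalIntegrable
  rw [uIcc_of_le hab.le]
  exact hu.mul hw

lemma orthogonal_of_natDegree_lt {a b : ℝ} (hab : a < b) {w : ℝ → ℝ}
    (hw : ContinuousOn w (Icc a b)) {G : ℝ[X]} {k : ℕ}
    (horth : ∀ l < k, ∫ x in a..b, G.eval x * x ^ l * w x = 0) {r : ℝ[X]} (hr : r.degree < k) :
    ∫ x in a..b, G.eval x * r.eval x * w x = 0 := by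
  have h : ∀ x, G.eval x * r.eval x * w x
      = ∑ l ∈ Finset.range k, r.coeff l * (G.eval x * x ^ l * w x) := by
    intro x
    have : r.eval x = ∑ l ∈ Finset.range k, r.coeff l * x ^ l := by
      rcases eq_or_ne r 0 with rfl | h0
      · simp
      · exact eval_eq_sum_range' ((natDegree_lt_iff_degree_lt h0).mpr hr) x
    rw [this, Finset.mul_sum, Finset.sum_mul]
    exact Finset.sum_congr rfl fun l _ => by ring
  simp_rw [h]
  rw [intervalIntegral.integral_finsetSum]
  · refine Finset.sum_eq_zero fun l hl => ?_
    rw [intervalIntegral.integral_const_mul, horth l (Finset.mem_range.mp hl), mul_zero]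
  · intro l _
    exact (intervalIntegrable_eval_mul hab hw (by fun_prop)).const_mul _

/-- A nonzero polynomial that is nonnegative on an interval has positive integral. -/
lemma integral_eval_mul_pos {a b : ℝ} (hab : a < b) {w : ℝ → ℝ}
    (hw : ContinuousOn w (Icc a b)) (hw0 : ∀ x ∈ Icc a b, 0 < w x) {G : ℝ[X]} (hG : G ≠ 0)
    (h0 : ∀ x ∈ Ioo a b, 0 ≤ G.eval x) : 0 < ∫ x in a..b, G.eval x * w x := by
  have h0' : ∀ x ∈ Icc a b, 0 ≤ G.eval x := by
    rw [← closure_Ioo hab.ne]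
    exact fun x hx => (isClosed_le continuous_const G.continuous).closure_subset_iff.mpr h0 hx
  have hne : ∃ x ∈ Icc a b, G.eval x ≠ 0 := by
    by_contra! h
    refine hG (eq_zero_of_infinite_isRoot G ((Icc_infinite hab).mono fun x hx => h x hx))
  obtain ⟨c, hc, hc0⟩ := hne
  refine intervalIntegral.integral_pos hab (G.continuous.continuousOn.mul hw)
    (fun x hx => mul_nonneg (h0' x (Ioc_subset_Icc_self hx)) (hw0 x (Ioc_subset_Icc_self hx)).le)
    ⟨c, hc, mul_pos (lt_of_le_of_ne (h0' c hc) hc0.symm) (hw0 c hc)⟩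

/-- Orthogonality to all polynomials of degree less than `k` forces `k` distinct zeros. -/
lemma exists_roots_of_orthogonal {a b : ℝ} (hab : a < b) {w : ℝ → ℝ}
    (hw : ContinuousOn w (Icc a b)) (hw0 : ∀ x ∈ Icc a b, 0 < w x) {G V : ℝ[X]} (hG : G ≠ 0)
    (hV : V ≠ 0) {k : ℕ}
    (horth : ∀ r : ℝ[X], r.degree < k →
      ∫ x in a..b, (G * V ^ 2 * r).eval x * w x = 0) :
    ∃ s : Finset ℝ, (∀ x ∈ s, x ∈ Ioo a b) ∧ (∏ y ∈ s, (X - C y)) ∣ G ∧ k ≤ s.card := by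
  obtain ⟨s, hs, hdvd, hsign⟩ := exists_finset_constant_sign a b G hG
  refine ⟨s, hs, hdvd, ?_⟩
  by_contra! hk
  have hr : (∏ y ∈ s, (X - C y) : ℝ[X]).degree < k := by
    rw [degree_prod]; simpa using hk
  have hp : (∏ y ∈ s, (X - C y) : ℝ[X]) ≠ 0 :=
    Finset.prod_ne_zero_iff.mpr fun y _ => X_sub_C_ne_zero y
  have hne : G * V ^ 2 * ∏ y ∈ s, (X - C y) ≠ 0 :=
    mul_ne_zero (mul_ne_zero hG (pow_ne_zero _ hV)) hp
  have h0 := horth _ hr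
  have hev : ∀ x, (G * V ^ 2 * ∏ y ∈ s, (X - C y)).eval x
      = (V.eval x) ^ 2 * (G * ∏ y ∈ s, (X - C y)).eval x := by
    intro x; simp only [eval_mul, eval_pow]; ring
  rcases hsign with h | h
  · refine absurd h0 (integral_eval_mul_pos hab hw hw0 hne fun x hx => ?_).ne'
    rw [hev]; exact mul_nonneg (sq_nonneg _) (h x hx)
  · have := integral_eval_mul_pos hab hw hw0 (neg_ne_zero.mpr hne) fun x hx => by
      rw [eval_neg, hev, ← mul_neg]; exact mul_nonneg (sq_nonneg _) (neg_nonneg.mpr (h x hx))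
    simp only [eval_neg, neg_mul, intervalIntegral.integral_neg] at this
    linarith

end SignChanges

section Interlacing
open Polynomial Set

/-- Two differentiable functions with nonvanishing Wronskian have interlacing zeros. -/
lemma exists_root_between {G H : ℝ[X]}
    (hW : ∀ x, G.eval x * H.derivative.eval x - G.derivative.eval x * H.eval x ≠ 0)
    {x y : ℝ} (hxy : x < y) (hx : G.eval x = 0) (hy : G.eval y = 0) :
    ∃ z ∈ Ioo x y, H.eval z = 0 := by
  by_contra! h
  have hH : ∀ z ∈ Icc x y, H.eval z ≠ 0 := by
    intro z hz h0
    rcases eq_or_lt_of_le hz.1 with rfl | h1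
    · exact hW x (by rw [hx, h0]; ring)
    rcases eq_or_lt_of_le hz.2 with rfl | h2
    · exact hW z (by rw [hy, h0]; ring)
    exact h z ⟨h1, h2⟩ h0
  obtain ⟨c, hc, hc0⟩ := exists_deriv_eq_zero (f := fun z => G.eval z / H.eval z) hxy
    (G.continuous.continuousOn.div H.continuous.continuousOn hH) (by simp [hx, hy])
  have hHc := hH c (Ioo_subset_Icc_self hc)
  have := (G.hasDerivAt c).div (H.hasDerivAt c) hHc
  have h2 := this.deriv
  change deriv (fun z => G.eval z / H.eval z) c = _ at h2
  rw [hc0, eq_comm, div_eq_zero_iff] at h2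
  rcases h2 with h2 | h2
  · exact hW c (by linarith)
  · exact hHc (by simpa using h2)

/-- Comparison of sums over a set `t` interlaced by `s`. -/
lemma sum_le_sum_filter_of_interlaced {g : ℝ → ℝ} {a e : ℝ} (hg : MonotoneOn g (Icc a e))
    (hg0 : ∀ x ∈ Icc a e, 0 ≤ g x) (s : Finset ℝ) (hs : ∀ x ∈ s, x ∈ Icc a e) (t : Finset ℝ)
    (ht : ∀ x ∈ t, x ∈ Icc a e) (M : ℝ) (htM : ∀ x ∈ t, x < M)
    (h : ∀ x ∈ insert M t, ∀ y ∈ insert M t, x < y → ∃ z ∈ s, z ∈ Ioo x y) :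
    ∑ x ∈ t, g x ≤ ∑ x ∈ s.filter (· < M), g x := by
  induction t using Finset.induction_on_max generalizing M with
  | empty =>
    simp only [Finset.sum_empty]
    exact Finset.sum_nonneg fun x hx => hg0 x (hs x (Finset.mem_of_mem_filter x hx))
  | insert m t hm ih =>
    have hmt : m ∉ t := fun hh => lt_irrefl _ (hm m hh)
    have h1 := ih (fun x hx => ht x (Finset.mem_insert_of_mem hx)) m hm
      (fun x hx y hy => h x (Finset.mem_insert_of_mem hx) y (Finset.mem_insert_of_mem hy))
    obtain ⟨z, hz, hmz, hzM⟩ := h m (by simp) M (by simp) (htM m (by simp))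
    have h2 : g m ≤ g z := hg (ht m (by simp)) (hs z hz) hmz.le
    rw [Finset.sum_insert hmt]
    have hz' : z ∉ s.filter (· < m) := by simp [hmz.le]
    calc g m + ∑ x ∈ t, g x ≤ g z + ∑ x ∈ s.filter (· < m), g x := add_le_add h2 h1
      _ = ∑ x ∈ insert z (s.filter (· < m)), g x := (Finset.sum_insert hz').symm
      _ ≤ _ := by
        refine Finset.sum_le_sum_of_subset_of_nonneg ?_ fun x hx _ =>
          hg0 x (hs x (Finset.mem_of_mem_filter x hx))
        intro x hx
        rcases Finset.mem_insert.mp hx with rfl | hx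
        · exact Finset.mem_filter.mpr ⟨hz, hzM⟩
        · rw [Finset.mem_filter] at hx ⊢
          exact ⟨hx.1, hx.2.trans (htM m (by simp))⟩

lemma sum_le_sum_add_of_interlaced {g : ℝ → ℝ} {a e : ℝ} (hae : a ≤ e)
    (hg : MonotoneOn g (Icc a e))
    (hg0 : ∀ x ∈ Icc a e, 0 ≤ g x) (s : Finset ℝ) (hs : ∀ x ∈ s, x ∈ Icc a e) (t : Finset ℝ)
    (ht : ∀ x ∈ t, x ∈ Icc a e)
    (h : ∀ x ∈ t, ∀ y ∈ t, x < y → ∃ z ∈ s, z ∈ Ioo x y) :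
    ∑ x ∈ t, g x ≤ ∑ x ∈ s, g x + g e := by
  have hsn : 0 ≤ ∑ x ∈ s, g x := Finset.sum_nonneg fun x hx => hg0 x (hs x hx)
  have hge := hg0 e ⟨hae, le_rfl⟩
  rcases t.eq_empty_or_nonempty with rfl | hne
  · simpa using add_nonneg hsn hge
  · set M := t.max' hne
    have hM : M ∈ t := t.max'_mem hne
    have h1 := sum_le_sum_filter_of_interlaced hg hg0 s hs (t.erase M)
      (fun x hx => ht x (Finset.mem_of_mem_erase hx)) M
      (fun x hx => t.lt_max'_of_mem_erase_max' hne hx)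
      (by rw [Finset.insert_erase hM]; exact h)
    rw [← Finset.sum_erase_add t _ hM]
    refine add_le_add (h1.trans ?_) (hg (ht M hM) ⟨hae, le_rfl⟩ (ht M hM).2)
    exact Finset.sum_le_sum_of_subset_of_nonneg (Finset.filter_subset _ _)
      fun x hx _ => hg0 x (hs x hx)

/-- Sums of a monotone function over mutually interlacing sets. -/
lemma abs_sum_sub_sum_le_of_interlaced {g : ℝ → ℝ} {a e : ℝ} (hae : a ≤ e)
    (hg : MonotoneOn g (Icc a e)) (s t : Finset ℝ)
    (hs : ∀ x ∈ s, x ∈ Icc a e) (ht : ∀ x ∈ t, x ∈ Icc a e)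
    (hst : ∀ x ∈ t, ∀ y ∈ t, x < y → ∃ z ∈ s, z ∈ Ioo x y)
    (hts : ∀ x ∈ s, ∀ y ∈ s, x < y → ∃ z ∈ t, z ∈ Ioo x y) :
    |∑ x ∈ t, g x - ∑ x ∈ s, g x - ((t.card : ℝ) - s.card) * g a| ≤ g e - g a := by
  have hg' : MonotoneOn (fun x => g x - g a) (Icc a e) := fun x hx y hy hxy =>
    sub_le_sub_right (hg hx hy hxy) _
  have hg0 : ∀ x ∈ Icc a e, 0 ≤ g x - g a := fun x hx =>
    sub_nonneg.mpr (hg ⟨le_rfl, hae⟩ hx hx.1)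
  have h1 := sum_le_sum_add_of_interlaced hae hg' hg0 s hs t ht hst
  have h2 := sum_le_sum_add_of_interlaced hae hg' hg0 t ht s hs hts
  simp only [Finset.sum_sub_distrib, Finset.sum_const, nsmul_eq_mul] at h1 h2
  rw [abs_le]
  constructor <;> linarith

end Interlacing

section Structure
open Polynomial Set

lemma iLo_lt_iHi (h₁ : α₁ < β₁) (h₃ : α₂ < β₂) (i : Fin 2) : iLo α₁ α₂ i < iHi β₁ β₂ i := by
  fin_cases i <;> simpa [iLo, iHi]

lemma AngelescoSystem.continuousOn_f (S : AngelescoSystem α₁ β₁ α₂ β₂) (i : Fin 2) :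
    ContinuousOn (S.f i) (Icc (iLo α₁ α₂ i) (iHi β₁ β₂ i)) := by
  have h : ContinuousOn (fun x : ℝ => (S.F i (x : ℂ)).re) (Icc (iLo α₁ α₂ i) (iHi β₁ β₂ i)) :=
    Complex.continuous_re.comp_continuousOn ((S.holoF i).continuousOn.comp
      Complex.continuous_ofReal.continuousOn fun x hx => S.subsetU i ⟨x, hx, rfl⟩)
  exact h.congr fun x hx => by simp only [S.realF i x hx, Complex.ofReal_re]

lemma AngelescoSystem.integral_μ (S : AngelescoSystem α₁ β₁ α₂ β₂) (i : Fin 2)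
    (h : iLo α₁ α₂ i < iHi β₁ β₂ i) (u : ℝ → ℝ) :
    ∫ x, u x ∂ S.μ i = ∫ x in (iLo α₁ α₂ i)..(iHi β₁ β₂ i), u x * S.f i x := by
  rw [AngelescoSystem.μ, integral_withDensity_eq_integral_toReal_smul₀,
    intervalIntegral.integral_of_le h.le, ← integral_Icc_eq_integral_Ioc]
  · refine setIntegral_congr_fun measurableSet_Icc fun x hx => ?_
    simp only [smul_eq_mul]
    rw [ENNReal.toReal_ofReal (S.posf i x hx).le, mul_comm]
  · exact ((S.continuousOn_f i).aemeasurable measurableSet_Icc).ennreal_ofReal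
  · exact Filter.Eventually.of_forall fun x => ENNReal.ofReal_lt_top

/-- The orthogonality relations of multi-index `n`. -/
def AngelescoSystem.Orthogonal (S : AngelescoSystem α₁ β₁ α₂ β₂) (n : ℕ × ℕ) (G : ℝ[X]) : Prop :=
  ∀ i : Fin 2, ∀ r : ℝ[X], r.degree < nComp n i →
    ∫ x in (iLo α₁ α₂ i)..(iHi β₁ β₂ i), (G * r).eval x * S.f i x = 0

lemma AngelescoSystem.intervalIntegrable (S : AngelescoSystem α₁ β₁ α₂ β₂) (h₁ : α₁ < β₁)
    (h₃ : α₂ < β₂) (i : Fin 2) (G : ℝ[X]) :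
    IntervalIntegrable (fun x => G.eval x * S.f i x) volume (iLo α₁ α₂ i) (iHi β₁ β₂ i) :=
  intervalIntegrable_eval_mul (iLo_lt_iHi h₁ h₃ i) (S.continuousOn_f i) G.continuous.continuousOn

lemma AngelescoSystem.Orthogonal.combination {S : AngelescoSystem α₁ β₁ α₂ β₂} (h₁ : α₁ < β₁)
    (h₃ : α₂ < β₂) {n : ℕ × ℕ} {G H : ℝ[X]} (hG : S.Orthogonal n G) (hH : S.Orthogonal n H)
    (A B : ℝ) : S.Orthogonal n (C A * G + C B * H) := by
  intro i r hr
  have h : ∀ x, ((C A * G + C B * H) * r).eval x * S.f i x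
      = A * ((G * r).eval x * S.f i x) + B * ((H * r).eval x * S.f i x) := by
    intro x; simp only [eval_mul, eval_add, eval_C]; ring
  simp_rw [h]
  rw [intervalIntegral.integral_add ((S.intervalIntegrable h₁ h₃ i _).const_mul _)
    ((S.intervalIntegrable h₁ h₃ i _).const_mul _), intervalIntegral.integral_const_mul,
    intervalIntegral.integral_const_mul, hG i r hr, hH i r hr]
  simp

lemma AngelescoSystem.Orthogonal.mono {S : AngelescoSystem α₁ β₁ α₂ β₂} {n m : ℕ × ℕ}
    {G : ℝ[X]} (hG : S.Orthogonal m G) (h : ∀ i, nComp n i ≤ nComp m i) : S.Orthogonal n G :=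
  fun i r hr => hG i r (hr.trans_le (by exact_mod_cast h i))

lemma AngelescoSystem.Orthogonal.exists_zeros {S : AngelescoSystem α₁ β₁ α₂ β₂} (h₁ : α₁ < β₁)
    (h₂ : β₁ < α₂) (h₃ : α₂ < β₂) {n : ℕ × ℕ} {G V : ℝ[X]} (hG0 : G ≠ 0) (hV : V ≠ 0)
    (hG : S.Orthogonal n (G * V ^ 2)) :
    ∃ s : Fin 2 → Finset ℝ, (∀ i, ∀ x ∈ s i, x ∈ Ioo (iLo α₁ α₂ i) (iHi β₁ β₂ i)) ∧
      ((∏ y ∈ s 0, (X - C y)) * ∏ y ∈ s 1, (X - C y)) ∣ G ∧ ∀ i, nComp n i ≤ (s i).card := by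
  have hex : ∀ i : Fin 2, ∃ s : Finset ℝ, (∀ x ∈ s, x ∈ Ioo (iLo α₁ α₂ i) (iHi β₁ β₂ i)) ∧
      (∏ y ∈ s, (X - C y)) ∣ G ∧ nComp n i ≤ s.card := fun i =>
    exists_roots_of_orthogonal (iLo_lt_iHi h₁ h₃ i) (S.continuousOn_f i) (S.posf i) hG0 hV (hG i)
  choose s hs hdvd hcard using hex
  refine ⟨s, hs, IsCoprime.mul_dvd ?_ (hdvd 0) (hdvd 1), hcard⟩
  refine IsCoprime.prod_left fun x hx => IsCoprime.prod_right fun y hy => ?_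
  have hx' := (hs 0 x hx).2
  have hy' := (hs 1 y hy).1
  simp only [iLo, iHi] at hx' hy'
  have : x ≠ y := by
    have : x < y := by simp at hx' hy'; linarith
    exact this.ne
  exact isCoprime_X_sub_C_of_isUnit_sub (sub_ne_zero.mpr this).isUnit

lemma natDegree_prod_X_sub (s t : Finset ℝ) :
    ((∏ y ∈ s, (X - C y)) * ∏ y ∈ t, (X - C y) : ℝ[X]).natDegree = s.card + t.card := by
  rw [Monic.natDegree_mul (monic_prod_X_sub_C _ _) (monic_prod_X_sub_C _ _),
    natDegree_prod_of_monic _ _ fun y _ => monic_X_sub_C y,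
    natDegree_prod_of_monic _ _ fun y _ => monic_X_sub_C y]
  simp

lemma AngelescoSystem.Orthogonal.le_natDegree {S : AngelescoSystem α₁ β₁ α₂ β₂} (h₁ : α₁ < β₁)
    (h₂ : β₁ < α₂) (h₃ : α₂ < β₂) {n : ℕ × ℕ} {G V : ℝ[X]} (hG0 : G ≠ 0) (hV : V ≠ 0)
    (hG : S.Orthogonal n (G * V ^ 2)) : n.1 + n.2 ≤ G.natDegree := by
  obtain ⟨s, -, hdvd, hcard⟩ := hG.exists_zeros h₁ h₂ h₃ hG0 hV
  have h := natDegree_le_of_dvd hdvd hG0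
  rw [natDegree_prod_X_sub] at h
  have h0 := hcard 0
  have h1 := hcard 1
  simp only [nComp] at h0 h1
  simp at h0 h1
  omega

variable {S : AngelescoSystem α₁ β₁ α₂ β₂} {P : ℕ × ℕ → ℝ[X]}

lemma IsTypeII.orthogonal (h₁ : α₁ < β₁) (h₃ : α₂ < β₂) (hP : IsTypeII S P) (n : ℕ × ℕ) :
    S.Orthogonal n (P n) := by
  intro i r hr
  have h := (hP n).2.2 i
  simp_rw [S.integral_μ i (iLo_lt_iHi h₁ h₃ i)] at h
  simp_rw [eval_mul]
  exact orthogonal_of_natDegree_lt (iLo_lt_iHi h₁ h₃ i) (S.continuousOn_f i) h hr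

/-- `Z n i` is the set of zeros of `P n` in the `i`-th interval. -/
def IsZeroSet (α₁ β₁ α₂ β₂ : ℝ) (P : ℕ × ℕ → ℝ[X]) (Z : ℕ × ℕ → Fin 2 → Finset ℝ) : Prop :=
  ∀ n, (∀ i, ∀ x ∈ Z n i, x ∈ Ioo (iLo α₁ α₂ i) (iHi β₁ β₂ i)) ∧
    P n = (∏ y ∈ Z n 0, (X - C y)) * ∏ y ∈ Z n 1, (X - C y) ∧ ∀ i, (Z n i).card = nComp n i

lemma IsTypeII.exists_isZeroSet (h₁ : α₁ < β₁) (h₂ : β₁ < α₂) (h₃ : α₂ < β₂)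
    (hP : IsTypeII S P) : ∃ Z, IsZeroSet α₁ β₁ α₂ β₂ P Z := by
  have hex : ∀ n, ∃ s : Fin 2 → Finset ℝ,
      (∀ i, ∀ x ∈ s i, x ∈ Ioo (iLo α₁ α₂ i) (iHi β₁ β₂ i)) ∧
      P n = (∏ y ∈ s 0, (X - C y)) * ∏ y ∈ s 1, (X - C y) ∧ ∀ i, (s i).card = nComp n i := by
    intro n
    have h := hP.orthogonal h₁ h₃ n
    have hP0 := (hP n).1.ne_zero
    have hdeg := (hP n).2.1
    obtain ⟨s, hs, hdvd, hcard⟩ := AngelescoSystem.Orthogonal.exists_zeros (V := 1) h₁ h₂ h₃ hP0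
      one_ne_zero (by simpa using h)
    have hle := natDegree_le_of_dvd hdvd hP0
    have hnd := natDegree_prod_X_sub (s 0) (s 1)
    rw [hnd, hdeg] at hle
    have h0 := hcard 0
    have h1 := hcard 1
    simp [nComp] at h0 h1
    refine ⟨s, hs, ?_, ?_⟩
    · refine eq_of_monic_of_dvd_of_natDegree_le ?_ (hP n).1 hdvd (by rw [hnd, hdeg]; omega)
      exact (monic_prod_X_sub_C _ _).mul (monic_prod_X_sub_C _ _)
    · intro i
      fin_cases i <;> simp [nComp] <;> omega
  choose Z hZ using hex
  exact ⟨Z, hZ⟩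

lemma nComp_le_add_evec (n : ℕ × ℕ) (j i : Fin 2) : nComp n i ≤ nComp (n + evec j) i := by
  fin_cases i <;> fin_cases j <;> simp [nComp, evec]

/-- The Wronskian of neighbouring multiple orthogonal polynomials does not vanish. -/
lemma IsTypeII.wronskian_ne_zero (h₁ : α₁ < β₁) (h₂ : β₁ < α₂) (h₃ : α₂ < β₂)
    (hP : IsTypeII S P) (n : ℕ × ℕ) (j : Fin 2) (y : ℝ) :
    (P n).eval y * (P (n + evec j)).derivative.eval y
      - (P n).derivative.eval y * (P (n + evec j)).eval y ≠ 0 := by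
  intro hW
  set G := P n
  set H := P (n + evec j)
  have hdG : G.natDegree = n.1 + n.2 := (hP n).2.1
  have hdH : H.natDegree = n.1 + n.2 + 1 := by
    rw [(hP (n + evec j)).2.1]
    fin_cases j <;> simp [evec] <;> omega
  have hG0 : G ≠ 0 := (hP n).1.ne_zero
  have hH0 : H ≠ 0 := (hP _).1.ne_zero
  have hoG := hP.orthogonal h₁ h₃ n
  have hoH := (hP.orthogonal h₁ h₃ (n + evec j)).mono (nComp_le_add_evec n j)
  have key : ∀ A B : ℝ, (A ≠ 0 ∨ B ≠ 0) → A * G.eval y + B * H.eval y = 0 →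
      A * G.derivative.eval y + B * H.derivative.eval y = 0 → False := by
    intro A B hAB h0 h1
    set K := C A * G + C B * H with hK
    have hK0 : K ≠ 0 := by
      by_cases hB : B = 0
      · have hA : A ≠ 0 := by simpa [hB] using hAB
        rw [hK, hB]; simp [hA, hG0]
      · intro hK0
        have h2 : K.coeff (n.1 + n.2 + 1) = B := by
          have : H.coeff (n.1 + n.2 + 1) = 1 := by rw [← hdH]; exact (hP _).1
          rw [hK, coeff_add, coeff_C_mul, coeff_C_mul, this,
            coeff_eq_zero_of_natDegree_lt (by omega)]
          ring
        rw [hK0] at h2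
        exact hB (by simpa using h2.symm)
    have hKd : K.natDegree ≤ n.1 + n.2 + 1 := by
      refine (natDegree_add_le _ _).trans (max_le ?_ ?_)
      · exact (natDegree_C_mul_le _ _).trans (by omega)
      · exact (natDegree_C_mul_le _ _).trans hdH.le
    have hroot : (X - C y) ^ 2 ∣ K := by
      refine (le_rootMultiplicity_iff hK0).mp ?_
      refine (one_lt_rootMultiplicity_iff_isRoot hK0).mpr ⟨?_, ?_⟩
      · simp [hK, h0]
      · simp [hK, h1]
    obtain ⟨K₁, hK₁⟩ := hroot
    have hK₁0 : K₁ ≠ 0 := by rintro rfl; exact hK0 (by simpa using hK₁)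
    have ho : S.Orthogonal n (K₁ * (X - C y) ^ 2) := by
      rw [mul_comm, ← hK₁]; exact hoG.combination h₁ h₃ hoH A B
    have := ho.le_natDegree h₁ h₂ h₃ hK₁0 (X_sub_C_ne_zero y)
    rw [hK₁, natDegree_mul (pow_ne_zero _ (X_sub_C_ne_zero y)) hK₁0, natDegree_pow,
      natDegree_X_sub_C] at hKd
    omega
  by_cases h : G.eval y = 0 ∧ H.eval y = 0
  · by_cases h' : G.derivative.eval y = 0 ∧ H.derivative.eval y = 0
    · exact key 1 0 (by simp) (by simp [h.1]) (by simp [h'.1])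
    · refine key (H.derivative.eval y) (-G.derivative.eval y) ?_ (by simp [h.1, h.2]) (by ring)
      by_contra! hh
      exact h' ⟨by simpa using hh.2, hh.1⟩
  · refine key (H.eval y) (-G.eval y) ?_ (by ring) (by linarith)
    by_contra! hh
    exact h ⟨by simpa using hh.2, hh.1⟩

lemma IsZeroSet.mem_iff (h₂ : β₁ < α₂) {Z : ℕ × ℕ → Fin 2 → Finset ℝ}
    (hZ : IsZeroSet α₁ β₁ α₂ β₂ P Z) (n : ℕ × ℕ) (i : Fin 2) (x : ℝ) :
    x ∈ Z n i ↔ x ∈ Ioo (iLo α₁ α₂ i) (iHi β₁ β₂ i) ∧ (P n).eval x = 0 := by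
  obtain ⟨hmem, hprod, -⟩ := hZ n
  have hev : (P n).eval x = 0 ↔ x ∈ Z n 0 ∨ x ∈ Z n 1 := by
    rw [hprod, eval_mul, mul_eq_zero, eval_prod, eval_prod, Finset.prod_eq_zero_iff,
      Finset.prod_eq_zero_iff]
    simp [sub_eq_zero]
  have h0 := hmem 0 x
  have h1 := hmem 1 x
  rw [hev]
  simp [iLo, iHi] at h0 h1
  fin_cases i <;> simp [iLo, iHi]
  · constructor
    · intro h; exact ⟨h0 h, Or.inl h⟩
    · rintro ⟨⟨_, h⟩, h' | h'⟩
      · exact h'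
      · linarith [(h1 h').1]
  · constructor
    · intro h; exact ⟨h1 h, Or.inr h⟩
    · rintro ⟨⟨h, _⟩, h' | h'⟩
      · linarith [(h0 h').2]
      · exact h'

lemma IsTypeII.interlace (h₁ : α₁ < β₁) (h₂ : β₁ < α₂) (h₃ : α₂ < β₂)
    (hP : IsTypeII S P) {Z : ℕ × ℕ → Fin 2 → Finset ℝ} (hZ : IsZeroSet α₁ β₁ α₂ β₂ P Z)
    (n : ℕ × ℕ) (j i : Fin 2) :
    (∀ x ∈ Z n i, ∀ y ∈ Z n i, x < y → ∃ z ∈ Z (n + evec j) i, z ∈ Ioo x y) ∧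
    (∀ x ∈ Z (n + evec j) i, ∀ y ∈ Z (n + evec j) i, x < y → ∃ z ∈ Z n i, z ∈ Ioo x y) := by
  have hW := hP.wronskian_ne_zero h₁ h₂ h₃ n j
  simp_rw [hZ.mem_iff h₂]
  constructor
  · rintro x ⟨hx, hx0⟩ y ⟨hy, hy0⟩ hxy
    obtain ⟨z, hz, hz0⟩ := exists_root_between hW hxy hx0 hy0
    exact ⟨z, ⟨⟨hx.1.trans hz.1, hz.2.trans hy.2⟩, hz0⟩, hz⟩
  · rintro x ⟨hx, hx0⟩ y ⟨hy, hy0⟩ hxy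
    obtain ⟨z, hz, hz0⟩ := exists_root_between (H := P n)
      (fun x => by have := hW x; contrapose! this; linarith) hxy hx0 hy0
    exact ⟨z, ⟨⟨hx.1.trans hz.1, hz.2.trans hy.2⟩, hz0⟩, hz⟩

end Structure

section Circle
open Polynomial Set

lemma continuous_aeval_exp (R : ℝ[X]) :
    Continuous fun θ : ℝ => aeval (Complex.exp (θ * Complex.I)) R :=
  R.continuous_aeval.comp (by fun_prop)

lemma two_pi_mul_norm_sq_le {F : ℂ → ℂ} (hF : DiffContOnCl ℂ F (Metric.ball 0 1)) :
    2 * Real.pi * ‖F 0‖ ^ 2 ≤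
      ∫ θ in (0 : ℝ)..2 * Real.pi, ‖F (Complex.exp (θ * Complex.I))‖ ^ 2 := by
  have h2 : DiffContOnCl ℂ (fun z => F z • F z) (Metric.ball 0 |1|) := by
    rw [abs_one]; exact hF.smul hF
  have h := h2.circleAverage
  rw [Real.circleAverage_def] at h
  have h3 : ‖F 0‖ ^ 2 = ‖(2 * Real.pi)⁻¹ • ∫ θ in (0 : ℝ)..2 * Real.pi,
      (fun z => F z • F z) (circleMap 0 1 θ)‖ := by
    rw [h]; simp [pow_two]
  rw [norm_smul, Real.norm_of_nonneg (by positivity)] at h3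
  have hpi : (0 : ℝ) < 2 * Real.pi := by positivity
  rw [h3, mul_inv_cancel_left₀ hpi.ne']
  refine (intervalIntegral.norm_integral_le_integral_norm hpi.le).trans (le_of_eq ?_)
  refine intervalIntegral.integral_congr fun θ _ => ?_
  simp [circleMap, pow_two]

lemma integral_eq_circle {m lam : ℝ} (hlam : 0 < lam) {u : ℝ → ℝ}
    (hu : ContinuousOn u (Icc (m - 2 * lam) (m + 2 * lam))) :
    ∫ x in (m - 2 * lam)..(m + 2 * lam), u x
      = lam * ∫ θ in (0 : ℝ)..2 * Real.pi, u (m + lam * (2 * Real.cos θ)) * |Real.sin θ| := by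
  have hmaps : ∀ θ : ℝ, m + lam * (2 * Real.cos θ) ∈ Icc (m - 2 * lam) (m + 2 * lam) := by
    intro θ
    constructor <;> nlinarith [Real.neg_one_le_cos θ, Real.cos_le_one θ]
  have hcont : Continuous fun θ : ℝ => u (m + lam * (2 * Real.cos θ)) :=
    hu.comp_continuous (by fun_prop) hmaps
  have hderiv : ∀ θ : ℝ, HasDerivAt (fun θ => m + lam * (2 * Real.cos θ))
      (-(2 * lam) * Real.sin θ) θ := by
    intro θ
    have := (((Real.hasDerivAt_cos θ).const_mul 2).const_mul lam).const_add m
    exact this.congr_deriv (by ring)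
  have hsub : ∀ a b : ℝ, ∫ θ in a..b, u (m + lam * (2 * Real.cos θ)) * (-(2 * lam) * Real.sin θ)
      = ∫ x in (m + lam * (2 * Real.cos a))..(m + lam * (2 * Real.cos b)), u x := by
    intro a b
    refine intervalIntegral.integral_comp_mul_deriv''
      (f := fun θ => m + lam * (2 * Real.cos θ)) (g := u) (by fun_prop)
      (fun x _ => (hderiv x).hasDerivWithinAt) (by fun_prop) (hu.mono ?_)
    rintro _ ⟨θ, _, rfl⟩
    exact hmaps θ
  have hpi := Real.pi_pos
  have h1 : ∫ θ in (0 : ℝ)..Real.pi, u (m + lam * (2 * Real.cos θ)) * |Real.sin θ|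
      = (2 * lam)⁻¹ * ∫ x in (m - 2 * lam)..(m + 2 * lam), u x := by
    have := hsub 0 Real.pi
    rw [Real.cos_zero, Real.cos_pi] at this
    rw [show m - 2 * lam = m + lam * (2 * -1) by ring, show m + 2 * lam = m + lam * (2 * 1) by ring,
      intervalIntegral.integral_symm (m + lam * (2 * 1)), ← this, ← intervalIntegral.integral_neg,
      ← intervalIntegral.integral_const_mul]
    refine intervalIntegral.integral_congr fun θ hθ => ?_
    rw [uIcc_of_le hpi.le] at hθ
    simp only [abs_of_nonneg (Real.sin_nonneg_of_mem_Icc hθ)]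
    field_simp
  have h2 : ∫ θ in Real.pi..2 * Real.pi, u (m + lam * (2 * Real.cos θ)) * |Real.sin θ|
      = (2 * lam)⁻¹ * ∫ x in (m - 2 * lam)..(m + 2 * lam), u x := by
    have := hsub Real.pi (2 * Real.pi)
    rw [Real.cos_two_pi, Real.cos_pi] at this
    rw [show m - 2 * lam = m + lam * (2 * -1) by ring, show m + 2 * lam = m + lam * (2 * 1) by ring,
      ← this, ← intervalIntegral.integral_const_mul]
    refine intervalIntegral.integral_congr fun θ hθ => ?_
    rw [uIcc_of_le (by linarith)] at hθ
    have hs : Real.sin θ ≤ 0 := by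
      have := Real.sin_nonneg_of_mem_Icc (x := θ - Real.pi) ⟨by linarith [hθ.1], by linarith [hθ.2]⟩
      rw [Real.sin_sub_pi] at this; linarith
    simp only [abs_of_nonpos hs]
    field_simp
  have hint : Continuous fun θ => u (m + lam * (2 * Real.cos θ)) * |Real.sin θ| :=
    hcont.mul (by fun_prop)
  rw [← intervalIntegral.integral_add_adjacent_intervals (hint.intervalIntegrable 0 Real.pi)
    (hint.intervalIntegrable _ _), h1, h2]
  field_simp
  ring

lemma ofReal_two_mul_cos (θ : ℝ) : ((2 * Real.cos θ : ℝ) : ℂ)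
    = Complex.exp (θ * Complex.I) + Complex.exp (-(θ * Complex.I)) := by
  push_cast
  rw [Complex.cos, neg_mul]; ring

/-- A real polynomial in `2 cos θ` times `z ^ M` is a polynomial in `z = exp (iθ)`. -/
lemma exists_aeval_exp_eq (V : ℝ[X]) (M : ℕ) (hV : V.natDegree ≤ M) :
    ∃ R : ℝ[X], R.eval 0 = V.coeff M ∧ ∀ θ : ℝ, aeval (Complex.exp (θ * Complex.I)) R
      = Complex.exp (θ * Complex.I) ^ M * ((V.eval (2 * Real.cos θ) : ℝ) : ℂ) := by
  refine ⟨∑ k ∈ Finset.range (M + 1), C (V.coeff k) * X ^ (M - k) * (X ^ 2 + 1) ^ k, ?_, ?_⟩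
  · rw [eval_finsetSum, Finset.sum_range_succ]
    rw [Finset.sum_eq_zero]
    · simp
    · intro k hk
      have : M - k ≠ 0 := by have := Finset.mem_range.mp hk; omega
      simp [this]
  · intro θ
    rw [eval_eq_sum_range' (Nat.lt_succ_of_le hV), map_sum, Complex.ofReal_sum, Finset.mul_sum]
    refine Finset.sum_congr rfl fun k hk => ?_
    have hk : k ≤ M := Nat.lt_succ_iff.mp (Finset.mem_range.mp hk)
    have hz : Complex.exp (θ * Complex.I) ^ 2 + 1
        = Complex.exp (θ * Complex.I) * ((2 * Real.cos θ : ℝ) : ℂ) := by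
      have : Complex.exp (θ * Complex.I) * Complex.exp (-(θ * Complex.I)) = 1 := by
        rw [← Complex.exp_add, add_neg_cancel, Complex.exp_zero]
      rw [ofReal_two_mul_cos]
      linear_combination -this
    have hp : Complex.exp (θ * Complex.I) ^ M
        = Complex.exp (θ * Complex.I) ^ (M - k) * Complex.exp (θ * Complex.I) ^ k := by
      rw [← pow_add, Nat.sub_add_cancel hk]
    simp only [map_mul, map_pow, map_add, map_one, aeval_X, aeval_C, hz, hp, mul_pow,
      Complex.ofReal_mul, Complex.ofReal_pow, Complex.coe_algebraMap]
    ring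

lemma chebyshev_C_coeff (n : ℕ) : (Chebyshev.C ℝ ((n : ℤ) + 1)).natDegree ≤ n + 1 ∧
    (Chebyshev.C ℝ ((n : ℤ) + 1)).coeff (n + 1) = 1 ∧
    (Chebyshev.C ℝ ((n : ℤ) + 1)).coeff n = 0 := by
  induction n using Nat.strong_induction_on with
  | _ n ih =>
  match n with
  | 0 => simp
  | 1 =>
    have : Chebyshev.C ℝ (((1 : ℕ) : ℤ) + 1) = X ^ 2 - C 2 := by
      rw [show (((1 : ℕ) : ℤ) + 1) = 2 by norm_num, Chebyshev.C_two]; rfl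
    rw [this]
    refine ⟨by compute_degree, ?_, ?_⟩ <;> simp [coeff_X_pow]
  | n + 2 =>
    obtain ⟨a1, a2, a3⟩ := ih n (by omega)
    obtain ⟨b1, b2, b3⟩ := ih (n + 1) (by omega)
    have h : Chebyshev.C ℝ (((n + 2 : ℕ) : ℤ) + 1)
        = X * Chebyshev.C ℝ (((n + 1 : ℕ) : ℤ) + 1) - Chebyshev.C ℝ ((n : ℤ) + 1) := by
      rw [Chebyshev.C_eq]; congr 3 <;> push_cast <;> ring_nf
    rw [h]
    refine ⟨?_, ?_, ?_⟩
    · refine (natDegree_sub_le _ _).trans (max_le ?_ (by omega))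
      refine natDegree_mul_le.trans ?_
      rw [natDegree_X]; omega
    · rw [coeff_sub, coeff_X_mul, b2, coeff_eq_zero_of_natDegree_lt (by omega), sub_zero]
    · rw [coeff_sub, coeff_X_mul, b3, coeff_eq_zero_of_natDegree_lt (by omega), sub_zero]

/-- The polynomial `v` with `v (2 cos θ) = 2 Re (z ^ (-N) T z)`. -/
lemma exists_trial (N : ℕ) (hN : 2 ≤ N) (T : ℝ[X]) (hT : T.natDegree < N) (hT0 : T.coeff 0 = 1) :
    ∃ v : ℝ[X], v.natDegree ≤ N ∧ v.coeff N = 1 ∧ v.coeff (N - 1) = T.coeff 1 ∧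
      ∀ θ : ℝ, v.eval (2 * Real.cos θ)
        = 2 * (Complex.exp (-(N * (θ * Complex.I))) *
          aeval (Complex.exp (θ * Complex.I)) T).re := by
  have hdeg : ∀ k < N, (Chebyshev.C ℝ ((N : ℤ) - k)).natDegree ≤ N - k ∧
      (Chebyshev.C ℝ ((N : ℤ) - k)).coeff (N - k) = 1 ∧
      (Chebyshev.C ℝ ((N : ℤ) - k)).coeff (N - k - 1) = 0 := by
    intro k hk
    have h := chebyshev_C_coeff (N - k - 1)
    rw [show N - k - 1 + 1 = N - k by omega,
      show ((N - k - 1 : ℕ) : ℤ) + 1 = (N : ℤ) - k by omega] at h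
    exact h
  refine ⟨∑ k ∈ Finset.range N, C (T.coeff k) * Chebyshev.C ℝ ((N : ℤ) - k), ?_, ?_, ?_, ?_⟩
  · refine natDegree_sum_le_of_forall_le _ _ fun k hk => ?_
    refine (natDegree_C_mul_le _ _).trans ?_
    have := (hdeg k (Finset.mem_range.mp hk)).1
    omega
  · rw [finsetSum_coeff, Finset.sum_eq_single 0]
    · rw [coeff_C_mul, hT0]; simpa using (hdeg 0 (by omega)).2.1
    · intro k hk hk0
      have := (hdeg k (Finset.mem_range.mp hk)).1
      have := Finset.mem_range.mp hk
      rw [coeff_C_mul, coeff_eq_zero_of_natDegree_lt (p := Chebyshev.C ℝ ((N : ℤ) - k)) (by omega),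
        mul_zero]
    · intro h; exact absurd (Finset.mem_range.mpr (by omega)) h
  · rw [finsetSum_coeff, Finset.sum_eq_single 1]
    · have := (hdeg 1 (by omega)).2.1
      rw [coeff_C_mul]; push_cast at this ⊢; rw [this, mul_one]
    · intro k hk hk1
      rw [coeff_C_mul]
      rcases Nat.eq_zero_or_pos k with rfl | hk0
      · have := (hdeg 0 (by omega)).2.2
        simp only [Nat.sub_zero] at this
        rw [this, mul_zero]
      · have := (hdeg k (Finset.mem_range.mp hk)).1
        have := Finset.mem_range.mp hk
        rw [coeff_eq_zero_of_natDegree_lt (p := Chebyshev.C ℝ ((N : ℤ) - k)) (by omega), mul_zero]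
    · intro h; exact absurd (Finset.mem_range.mpr (by omega)) h
  · intro θ
    rw [aeval_eq_sum_range' hT, Finset.mul_sum, Complex.re_sum, Finset.mul_sum, eval_finsetSum]
    refine Finset.sum_congr rfl fun k _ => ?_
    rw [eval_mul, eval_C, Chebyshev.C_two_mul_real_cos, ← Complex.exp_nat_mul]
    have : Complex.exp (-(N * (θ * Complex.I))) * T.coeff k • Complex.exp (k * (θ * Complex.I))
        = T.coeff k • Complex.exp (((-((N - k : ℝ) * θ) : ℝ) : ℂ) * Complex.I) := by
      rw [mul_smul_comm, ← Complex.exp_add]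
      congr 2; push_cast; ring
    rw [this, Complex.smul_re, Complex.exp_ofReal_mul_I_re, Real.cos_neg]
    push_cast
    simp only [smul_eq_mul]; ring

end Circle

section Extremal
open Polynomial Set

lemma integral_combination {a b : ℝ} {f g h : ℝ → ℝ} (hf : Continuous f) (hg : Continuous g)
    (hh : Continuous h) (A B C : ℝ) :
    ∫ θ in a..b, (A * f θ + B * g θ + C * h θ)
      = A * (∫ θ in a..b, f θ) + B * (∫ θ in a..b, g θ) + C * ∫ θ in a..b, h θ := by
  rw [intervalIntegral.integral_add, intervalIntegral.integral_add,
    intervalIntegral.integral_const_mul, intervalIntegral.integral_const_mul,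
    intervalIntegral.integral_const_mul]
  all_goals exact Continuous.intervalIntegrable (by fun_prop) _ _

lemma exists_reflected (T : ℝ[X]) {N : ℕ} (hT : T.natDegree < N) :
    ∃ T' : ℝ[X], T'.eval 0 = 0 ∧ ∀ θ : ℝ, aeval (Complex.exp (θ * Complex.I)) T'
      = Complex.exp (θ * Complex.I) ^ (2 * N) *
        (starRingEnd ℂ) (aeval (Complex.exp (θ * Complex.I)) T) := by
  refine ⟨∑ k ∈ Finset.range N, C (T.coeff k) * X ^ (2 * N - k), ?_, fun θ => ?_⟩
  · rw [eval_finsetSum]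
    refine Finset.sum_eq_zero fun k hk => ?_
    have : 2 * N - k ≠ 0 := by have := Finset.mem_range.mp hk; omega
    simp [this]
  · rw [aeval_eq_sum_range' hT, map_sum, map_sum, Finset.mul_sum]
    refine Finset.sum_congr rfl fun k hk => ?_
    have hk := Finset.mem_range.mp hk
    set z := Complex.exp (θ * Complex.I)
    have hz : z * (starRingEnd ℂ) z = 1 := by
      rw [Complex.mul_conj, Complex.normSq_eq_norm_sq, Complex.norm_exp_ofReal_mul_I]; simp
    have hp : z ^ (2 * N) * (starRingEnd ℂ) z ^ k = z ^ (2 * N - k) := by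
      rw [show 2 * N = (2 * N - k) + k by omega, pow_add, mul_assoc, ← mul_pow, hz]; simp
    simp only [map_mul, aeval_C, map_pow, aeval_X, Complex.real_smul, Complex.conj_ofReal,
      Complex.coe_algebraMap]
    rw [← hp]; ring

/-- Stability of the extremal problem on the circle: a nearly extremal polynomial `T` determines
the norm and the second coefficient of the orthogonal polynomial. -/
lemma abs_orthogonal_sub_le {W : ℝ → ℝ} (hW : Continuous W) (hW0 : ∀ θ, 0 ≤ W θ) {D η : ℝ}
    (hD : 0 < D) (hη0 : 0 ≤ η) (hη1 : η ≤ 1)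
    (hlow : ∀ R : ℝ[X], D * R.eval 0 ^ 2
      ≤ ∫ θ in (0 : ℝ)..2 * Real.pi, ‖aeval (Complex.exp (θ * Complex.I)) R‖ ^ 2 * W θ)
    {N : ℕ} (hN : 2 ≤ N) {T : ℝ[X]} (hT : T.natDegree < N) (hT0 : T.coeff 0 = 1)
    (hI : ∫ θ in (0 : ℝ)..2 * Real.pi, ‖aeval (Complex.exp (θ * Complex.I)) T‖ ^ 2 * W θ
      ≤ D * (1 + η ^ 2))
    {q : ℝ[X]} (hq : q.Monic) (hqN : q.natDegree = N)
    (horth : ∀ r : ℝ[X], r.natDegree < N → ∫ θ in (0 : ℝ)..2 * Real.pi,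
      q.eval (2 * Real.cos θ) * r.eval (2 * Real.cos θ) * W θ = 0) :
    |(∫ θ in (0 : ℝ)..2 * Real.pi, q.eval (2 * Real.cos θ) ^ 2 * W θ) - 2 * D| ≤ 8 * η * D ∧
      |q.coeff (N - 1) - T.coeff 1| ≤ 2 * η := by
  obtain ⟨v, hv1, hv2, hv3, hv4⟩ := exists_trial N hN T hT hT0
  obtain ⟨T', hT'0, hT'⟩ := exists_reflected T hT
  have hVdeg : (q - v).natDegree ≤ N - 1 := by
    rw [natDegree_le_iff_coeff_eq_zero]
    intro k hk
    rcases eq_or_lt_of_le (show N ≤ k by omega) with rfl | h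
    · rw [coeff_sub, hv2, ← hqN, hq.coeff_natDegree, sub_self]
    · rw [coeff_sub, coeff_eq_zero_of_natDegree_lt (p := v) (by omega),
        coeff_eq_zero_of_natDegree_lt (p := q) (by omega), sub_self]
  obtain ⟨R, hR0, hR⟩ := exists_aeval_exp_eq (q - v) (N - 1) hVdeg
  set A : ℝ → ℂ := fun θ => Complex.exp (-(N * (θ * Complex.I))) *
    aeval (Complex.exp (θ * Complex.I)) T with hA
  have hAc : Continuous A := by
    have := continuous_aeval_exp T
    fun_prop
  set V : ℝ → ℝ := fun θ => (q - v).eval (2 * Real.cos θ) with hV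
  have hVc : Continuous V := (q - v).continuous.comp (by fun_prop)
  have hAN : ∀ θ : ℝ, aeval (Complex.exp (θ * Complex.I)) T
      = Complex.exp (θ * Complex.I) ^ N * A θ := by
    intro θ
    rw [hA, ← mul_assoc, ← Complex.exp_nat_mul, ← Complex.exp_add, add_neg_cancel, Complex.exp_zero,
      one_mul]
  have hnorm : ∀ θ : ℝ, ∀ k : ℕ, ∀ B : ℂ, ‖Complex.exp (θ * Complex.I) ^ k * B‖ ^ 2
      = B.re * B.re + B.im * B.im := by
    intro θ k B
    rw [norm_mul, norm_pow, Complex.norm_exp_ofReal_mul_I, one_pow, one_mul,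
      ← Complex.normSq_eq_norm_sq, Complex.normSq_apply]
  have hAre : Continuous fun θ => (A θ).re := Complex.continuous_re.comp hAc
  have hAim : Continuous fun θ => (A θ).im := Complex.continuous_im.comp hAc
  set I := ∫ θ in (0 : ℝ)..2 * Real.pi, ((A θ).re * (A θ).re + (A θ).im * (A θ).im) * W θ with hIdef
  set c₁ := ∫ θ in (0 : ℝ)..2 * Real.pi, ((A θ).re * (A θ).re - (A θ).im * (A θ).im) * W θ with hc₁
  set c₂ := ∫ θ in (0 : ℝ)..2 * Real.pi, (A θ).re * V θ * W θ with hc₂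
  set v₂ := ∫ θ in (0 : ℝ)..2 * Real.pi, V θ ^ 2 * W θ with hv₂
  have hI' : I ≤ D * (1 + η ^ 2) := by
    refine le_trans (le_of_eq ?_) hI
    refine intervalIntegral.integral_congr fun θ _ => ?_
    simp only [hAN, hnorm]
  have H1 : ∀ μ : ℝ, 0 ≤ I * (μ * μ) + 2 * c₁ * μ + (I - D) := by
    intro μ
    have h := hlow (T + C μ * T')
    have h0 : (T + C μ * T').eval 0 = 1 := by
      rw [eval_add, eval_mul, hT'0, mul_zero, add_zero, ← coeff_zero_eq_eval_zero, hT0]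
    rw [h0] at h
    have : ∀ θ : ℝ, ‖aeval (Complex.exp (θ * Complex.I)) (T + C μ * T')‖ ^ 2 * W θ
        = (1 + μ * μ) * (((A θ).re * (A θ).re + (A θ).im * (A θ).im) * W θ)
          + (2 * μ) * (((A θ).re * (A θ).re - (A θ).im * (A θ).im) * W θ)
          + 0 * ((A θ).re * V θ * W θ) := by
      intro θ
      have e : aeval (Complex.exp (θ * Complex.I)) (T + C μ * T')
          = Complex.exp (θ * Complex.I) ^ N * (A θ + μ * (starRingEnd ℂ) (A θ)) := by
        have hz : Complex.exp (θ * Complex.I) * (starRingEnd ℂ) (Complex.exp (θ * Complex.I))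
            = 1 := by
          rw [Complex.mul_conj, Complex.normSq_eq_norm_sq, Complex.norm_exp_ofReal_mul_I]; simp
        rw [map_add, map_mul, hT', hAN, map_mul, map_pow, aeval_C, Complex.coe_algebraMap, two_mul,
          pow_add]
        have hz' := congrArg (· ^ N) hz
        simp only [mul_pow, one_pow] at hz'
        linear_combination (μ : ℂ) * Complex.exp (θ * Complex.I) ^ N * (starRingEnd ℂ) (A θ) * hz'
      rw [e, hnorm]
      simp
      ring
    simp_rw [this] at h
    rw [integral_combination (by fun_prop) (by fun_prop) (by fun_prop)] at h
    linarith
  have H2 : ∀ μ : ℝ, 0 ≤ v₂ * (μ * μ) + 2 * c₂ * μ + (I - D) := by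
    intro μ
    have h := hlow (T + C μ * (X * R))
    have h0 : (T + C μ * (X * R)).eval 0 = 1 := by
      simp [← coeff_zero_eq_eval_zero, hT0]
    rw [h0] at h
    have : ∀ θ : ℝ, ‖aeval (Complex.exp (θ * Complex.I)) (T + C μ * (X * R))‖ ^ 2 * W θ
        = 1 * (((A θ).re * (A θ).re + (A θ).im * (A θ).im) * W θ)
          + (2 * μ) * ((A θ).re * V θ * W θ) + (μ * μ) * (V θ ^ 2 * W θ) := by
      intro θ
      have e : aeval (Complex.exp (θ * Complex.I)) (T + C μ * (X * R))
          = Complex.exp (θ * Complex.I) ^ N * (A θ + μ * V θ) := by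
        rw [map_add, map_mul, map_mul, aeval_X, hR, hAN, aeval_C, Complex.coe_algebraMap]
        have hp : Complex.exp (θ * Complex.I) ^ N
            = Complex.exp (θ * Complex.I) * Complex.exp (θ * Complex.I) ^ (N - 1) := by
          rw [← pow_succ', Nat.sub_add_cancel (by omega)]
        rw [hp]; simp only [hV]; ring
      rw [e, hnorm]
      simp
      ring
    simp_rw [this] at h
    rw [integral_combination (by fun_prop) (by fun_prop) (by fun_prop)] at h
    linarith
  have hpi : (0 : ℝ) ≤ 2 * Real.pi := by positivity
  have hv₂0 : 0 ≤ v₂ := intervalIntegral.integral_nonneg hpi fun θ _ =>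
    mul_nonneg (sq_nonneg _) (hW0 θ)
  have horth' : 2 * c₂ + v₂ = 0 := by
    have h := horth (q - v) (by omega)
    have : ∀ θ : ℝ, q.eval (2 * Real.cos θ) * (q - v).eval (2 * Real.cos θ) * W θ
        = 2 * ((A θ).re * V θ * W θ) + 1 * (V θ ^ 2 * W θ) + 0 * (V θ ^ 2 * W θ) := by
      intro θ
      have : q.eval (2 * Real.cos θ) = 2 * (A θ).re + V θ := by
        simp only [hV, hA, eval_sub, hv4]; ring
      rw [this]; simp only [hV]; ring
    simp_rw [this] at h
    rw [integral_combination (by fun_prop) (by fun_prop) (by fun_prop)] at h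
    linarith
  have hh : ∫ θ in (0 : ℝ)..2 * Real.pi, q.eval (2 * Real.cos θ) ^ 2 * W θ
      = 2 * I + 2 * c₁ + (4 * c₂ + v₂) := by
    have : ∀ θ : ℝ, q.eval (2 * Real.cos θ) ^ 2 * W θ
        = 1 * (2 * (((A θ).re * (A θ).re + (A θ).im * (A θ).im) * W θ)
          + 2 * (((A θ).re * (A θ).re - (A θ).im * (A θ).im) * W θ)
          + 0 * (V θ ^ 2 * W θ))
          + 4 * ((A θ).re * V θ * W θ) + 1 * (V θ ^ 2 * W θ) := by
      intro θ
      have : q.eval (2 * Real.cos θ) = 2 * (A θ).re + V θ := by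
        simp only [hV, hA, eval_sub, hv4]; ring
      rw [this]; ring
    simp_rw [this]
    rw [integral_combination (by fun_prop) (by fun_prop) (by fun_prop),
      integral_combination (by fun_prop) (by fun_prop) (by fun_prop)]
    ring
  have hID : 0 ≤ I - D := by simpa using H1 0
  have d1 : c₁ ^ 2 ≤ I * (I - D) := by
    have := discrim_le_zero H1
    rw [discrim] at this; nlinarith
  have d2 : c₂ ^ 2 ≤ v₂ * (I - D) := by
    have := discrim_le_zero H2
    rw [discrim] at this; nlinarith
  have hv₂4 : v₂ ≤ 4 * (I - D) := by
    rcases hv₂0.eq_or_lt with h | h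
    · rw [← h]; linarith
    · have : c₂ = -v₂ / 2 := by linarith
      rw [this] at d2
      by_contra! hc
      nlinarith
  have hη2 : η ^ 2 ≤ η := by nlinarith
  have hIDη : I - D ≤ D * η ^ 2 := by linarith
  have hc₁' : |c₁| ≤ 2 * η * D := by
    refine abs_le_of_sq_le_sq ?_ (by positivity)
    have hI2 : I ≤ 2 * D := by nlinarith
    calc c₁ ^ 2 ≤ I * (I - D) := d1
      _ ≤ (2 * D) * (D * η ^ 2) := by gcongr
      _ ≤ _ := by nlinarith [mul_nonneg (sq_nonneg D) (sq_nonneg η)]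
  constructor
  · rw [hh, abs_le]
    have := abs_le.mp hc₁'
    have : D * η ^ 2 ≤ D * η := by gcongr
    constructor <;> linarith
  · have h := hlow R
    have e : ∫ θ in (0 : ℝ)..2 * Real.pi,
        ‖aeval (Complex.exp (θ * Complex.I)) R‖ ^ 2 * W θ = v₂ := by
      refine intervalIntegral.integral_congr fun θ _ => ?_
      simp only [hR, hnorm, Complex.ofReal_re, Complex.ofReal_im, hV]
      ring
    rw [e, hR0, coeff_sub, hv3] at h
    refine abs_le_of_sq_le_sq ?_ (by positivity)
    have : D * (q.coeff (N - 1) - T.coeff 1) ^ 2 ≤ D * (2 * η) ^ 2 := by nlinarith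
    exact le_of_mul_le_mul_left this hD

end Extremal

section Product
open Polynomial Set

lemma conj_exp_ofReal_mul_I (θ : ℝ) : (starRingEnd ℂ) (Complex.exp (θ * Complex.I))
    = Complex.exp ((-θ : ℝ) * Complex.I) := by
  rw [← Complex.exp_conj]
  simp

lemma exists_real_taylor {E : ℂ → ℂ} {ρ K : ℝ} (hρ : 1 < ρ)
    (hE : DiffContOnCl ℂ E (Metric.ball 0 ρ)) (hK : ∀ z ∈ Metric.sphere 0 ρ, ‖E z‖ ≤ K) {N : ℕ}
    (hN : 2 ≤ N) :
    ∃ T : ℝ[X], T.natDegree < N ∧ T.coeff 0 = (E 0).re ∧ T.coeff 1 = (deriv E 0).re ∧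
      ∀ θ : ℝ, ‖aeval (Complex.exp (θ * Complex.I)) T‖
        ≤ (‖E (Complex.exp (θ * Complex.I))‖ + ‖E (Complex.exp ((-θ : ℝ) * Complex.I))‖) / 2
          + K * ρ⁻¹ ^ N / (1 - ρ⁻¹) := by
  have hρ0 : 0 < ρ := by linarith
  set e : ℕ → ℂ := fun k => (k.factorial : ℂ)⁻¹ * iteratedDeriv k E 0 with he
  have hsum : ∀ θ : ℝ, ‖∑ k ∈ Finset.range N, e k * Complex.exp (θ * Complex.I) ^ k
      - E (Complex.exp (θ * Complex.I))‖ ≤ K * ρ⁻¹ ^ N / (1 - ρ⁻¹) := by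
    intro θ
    refine norm_sub_le_of_geometric_bound_of_hasSum (inv_lt_one_of_one_lt₀ hρ) (fun k => ?_)
      ?_ N (f := fun k => e k * Complex.exp (θ * Complex.I) ^ k)
    · rw [norm_mul, norm_pow, Complex.norm_exp_ofReal_mul_I, one_pow, mul_one, he]
      have h := Complex.norm_iteratedDeriv_le_of_forall_mem_sphere_norm_le k hρ0 hE hK
      have hk : (0 : ℝ) < k.factorial := by exact_mod_cast k.factorial_pos
      rw [norm_mul, norm_inv, Complex.norm_natCast, inv_mul_le_iff₀ hk, inv_pow]
      calc _ ≤ _ := h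
        _ = _ := by ring
    · have h := Complex.hasSum_taylorSeries_on_ball hE.differentiableOn
        (z := Complex.exp (θ * Complex.I)) (by simpa [Complex.norm_exp_ofReal_mul_I] using hρ)
      refine h.congr_fun fun k => ?_
      simp only [he, sub_zero, smul_eq_mul]; ring
  have hco : ∀ k, (∑ j ∈ Finset.range N, C (e j).re * X ^ j : ℝ[X]).coeff k
      = if k < N then (e k).re else 0 := by
    intro k
    simp [finsetSum_coeff, coeff_X_pow]
  refine ⟨∑ k ∈ Finset.range N, C (e k).re * X ^ k, ?_, ?_, ?_, fun θ => ?_⟩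
  · have : (∑ k ∈ Finset.range N, C (e k).re * X ^ k : ℝ[X]).natDegree ≤ N - 1 := by
      refine natDegree_sum_le_of_forall_le _ _ fun k hk => ?_
      have := Finset.mem_range.mp hk
      exact (natDegree_C_mul_X_pow_le _ _).trans (by omega)
    omega
  · rw [hco, if_pos (by omega)]; simp [he]
  · rw [hco, if_pos (by omega)]; simp [he, iteratedDeriv_one]
  · have hz := hsum θ
    have hzb := hsum (-θ)
    have key : aeval (Complex.exp (θ * Complex.I)) (∑ k ∈ Finset.range N, C (e k).re * X ^ k : ℝ[X])
        = (∑ k ∈ Finset.range N, e k * Complex.exp (θ * Complex.I) ^ k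
          + (starRingEnd ℂ) (∑ k ∈ Finset.range N,
            e k * Complex.exp ((-θ : ℝ) * Complex.I) ^ k)) / 2 := by
      rw [map_sum, map_sum, ← Finset.sum_add_distrib, Finset.sum_div]
      refine Finset.sum_congr rfl fun k _ => ?_
      simp only [map_mul, map_pow, aeval_C, aeval_X, ← conj_exp_ofReal_mul_I, Complex.conj_conj,
        Complex.coe_algebraMap]
      rw [Complex.re_eq_add_conj]; ring
    rw [key, norm_div, Complex.norm_ofNat]
    have h1 := norm_add_le (∑ k ∈ Finset.range N, e k * Complex.exp (θ * Complex.I) ^ k)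
      ((starRingEnd ℂ) (∑ k ∈ Finset.range N, e k * Complex.exp ((-θ : ℝ) * Complex.I) ^ k))
    rw [RCLike.norm_conj] at h1
    have h2 := norm_le_norm_add_norm_sub'
      (∑ k ∈ Finset.range N, e k * Complex.exp (θ * Complex.I) ^ k)
      (E (Complex.exp (θ * Complex.I)))
    have h3 := norm_le_norm_add_norm_sub'
      (∑ k ∈ Finset.range N, e k * Complex.exp ((-θ : ℝ) * Complex.I) ^ k)
      (E (Complex.exp ((-θ : ℝ) * Complex.I)))
    linarith

/-- The product `∏ (1 + ω x z)`. -/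
def blaschkeProd (ω : ℝ → ℝ) (s : Finset ℝ) (z : ℂ) : ℂ := ∏ x ∈ s, (1 + ω x * z)

lemma blaschkeProd_zero (ω : ℝ → ℝ) (s : Finset ℝ) : blaschkeProd ω s 0 = 1 := by
  simp [blaschkeProd]

lemma differentiable_blaschkeProd (ω : ℝ → ℝ) (s : Finset ℝ) :
    Differentiable ℂ (blaschkeProd ω s) := by
  unfold blaschkeProd
  fun_prop

lemma norm_blaschkeProd_le {ω : ℝ → ℝ} {s : Finset ℝ} (hω : ∀ x ∈ s, 0 ≤ ω x ∧ ω x ≤ 1) {z : ℂ}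
    (hz : ‖z‖ ≤ 1) : ‖blaschkeProd ω s z‖ ≤ 2 ^ s.card := by
  rw [blaschkeProd, norm_prod, ← Finset.prod_const]
  refine Finset.prod_le_prod (fun _ _ => norm_nonneg _) fun x hx => ?_
  calc ‖1 + (ω x : ℂ) * z‖ ≤ ‖(1 : ℂ)‖ + ‖(ω x : ℂ) * z‖ := norm_add_le _ _
    _ ≤ 1 + 1 * 1 := by
      rw [norm_one, norm_mul, Complex.norm_of_nonneg (hω x hx).1]
      gcongr
      exact (hω x hx).2
    _ = 2 := by norm_num

lemma le_norm_blaschkeProd {ω : ℝ → ℝ} {s : Finset ℝ} {b ρ : ℝ} (hω : ∀ x ∈ s, 0 ≤ ω x ∧ ω x ≤ b)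
    (hb : b * ρ < 1) {z : ℂ} (hz : ‖z‖ ≤ ρ) :
    (1 - b * ρ) ^ s.card ≤ ‖blaschkeProd ω s z‖ := by
  rw [blaschkeProd, norm_prod, ← Finset.prod_const]
  refine Finset.prod_le_prod (fun _ _ => by linarith) fun x hx => ?_
  have h := norm_sub_le_norm_add (1 : ℂ) ((ω x : ℂ) * z)
  rw [norm_one, norm_mul, Complex.norm_of_nonneg (hω x hx).1] at h
  have : ω x * ‖z‖ ≤ b * ρ :=
    mul_le_mul (hω x hx).2 hz (norm_nonneg _) ((hω x hx).1.trans (hω x hx).2)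
  linarith

end Product

section Szego
open Polynomial Set

/-- A branch of `log (1 + ε - z ^ 2) / 2`. -/
def halfLog (ε : ℝ) (z : ℂ) : ℂ := Complex.log (1 + ε - z ^ 2) / 2

lemma mem_slitPlane_of_norm_sq_lt {ε : ℝ} {z : ℂ} (hz : ‖z‖ ^ 2 < 1 + ε) :
    1 + (ε : ℂ) - z ^ 2 ∈ Complex.slitPlane := by
  left
  have h := (Complex.abs_re_le_norm (z ^ 2)).trans_eq (norm_pow z 2)
  have := le_abs_self (z ^ 2).re
  simp only [Complex.sub_re, Complex.add_re, Complex.one_re, Complex.ofReal_re]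
  linarith

lemma differentiableAt_halfLog {ε : ℝ} {z : ℂ} (hz : ‖z‖ ^ 2 < 1 + ε) :
    DifferentiableAt ℂ (halfLog ε) z := by
  unfold halfLog
  have h : DifferentiableAt ℂ (fun z : ℂ => 1 + (ε : ℂ) - z ^ 2) z := by fun_prop
  exact (h.clog (mem_slitPlane_of_norm_sq_lt hz)).div_const 2

lemma halfLog_zero {ε : ℝ} (hε : 0 < ε) : halfLog ε 0 = ((Real.log (1 + ε) / 2 : ℝ) : ℂ) := by
  rw [halfLog]
  push_cast [Complex.ofReal_log (by linarith : (0 : ℝ) ≤ 1 + ε)]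
  simp

lemma hasDerivAt_halfLog_zero {ε : ℝ} (hε : 0 < ε) : HasDerivAt (halfLog ε) 0 0 := by
  have h : HasDerivAt (fun z : ℂ => 1 + (ε : ℂ) - z ^ 2) 0 0 := by
    have := (hasDerivAt_pow 2 (0 : ℂ)).const_sub (1 + (ε : ℂ))
    exact this.congr_deriv (by simp)
  have := (h.clog (mem_slitPlane_of_norm_sq_lt (by simp; linarith))).div_const 2
  exact this.congr_deriv (by simp)

lemma norm_exp_halfLog_sq {ε : ℝ} {z : ℂ} (hz : ‖z‖ ^ 2 < 1 + ε) :
    ‖Complex.exp (halfLog ε z)‖ ^ 2 = ‖1 + (ε : ℂ) - z ^ 2‖ := by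
  rw [← norm_pow, ← Complex.exp_nat_mul, halfLog, Nat.cast_ofNat, mul_div_cancel₀ _ two_ne_zero,
    Complex.exp_log (Complex.slitPlane_ne_zero (mem_slitPlane_of_norm_sq_lt hz))]

lemma norm_one_sub_sq (θ : ℝ) : ‖1 - Complex.exp (θ * Complex.I) ^ 2‖ = 2 * |Real.sin θ| := by
  have h1 : Complex.exp (θ * Complex.I) * Complex.exp (-(θ * Complex.I)) = 1 := by
    rw [← Complex.exp_add, add_neg_cancel, Complex.exp_zero]
  have h : 1 - Complex.exp (θ * Complex.I) ^ 2
      = Complex.exp (θ * Complex.I) * (((-2 * Real.sin θ : ℝ) : ℂ) * Complex.I) := by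
    push_cast
    rw [Complex.sin, neg_mul (θ : ℂ)]
    linear_combination (-1 : ℂ) * h1 + (Complex.exp (θ * Complex.I) *
      (Complex.exp (-(θ * Complex.I)) - Complex.exp (θ * Complex.I))) * Complex.I_sq
  rw [h, norm_mul, norm_mul, Complex.norm_exp_ofReal_mul_I, Complex.norm_I, Complex.norm_real,
    Real.norm_eq_abs, abs_mul]
  norm_num

lemma norm_one_sub_sq_le {ε : ℝ} (hε : 0 ≤ ε) {z : ℂ} (hz : ‖z‖ = 1) :
    ‖1 - z ^ 2‖ ≤ ‖1 + (ε : ℂ) - z ^ 2‖ := by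
  have h1 : (z ^ 2).re ≤ 1 := by
    have := (Complex.abs_re_le_norm (z ^ 2)).trans_eq (norm_pow z 2)
    rw [hz] at this
    linarith [le_abs_self (z ^ 2).re]
  refine le_of_sq_le_sq ?_ (norm_nonneg _)
  rw [← Complex.normSq_eq_norm_sq, ← Complex.normSq_eq_norm_sq, Complex.normSq_apply,
    Complex.normSq_apply]
  simp only [Complex.sub_re, Complex.add_re, Complex.one_re, Complex.ofReal_re, Complex.sub_im,
    Complex.add_im, Complex.one_im, Complex.ofReal_im]
  nlinarith [mul_nonneg hε (sub_nonneg.mpr h1)]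

variable {g : ℝ[X]} {ε : ℝ} {ω : ℝ → ℝ} {s : Finset ℝ} {W : ℝ → ℝ} {c : ℝ}

lemma norm_exp_sq (a : ℝ) : ‖Complex.exp (a : ℂ)‖ ^ 2 = Real.exp (2 * a) := by
  rw [Complex.norm_exp, Complex.ofReal_re, ← Real.exp_nat_mul]; norm_num

lemma aeval_zero_eq (g : ℝ[X]) : aeval (0 : ℂ) g = ((g.eval 0 : ℝ) : ℂ) := by
  have := aeval_algebraMap_apply ℂ (0 : ℝ) g
  simpa using this

/-- Mean value lower bound for weighted norms on the circle. -/
lemma le_integral_norm_sq_mul (hε : 0 < ε) (hc : 0 ≤ c) (hWc : Continuous W)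
    (hW : ∀ θ : ℝ, c * (‖Complex.exp (aeval (Complex.exp (θ * Complex.I)) g)‖ ^ 2 *
      ‖blaschkeProd ω s (Complex.exp (θ * Complex.I))‖ ^ 2 * |Real.sin θ|) ≤ W θ) (R : ℝ[X]) :
    Real.pi * c * Real.exp (2 * g.eval 0) / (1 + ε) * R.eval 0 ^ 2
      ≤ ∫ θ in (0 : ℝ)..2 * Real.pi, ‖aeval (Complex.exp (θ * Complex.I)) R‖ ^ 2 * W θ := by
  set F : ℂ → ℂ := fun z => Complex.exp (aeval z g) * Complex.exp (-halfLog ε z) * (1 - z ^ 2) *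
    blaschkeProd ω s z * aeval z R with hF
  have hdiff : ∀ z : ℂ, ‖z‖ ≤ 1 → DifferentiableAt ℂ F z := by
    intro z hz
    have h1 := differentiableAt_halfLog (ε := ε) (z := z) (by nlinarith [norm_nonneg z])
    have h2 := (differentiable_blaschkeProd ω s) z
    have h3 : DifferentiableAt ℂ (fun z => aeval z g) z := g.differentiable_aeval z
    have h4 : DifferentiableAt ℂ (fun z => aeval z R) z := R.differentiable_aeval z
    fun_prop
  have hcl : DiffContOnCl ℂ F (Metric.ball 0 1) := by
    refine DifferentiableOn.diffContOnCl fun z hz => (hdiff z ?_).differentiableWithinAt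
    rw [closure_ball _ one_ne_zero] at hz
    simpa using hz
  have h := two_pi_mul_norm_sq_le hcl
  have hF0 : ‖F 0‖ ^ 2 = Real.exp (2 * g.eval 0) / (1 + ε) * R.eval 0 ^ 2 := by
    simp only [hF, aeval_zero_eq, halfLog_zero hε, blaschkeProd_zero]
    rw [← Complex.ofReal_neg]
    simp only [norm_mul, mul_pow, norm_exp_sq]
    rw [show 2 * -(Real.log (1 + ε) / 2) = -Real.log (1 + ε) by ring, Real.exp_neg,
      Real.exp_log (by linarith), show ‖(1 : ℂ) - 0 ^ 2‖ = 1 by simp, norm_one, Complex.norm_real,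
      Real.norm_eq_abs, sq_abs]
    ring
  have hpi : (0 : ℝ) ≤ 2 * Real.pi := by positivity
  have hFW : ∀ θ : ℝ, c * ‖F (Complex.exp (θ * Complex.I))‖ ^ 2
      ≤ 2 * (‖aeval (Complex.exp (θ * Complex.I)) R‖ ^ 2 * W θ) := by
    intro θ
    have hz := Complex.norm_exp_ofReal_mul_I θ
    have h1 := norm_one_sub_sq θ
    have h2 := norm_one_sub_sq_le hε.le hz
    have h3 := norm_exp_halfLog_sq (ε := ε) (z := Complex.exp (θ * Complex.I)) (by
      rw [hz]; linarith)
    have h4 := hW θ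
    set z := Complex.exp (θ * Complex.I)
    have h5 : ‖Complex.exp (-halfLog ε z)‖ ^ 2 * ‖1 - z ^ 2‖ ^ 2 ≤ 2 * |Real.sin θ| := by
      have hpos : 0 < ‖1 + (ε : ℂ) - z ^ 2‖ := by
        rw [← h3]; exact pow_pos (norm_pos_iff.mpr (Complex.exp_ne_zero _)) 2
      rw [Complex.exp_neg, norm_inv, inv_pow, h3, inv_mul_le_iff₀ hpos, ← h1, pow_two]
      gcongr
    calc c * ‖F z‖ ^ 2 = c * (‖Complex.exp (aeval z g)‖ ^ 2 * ‖blaschkeProd ω s z‖ ^ 2 *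
          (‖Complex.exp (-halfLog ε z)‖ ^ 2 * ‖1 - z ^ 2‖ ^ 2)) * ‖aeval z R‖ ^ 2 := by
          simp only [hF, norm_mul, mul_pow]; ring
      _ ≤ c * (‖Complex.exp (aeval z g)‖ ^ 2 * ‖blaschkeProd ω s z‖ ^ 2 *
          (2 * |Real.sin θ|)) * ‖aeval z R‖ ^ 2 := by gcongr
      _ = 2 * (‖aeval z R‖ ^ 2 * (c * (‖Complex.exp (aeval z g)‖ ^ 2 * ‖blaschkeProd ω s z‖ ^ 2 *
          |Real.sin θ|))) := by ring
      _ ≤ _ := by gcongr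
  have hFc : Continuous fun θ : ℝ => F (Complex.exp (θ * Complex.I)) := by
    rw [continuous_iff_continuousAt]
    intro θ
    exact (hdiff _ (Complex.norm_exp_ofReal_mul_I θ).le).continuousAt.comp
      (f := fun θ : ℝ => Complex.exp (θ * Complex.I)) (by fun_prop)
  have hFc2 : Continuous fun θ : ℝ => c * ‖F (Complex.exp (θ * Complex.I))‖ ^ 2 :=
    continuous_const.mul (hFc.norm.pow 2)
  have hRc := continuous_aeval_exp R
  have hint := intervalIntegral.integral_mono_on (μ := volume) hpi
    (hFc2.intervalIntegrable _ _)
    (Continuous.intervalIntegrable (by fun_prop) _ _) fun θ _ => hFW θ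
  rw [intervalIntegral.integral_const_mul, intervalIntegral.integral_const_mul] at hint
  rw [hF0] at h
  have := mul_le_mul_of_nonneg_left h hc
  calc _ = c * (2 * Real.pi * (Real.exp (2 * g.eval 0) / (1 + ε) * R.eval 0 ^ 2)) / 2 := by ring
    _ ≤ _ := by linarith

end Szego

section Trial
open Polynomial Set

lemma exists_radius {ε b : ℝ} (hε : 0 < ε) (hb : b < 1) :
    ∃ ρ : ℝ, 1 < ρ ∧ ρ ^ 2 < 1 + ε ∧ b * ρ < 1 := by
  have h1 : Filter.Tendsto (fun ρ : ℝ => ρ ^ 2) (nhdsWithin 1 (Ioi 1)) (nhds 1) := by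
    have : Continuous fun ρ : ℝ => ρ ^ 2 := by fun_prop
    simpa using (this.tendsto 1).mono_left nhdsWithin_le_nhds
  have h2 : Filter.Tendsto (fun ρ : ℝ => b * ρ) (nhdsWithin 1 (Ioi 1)) (nhds b) := by
    have : Continuous fun ρ : ℝ => b * ρ := by fun_prop
    simpa using (this.tendsto 1).mono_left nhdsWithin_le_nhds
  obtain ⟨ρ, h⟩ := ((h1.eventually_lt_const (by linarith : (1 : ℝ) < 1 + ε)).and
    ((h2.eventually_lt_const hb).and self_mem_nhdsWithin)).exists
  exact ⟨ρ, h.2.2, h.1, h.2.1⟩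

variable {g : ℝ[X]} {ε : ℝ} {ω : ℝ → ℝ} {s : Finset ℝ} {W : ℝ → ℝ} {c : ℝ}

/-- The exterior Szegő-type function `exp (-g) / √(1 + ε - z ^ 2) / ∏ (1 + ω z)`. -/
def szegoFun (g : ℝ[X]) (ε : ℝ) (ω : ℝ → ℝ) (s : Finset ℝ) (z : ℂ) : ℂ :=
  Complex.exp (-aeval z g) * Complex.exp (-halfLog ε z) * (blaschkeProd ω s z)⁻¹

lemma szegoFun_zero (hε : 0 < ε) : szegoFun g ε ω s 0
    = ((Real.exp (-g.eval 0 - Real.log (1 + ε) / 2) : ℝ) : ℂ) := by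
  rw [szegoFun, aeval_zero_eq, halfLog_zero hε, blaschkeProd_zero, ← Complex.exp_add]
  push_cast
  rw [inv_one, mul_one, sub_eq_add_neg]

lemma deriv_szegoFun_zero (hε : 0 < ε) : deriv (szegoFun g ε ω s) 0
    = szegoFun g ε ω s 0 * ((-g.coeff 1 - ∑ x ∈ s, ω x : ℝ) : ℂ) := by
  have h1 : HasDerivAt (fun z => Complex.exp (-aeval z g))
      (Complex.exp (-aeval (0 : ℂ) g) * (-(g.coeff 1 : ℂ))) 0 := by
    have := g.hasDerivAt_aeval (0 : ℂ)
    rw [aeval_zero_eq, ← coeff_zero_eq_eval_zero, coeff_derivative] at this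
    refine this.neg.cexp.congr_deriv ?_
    simp
  have h2 : HasDerivAt (fun z => Complex.exp (-halfLog ε z)) 0 0 := by
    refine (hasDerivAt_halfLog_zero hε).neg.cexp.congr_deriv ?_
    simp
  have h3 : HasDerivAt (blaschkeProd ω s) ((∑ x ∈ s, ω x : ℝ) : ℂ) 0 := by
    have : HasDerivAt (fun z : ℂ => ∏ x ∈ s, (1 + (ω x : ℂ) * z))
        (∑ x ∈ s, (∏ y ∈ s.erase x, (1 + (ω y : ℂ) * 0)) • (ω x : ℂ)) 0 := by
      refine HasDerivAt.fun_finsetProd fun x _ => ?_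
      simpa using ((hasDerivAt_id (0 : ℂ)).const_mul (ω x : ℂ)).const_add 1
    refine this.congr_deriv ?_
    simp
  have h4 := (h1.mul h2).mul (h3.inv (by rw [blaschkeProd_zero]; exact one_ne_zero))
  refine h4.deriv.trans ?_
  simp only [szegoFun, blaschkeProd_zero, Pi.mul_apply, Pi.inv_apply]
  push_cast
  ring

lemma differentiableAt_szegoFun {b ρ : ℝ} (hω : ∀ x ∈ s, 0 ≤ ω x ∧ ω x ≤ b) (hb : b * ρ < 1)
    (hρ : ρ ^ 2 < 1 + ε) {z : ℂ} (hz : ‖z‖ ≤ ρ) : DifferentiableAt ℂ (szegoFun g ε ω s) z := by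
  have h1 := differentiableAt_halfLog (ε := ε) (z := z)
    (lt_of_le_of_lt (pow_le_pow_left₀ (norm_nonneg z) hz 2) hρ)
  have h2 := (differentiable_blaschkeProd ω s) z
  have h3 : DifferentiableAt ℂ (fun z => aeval z g) z := g.differentiable_aeval z
  have h4 : blaschkeProd ω s z ≠ 0 := by
    rw [← norm_pos_iff]
    exact lt_of_lt_of_le (pow_pos (by linarith) _) (le_norm_blaschkeProd hω hb hz)
  exact (h3.neg.cexp.mul h1.neg.cexp).mul (h2.inv h4)

lemma norm_szegoFun_sq_mul_le (hε : 0 < ε) (hc : 0 ≤ c) {b : ℝ}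
    (hω : ∀ x ∈ s, 0 ≤ ω x ∧ ω x ≤ b) (hb : b < 1) {θ : ℝ}
    (hW : W θ ≤ c * (‖Complex.exp (aeval (Complex.exp (θ * Complex.I)) g)‖ ^ 2 *
      ‖blaschkeProd ω s (Complex.exp (θ * Complex.I))‖ ^ 2 * |Real.sin θ|)) :
    ‖szegoFun g ε ω s (Complex.exp (θ * Complex.I))‖ ^ 2 * W θ ≤ c / 2 := by
  have hz := Complex.norm_exp_ofReal_mul_I θ
  have h1 := norm_one_sub_sq θ
  have h2 := norm_one_sub_sq_le hε.le hz
  have h3 := norm_exp_halfLog_sq (ε := ε) (z := Complex.exp (θ * Complex.I)) (by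
    rw [hz]; linarith)
  have h4 : blaschkeProd ω s (Complex.exp (θ * Complex.I)) ≠ 0 := by
    rw [← norm_pos_iff]
    exact lt_of_lt_of_le (pow_pos (by linarith) _) (le_norm_blaschkeProd (ρ := 1) hω (by linarith)
      hz.le)
  set z := Complex.exp (θ * Complex.I)
  have hpos : 0 < ‖1 + (ε : ℂ) - z ^ 2‖ := by
    rw [← h3]; exact pow_pos (norm_pos_iff.mpr (Complex.exp_ne_zero _)) 2
  have h5 : ‖Complex.exp (-halfLog ε z)‖ ^ 2 * |Real.sin θ| ≤ 1 / 2 := by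
    rw [Complex.exp_neg, norm_inv, inv_pow, h3, inv_mul_le_iff₀ hpos]
    linarith
  have h6 : 0 < ‖Complex.exp (aeval z g)‖ := norm_pos_iff.mpr (Complex.exp_ne_zero _)
  have h7 : 0 < ‖blaschkeProd ω s z‖ := norm_pos_iff.mpr h4
  calc ‖szegoFun g ε ω s z‖ ^ 2 * W θ
      ≤ ‖szegoFun g ε ω s z‖ ^ 2 * (c * (‖Complex.exp (aeval z g)‖ ^ 2 *
        ‖blaschkeProd ω s z‖ ^ 2 * |Real.sin θ|)) := by gcongr
    _ = c * (‖Complex.exp (-halfLog ε z)‖ ^ 2 * |Real.sin θ|) := by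
      simp only [szegoFun, norm_mul, mul_pow, norm_inv, Complex.exp_neg (aeval z g)]
      field_simp
    _ ≤ c * (1 / 2) := by gcongr
    _ = _ := by ring

lemma exists_norm_szegoFun_bounds (g : ℝ[X]) {ε b ρ : ℝ} (hb0 : 0 ≤ b)
    (hρ1 : 1 < ρ) (hρ : ρ ^ 2 < 1 + ε) (hb : b * ρ < 1) :
    ∃ A a : ℝ, 0 < a ∧ ∀ (ω : ℝ → ℝ) (s : Finset ℝ), (∀ x ∈ s, 0 ≤ ω x ∧ ω x ≤ b) →
      (∀ z : ℂ, ‖z‖ ≤ ρ → ‖szegoFun g ε ω s z‖ ≤ A * ((1 - b * ρ)⁻¹) ^ s.card) ∧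
      (∀ z : ℂ, ‖z‖ = 1 → a * (2⁻¹) ^ s.card ≤ ‖szegoFun g ε ω s z‖) := by
  have hcont : ContinuousOn (fun z => Complex.exp (-aeval z g) * Complex.exp (-halfLog ε z))
      (Metric.closedBall 0 ρ) := by
    intro z hz
    have h1 := differentiableAt_halfLog (ε := ε) (z := z)
      (lt_of_le_of_lt (pow_le_pow_left₀ (norm_nonneg z) (by simpa using hz) 2) hρ)
    have h3 : DifferentiableAt ℂ (fun z => aeval z g) z := g.differentiable_aeval z
    exact (h3.neg.cexp.mul h1.neg.cexp).continuousAt.continuousWithinAt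
  obtain ⟨A, hA⟩ := (isCompact_closedBall (0 : ℂ) ρ).exists_bound_of_continuousOn hcont
  obtain ⟨z₀, hz₀, hmin⟩ := (isCompact_closedBall (0 : ℂ) ρ).exists_isMinOn
    ⟨0, by simp; linarith⟩ hcont.norm
  refine ⟨A, ‖Complex.exp (-aeval z₀ g) * Complex.exp (-halfLog ε z₀)‖,
    norm_pos_iff.mpr (mul_ne_zero (Complex.exp_ne_zero _) (Complex.exp_ne_zero _)),
    fun ω s hω => ⟨fun z hz => ?_, fun z hz => ?_⟩⟩
  · rw [szegoFun, norm_mul, norm_inv, inv_pow]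
    have h := le_norm_blaschkeProd hω hb hz
    have hpos : (0 : ℝ) < (1 - b * ρ) ^ s.card := pow_pos (by linarith) _
    have := hA z (by simpa using hz)
    gcongr
    exact (norm_nonneg _).trans this
  · rw [szegoFun, norm_mul (_ * _) (_⁻¹), norm_inv, inv_pow]
    have h := norm_blaschkeProd_le (s := s) (ω := ω)
      (fun x hx => ⟨(hω x hx).1, (hω x hx).2.trans (by nlinarith)⟩) hz.le
    have hpos : 0 < ‖blaschkeProd ω s z‖ := by
      have := le_norm_blaschkeProd (ρ := ρ) hω hb (z := z) (by linarith)
      exact lt_of_lt_of_le (pow_pos (by linarith) _) this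
    have := hmin (a := z) (by simp; linarith)
    simp only [mem_ofPred_eq] at this
    gcongr

/-- Truncating the Taylor series of `szegoFun` gives a nearly extremal polynomial. -/
lemma exists_nearly_extremal (g : ℝ[X]) {ε b : ℝ} (hε : 0 < ε) (hb0 : 0 ≤ b) (hb : b < 1) :
    ∃ A K ρ : ℝ, 0 < K ∧ 1 < ρ ∧ ∀ (ω : ℝ → ℝ) (s : Finset ℝ), (∀ x ∈ s, 0 ≤ ω x ∧ ω x ≤ b) →
      ∀ N : ℕ, 2 ≤ N → A * K ^ s.card * ρ⁻¹ ^ N ≤ ε →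
      ∃ T : ℝ[X], T.natDegree < N ∧ T.coeff 0 = 1 ∧ T.coeff 1 = -g.coeff 1 - ∑ x ∈ s, ω x ∧
        ∀ (c : ℝ) (W : ℝ → ℝ), 0 ≤ c → Continuous W → (∀ θ, 0 ≤ W θ) → (∀ θ, W (-θ) = W θ) →
        (∀ θ : ℝ, W θ ≤ c * (‖Complex.exp (aeval (Complex.exp (θ * Complex.I)) g)‖ ^ 2 *
          ‖blaschkeProd ω s (Complex.exp (θ * Complex.I))‖ ^ 2 * |Real.sin θ|)) →
        ∫ θ in (0 : ℝ)..2 * Real.pi, ‖aeval (Complex.exp (θ * Complex.I)) T‖ ^ 2 * W θ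
          ≤ Real.pi * c * Real.exp (2 * g.eval 0) * (1 + ε) ^ 3 := by
  obtain ⟨ρ, hρ1, hρ, hbρ⟩ := exists_radius hε hb
  obtain ⟨A, a, ha, hAa⟩ := exists_norm_szegoFun_bounds g hb0 hρ1 hρ hbρ
  have hκ : 0 < 1 - b * ρ := by linarith
  have hρi : 0 < 1 - ρ⁻¹ := by linarith [inv_lt_one_of_one_lt₀ hρ1]
  refine ⟨A / ((1 - ρ⁻¹) * a), 2 * (1 - b * ρ)⁻¹, ρ, by positivity, hρ1,
    fun ω s hω N hN hsmall => ?_⟩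
  obtain ⟨hup, hlo⟩ := hAa ω s hω
  have hdiff : DiffContOnCl ℂ (szegoFun g ε ω s) (Metric.ball 0 ρ) := by
    refine DifferentiableOn.diffContOnCl fun z hz =>
      (differentiableAt_szegoFun hω hbρ hρ ?_).differentiableWithinAt
    rw [closure_ball _ (by linarith : ρ ≠ 0)] at hz
    simpa using hz
  obtain ⟨T, hT1, hT2, hT3, hT4⟩ := exists_real_taylor hρ1 hdiff
    (fun z hz => hup z (by simpa using hz.le)) hN
  set e := Real.exp (-g.eval 0 - Real.log (1 + ε) / 2) with he
  have he0 : 0 < e := Real.exp_pos _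
  rw [szegoFun_zero hε, Complex.ofReal_re] at hT2
  rw [deriv_szegoFun_zero hε, szegoFun_zero hε, ← Complex.ofReal_mul, Complex.ofReal_re] at hT3
  have htail : A * (1 - b * ρ)⁻¹ ^ s.card * ρ⁻¹ ^ N / (1 - ρ⁻¹) ≤ ε * (a * 2⁻¹ ^ s.card) := by
    calc A * (1 - b * ρ)⁻¹ ^ s.card * ρ⁻¹ ^ N / (1 - ρ⁻¹)
        = (A / ((1 - ρ⁻¹) * a) * (2 * (1 - b * ρ)⁻¹) ^ s.card * ρ⁻¹ ^ N) * (a * 2⁻¹ ^ s.card) := by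
          rw [mul_pow, inv_pow 2]; field_simp
      _ ≤ _ := by gcongr
  have hTb : ∀ θ : ℝ, ‖aeval (Complex.exp (θ * Complex.I)) T‖
      ≤ (1 + ε) * ((‖szegoFun g ε ω s (Complex.exp (θ * Complex.I))‖
        + ‖szegoFun g ε ω s (Complex.exp ((-θ : ℝ) * Complex.I))‖) / 2) := by
    intro θ
    have h1 := hT4 θ
    have h2 := mul_le_mul_of_nonneg_left (hlo _ (Complex.norm_exp_ofReal_mul_I θ)) hε.le
    have h3 := mul_le_mul_of_nonneg_left (hlo _ (Complex.norm_exp_ofReal_mul_I (-θ))) hε.le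
    linarith
  refine ⟨C e⁻¹ * T, (natDegree_C_mul_le _ _).trans_lt hT1, ?_, ?_, fun c W hc hWc hW0 hWe hW => ?_⟩
  · rw [coeff_C_mul, hT2, inv_mul_cancel₀ he0.ne']
  · rw [coeff_C_mul, hT3, inv_mul_cancel_left₀ he0.ne']
  have hpt : ∀ θ : ℝ, ‖aeval (Complex.exp (θ * Complex.I)) (C e⁻¹ * T)‖ ^ 2 * W θ
      ≤ e⁻¹ ^ 2 * (1 + ε) ^ 2 * (c / 2) := by
    intro θ
    have h1 := norm_szegoFun_sq_mul_le hε hc hω hb (hW θ)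
    have h2 := norm_szegoFun_sq_mul_le hε hc hω hb (hW (-θ))
    rw [hWe] at h2
    rw [map_mul, aeval_C, norm_mul, Complex.coe_algebraMap, Complex.norm_real,
      Real.norm_of_nonneg (by positivity)]
    set x := ‖szegoFun g ε ω s (Complex.exp (θ * Complex.I))‖
    set y := ‖szegoFun g ε ω s (Complex.exp ((-θ : ℝ) * Complex.I))‖
    have h3 : ((x + y) / 2) ^ 2 * W θ ≤ c / 2 := by
      nlinarith [mul_nonneg (sq_nonneg (x - y)) (hW0 θ)]
    have := hW0 θ
    calc (e⁻¹ * ‖aeval (Complex.exp (θ * Complex.I)) T‖) ^ 2 * W θ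
        ≤ (e⁻¹ * ((1 + ε) * ((x + y) / 2))) ^ 2 * W θ := by
          gcongr
          exact hTb θ
      _ = e⁻¹ ^ 2 * (1 + ε) ^ 2 * (((x + y) / 2) ^ 2 * W θ) := by ring
      _ ≤ _ := by gcongr
  have hpi : (0 : ℝ) ≤ 2 * Real.pi := by positivity
  have hTc := continuous_aeval_exp (C e⁻¹ * T)
  have hint := intervalIntegral.integral_mono_on (μ := volume) hpi
    (Continuous.intervalIntegrable (by fun_prop) _ _)
    (Continuous.intervalIntegrable continuous_const _ _) fun θ _ => hpt θ
  rw [intervalIntegral.integral_const, sub_zero, smul_eq_mul] at hint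
  refine hint.trans (le_of_eq ?_)
  have he2 : e⁻¹ ^ 2 = Real.exp (2 * g.eval 0) * (1 + ε) := by
    rw [he, ← Real.exp_neg, ← Real.exp_nat_mul, ← Real.exp_log (by linarith : 0 < 1 + ε),
      ← Real.exp_add, Real.log_exp]
    congr 1; push_cast; ring
  rw [he2]; ring

end Trial

section Weight
open Polynomial Set

lemma exists_re_aeval_eq (p : ℝ[X]) : ∃ g : ℝ[X], ∀ θ : ℝ,
    p.eval (2 * Real.cos θ) = (aeval (Complex.exp (θ * Complex.I)) g).re := by
  induction p using Polynomial.induction_on with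
  | C a => exact ⟨C a, by simp⟩
  | add p q hp hq =>
    obtain ⟨g, hg⟩ := hp
    obtain ⟨h, hh⟩ := hq
    exact ⟨g + h, fun θ => by rw [eval_add, hg, hh, map_add, Complex.add_re]⟩
  | monomial n a hp =>
    obtain ⟨g, hg⟩ := hp
    refine ⟨X * g + divX g + C (g.coeff 0) * X, fun θ => ?_⟩
    have h1 : (C a * X ^ (n + 1) : ℝ[X]).eval (2 * Real.cos θ)
        = 2 * Real.cos θ * (C a * X ^ n : ℝ[X]).eval (2 * Real.cos θ) := by
      simp only [eval_mul, eval_C, eval_pow, eval_X]; ring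
    have h2 : aeval (Complex.exp (θ * Complex.I)) g
        = Complex.exp (θ * Complex.I) * aeval (Complex.exp (θ * Complex.I)) (divX g)
          + (g.coeff 0 : ℂ) := by
      have := congrArg (aeval (Complex.exp (θ * Complex.I))) (X_mul_divX_add g)
      rw [map_add, map_mul, aeval_X, aeval_C] at this
      exact this.symm
    have h3 : Complex.exp (θ * Complex.I) * (starRingEnd ℂ) (Complex.exp (θ * Complex.I)) = 1 := by
      rw [Complex.mul_conj, Complex.normSq_eq_norm_sq, Complex.norm_exp_ofReal_mul_I]; simp
    have h4 := congrArg Complex.re h3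
    rw [h1, hg, h2, show Real.cos θ = (Complex.exp (θ * Complex.I)).re from
      (Complex.exp_ofReal_mul_I_re θ).symm]
    simp only [map_add, map_mul, aeval_X, aeval_C, h2, Complex.coe_algebraMap]
    set z := Complex.exp (θ * Complex.I)
    simp only [Complex.mul_re, Complex.mul_im, Complex.conj_re, Complex.conj_im, Complex.one_re,
      Complex.add_re, Complex.add_im, Complex.ofReal_re, Complex.ofReal_im] at h4 ⊢
    linear_combination (aeval z (divX g)).re * h4

lemma exists_weight_approx {m lam : ℝ} (hlam : 0 < lam) {f : ℝ → ℝ}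
    (hf : ContinuousOn f (Icc (m - 2 * lam) (m + 2 * lam)))
    (hf0 : ∀ x ∈ Icc (m - 2 * lam) (m + 2 * lam), 0 < f x) {ε : ℝ} (hε : 0 < ε) :
    ∃ g : ℝ[X], ∀ θ : ℝ,
      Real.exp (-ε) * ‖Complex.exp (aeval (Complex.exp (θ * Complex.I)) g)‖ ^ 2
        ≤ f (m + lam * (2 * Real.cos θ)) ∧
      f (m + lam * (2 * Real.cos θ))
        ≤ Real.exp ε * ‖Complex.exp (aeval (Complex.exp (θ * Complex.I)) g)‖ ^ 2 := by
  have hmaps : MapsTo (fun u => m + lam * u) (Icc (-2) 2) (Icc (m - 2 * lam) (m + 2 * lam)) := by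
    intro u hu
    constructor <;> nlinarith [hu.1, hu.2]
  have hcont : ContinuousOn (fun u => Real.log (f (m + lam * u)) / 2) (Icc (-2) 2) :=
    (ContinuousOn.log (hf.comp (by fun_prop) hmaps) fun u hu =>
      (hf0 _ (hmaps hu)).ne').div_const 2
  obtain ⟨p, hp⟩ := exists_polynomial_near_of_continuousOn _ _ _ hcont (ε / 2) (by linarith)
  obtain ⟨g, hg⟩ := exists_re_aeval_eq p
  refine ⟨g, fun θ => ?_⟩
  have hu : 2 * Real.cos θ ∈ Icc (-2 : ℝ) 2 := by
    constructor <;> nlinarith [Real.neg_one_le_cos θ, Real.cos_le_one θ]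
  have h := abs_lt.mp (hp _ hu)
  have hpos := hf0 _ (hmaps hu)
  rw [Complex.norm_exp, ← hg, ← Real.exp_nat_mul, ← Real.exp_add, ← Real.exp_add]
  conv => enter [1, 2]; rw [← Real.exp_log hpos]
  conv => enter [2, 1]; rw [← Real.exp_log hpos]
  push_cast
  exact ⟨Real.exp_le_exp.mpr (by linarith), Real.exp_le_exp.mpr (by linarith)⟩

/-- The inverse Joukowski map at a point to the left of `[m - 2 λ, m + 2 λ]`. -/
def joukowski (m lam x : ℝ) : ℝ := ((m - x) + Real.sqrt ((m - x) ^ 2 - 4 * lam ^ 2)) / 2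

/-- The parameter `ω` with `|y - x|` proportional to `|1 + ω z| ^ 2` for `y = m + 2 λ cos θ`. -/
def omegaOf (m lam x : ℝ) : ℝ := lam / joukowski m lam x

variable {m lam x : ℝ}

lemma lt_joukowski (hx : x < m - 2 * lam) : lam < joukowski m lam x := by
  have := Real.sqrt_nonneg ((m - x) ^ 2 - 4 * lam ^ 2)
  rw [joukowski]; linarith

lemma joukowski_add_div (hlam : 0 < lam) (hx : x < m - 2 * lam) :
    joukowski m lam x + lam ^ 2 / joukowski m lam x = m - x := by
  have hpos := hlam.trans (lt_joukowski hx)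
  have h : Real.sqrt ((m - x) ^ 2 - 4 * lam ^ 2) ^ 2 = (m - x) ^ 2 - 4 * lam ^ 2 :=
    Real.sq_sqrt (by nlinarith)
  field_simp
  rw [joukowski]
  nlinarith

lemma omegaOf_pos (hlam : 0 < lam) (hx : x < m - 2 * lam) : 0 < omegaOf m lam x :=
  div_pos hlam (hlam.trans (lt_joukowski hx))

lemma omegaOf_lt_one (hlam : 0 < lam) (hx : x < m - 2 * lam) : omegaOf m lam x < 1 :=
  (div_lt_one (hlam.trans (lt_joukowski hx))).mpr (lt_joukowski hx)

lemma continuous_joukowski : Continuous (joukowski m lam) := by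
  unfold joukowski; fun_prop

lemma joukowski_antitone {x y : ℝ} (hlam : 0 < lam) (hxy : x ≤ y) (hy : y < m - 2 * lam) :
    joukowski m lam y ≤ joukowski m lam x := by
  have : Real.sqrt ((m - y) ^ 2 - 4 * lam ^ 2) ≤ Real.sqrt ((m - x) ^ 2 - 4 * lam ^ 2) :=
    Real.sqrt_le_sqrt (by nlinarith)
  unfold joukowski; linarith

lemma omegaOf_mono {x y : ℝ} (hlam : 0 < lam) (hxy : x ≤ y) (hy : y < m - 2 * lam) :
    omegaOf m lam x ≤ omegaOf m lam y :=
  div_le_div_of_nonneg_left hlam.le (hlam.trans (lt_joukowski hy))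
    (joukowski_antitone hlam hxy hy)

lemma add_mul_cos_sub (hlam : 0 < lam) (hx : x < m - 2 * lam) (θ : ℝ) :
    m + lam * (2 * Real.cos θ) - x
      = joukowski m lam x * ‖1 + (omegaOf m lam x : ℂ) * Complex.exp (θ * Complex.I)‖ ^ 2 := by
  have hpos := hlam.trans (lt_joukowski hx)
  have h := joukowski_add_div hlam hx
  rw [← Complex.normSq_eq_norm_sq, Complex.normSq_apply]
  simp only [Complex.add_re, Complex.one_re, Complex.add_im, Complex.one_im, Complex.mul_re,
    Complex.mul_im, Complex.ofReal_re, Complex.ofReal_im, Complex.exp_ofReal_mul_I_re,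
    Complex.exp_ofReal_mul_I_im]
  have hω : joukowski m lam x * omegaOf m lam x = lam := mul_div_cancel₀ _ hpos.ne'
  have hω2 : joukowski m lam x * omegaOf m lam x ^ 2 = lam ^ 2 / joukowski m lam x := by
    rw [omegaOf]; field_simp
  linear_combination (-1 : ℝ) * h - 2 * Real.cos θ * hω - hω2 - joukowski m lam x *
    omegaOf m lam x ^ 2 * Real.sin_sq_add_cos_sq θ

lemma prod_add_mul_cos_sub (hlam : 0 < lam) {s : Finset ℝ} (hs : ∀ x ∈ s, x < m - 2 * lam) (θ : ℝ) :
    ∏ x ∈ s, (m + lam * (2 * Real.cos θ) - x) = (∏ x ∈ s, joukowski m lam x) *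
      ‖blaschkeProd (omegaOf m lam) s (Complex.exp (θ * Complex.I))‖ ^ 2 := by
  rw [blaschkeProd, norm_prod, ← Finset.prod_pow, ← Finset.prod_mul_distrib]
  exact Finset.prod_congr rfl fun x hx => add_mul_cos_sub hlam (hs x hx) θ

/-- Transplant a monic polynomial from `[m - 2 λ, m + 2 λ]` to `[-2, 2]`. -/
lemma exists_transplant (m : ℝ) (hlam : 0 < lam) {q : ℝ[X]} (hq : q.Monic) (hN : 1 ≤ q.natDegree) :
    ∃ q' : ℝ[X], q'.Monic ∧ q'.natDegree = q.natDegree ∧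
      (∀ u, q.eval (m + lam * u) = lam ^ q.natDegree * q'.eval u) ∧
      q.coeff (q.natDegree - 1) + q.natDegree * m = lam * q'.coeff (q.natDegree - 1) := by
  set N := q.natDegree with hNdef
  have hdeg : (C ((lam ^ N)⁻¹) * (taylor m q).comp (C lam * X)).natDegree = N := by
    rw [natDegree_C_mul (by positivity), natDegree_comp, natDegree_taylor,
      natDegree_C_mul_X _ hlam.ne', mul_one]
  refine ⟨C ((lam ^ N)⁻¹) * (taylor m q).comp (C lam * X), ?_, hdeg, fun u => ?_, ?_⟩
  · rw [Monic, leadingCoeff, hdeg, coeff_C_mul, comp_C_mul_X_coeff, hNdef, coeff_taylor_natDegree,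
      hq.leadingCoeff, one_mul, inv_mul_cancel₀ (by positivity)]
  · rw [eval_mul, eval_C, eval_comp, taylor_eval, mul_inv_cancel_left₀ (by positivity)]
    simp [add_comm]
  · rw [coeff_C_mul, comp_C_mul_X_coeff, taylor_coeff]
    have h1 : (hasseDeriv (N - 1) q).natDegree < 2 :=
      lt_of_le_of_lt (natDegree_hasseDeriv_le q (N - 1)) (by omega)
    have h2 : (hasseDeriv (N - 1) q).eval m = q.coeff (N - 1) + N * m := by
      rw [eval_eq_sum_range' h1, Finset.sum_range_succ, Finset.sum_range_one, hasseDeriv_coeff,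
        hasseDeriv_coeff, zero_add, Nat.choose_self, show 1 + (N - 1) = N by omega,
        Nat.choose_symm_of_eq_add (by omega : N = (N - 1) + 1), Nat.choose_one_right, hNdef,
        hq.coeff_natDegree]
      simp
    have h3 : lam ^ N = lam * lam ^ (N - 1) := by rw [← pow_succ', Nat.sub_add_cancel hN]
    rw [h2, h3]
    field_simp

end Weight

section Asymptotics
open Polynomial Set

lemma exists_pos_exp_mul_le {δ : ℝ} (hδ : 0 < δ) :
    ∃ ε : ℝ, 0 < ε ∧ Real.exp (2 * ε) * (1 + ε) ^ 4 ≤ 1 + δ := by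
  have hc : Continuous fun ε : ℝ => Real.exp (2 * ε) * (1 + ε) ^ 4 := by fun_prop
  have h : ∀ᶠ ε in nhds (0 : ℝ), Real.exp (2 * ε) * (1 + ε) ^ 4 < 1 + δ :=
    (hc.tendsto 0).eventually_lt_const (by simpa using hδ)
  obtain ⟨ε, h1, h2⟩ := ((h.filter_mono nhdsWithin_le_nhds).and
    (self_mem_nhdsWithin : Ioi (0 : ℝ) ∈ nhdsWithin 0 (Ioi 0))).exists
  exact ⟨ε, h2, h1.le⟩

/-- Asymptotics of the norm and of the subleading coefficient of orthogonal polynomials for a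
fixed weight times a varying polynomial of small degree. -/
theorem exists_asymptotics {m lam β η : ℝ} (hlam : 0 < lam) (hβ : β < m - 2 * lam) {f : ℝ → ℝ}
    (hf : ContinuousOn f (Icc (m - 2 * lam) (m + 2 * lam)))
    (hf0 : ∀ x ∈ Icc (m - 2 * lam) (m + 2 * lam), 0 < f x) (hη : 0 < η) :
    ∃ A K ρ D t : ℝ, 0 < K ∧ 1 < ρ ∧ 0 < D ∧ ∀ s : Finset ℝ, (∀ x ∈ s, x ≤ β) →
      ∀ N : ℕ, 2 ≤ N → A * K ^ s.card * ρ⁻¹ ^ N ≤ 1 → ∀ q : ℝ[X], q.Monic → q.natDegree = N →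
      (∀ r : ℝ[X], r.natDegree < N → ∫ y in (m - 2 * lam)..(m + 2 * lam),
        q.eval y * r.eval y * ((∏ x ∈ s, (y - x)) * f y) = 0) →
      |(∫ y in (m - 2 * lam)..(m + 2 * lam), q.eval y ^ 2 * ((∏ x ∈ s, (y - x)) * f y))
          - D * lam ^ (2 * N) * ∏ x ∈ s, joukowski m lam x|
        ≤ η * (D * lam ^ (2 * N) * ∏ x ∈ s, joukowski m lam x) ∧
      |q.coeff (N - 1) + N * m - lam * (t - ∑ x ∈ s, omegaOf m lam x)| ≤ η := by
  obtain ⟨δ, hδ0, hδ1, hδ2, hδ3⟩ : ∃ δ : ℝ, 0 < δ ∧ δ ≤ 1 ∧ 4 * δ ≤ η ∧ lam * (2 * δ) ≤ η := by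
    refine ⟨min 1 (min (η / 4) (η / (2 * lam))), by positivity, min_le_left _ _, ?_, ?_⟩
    · have := (min_le_right 1 _).trans (min_le_left (η / 4) (η / (2 * lam)))
      linarith
    · have := (min_le_right 1 _).trans (min_le_right (η / 4) (η / (2 * lam)))
      rw [le_div_iff₀ (by positivity)] at this
      linarith
  obtain ⟨ε, hε, hεδ⟩ := exists_pos_exp_mul_le (by positivity : 0 < δ ^ 2)
  obtain ⟨g, hg⟩ := exists_weight_approx hlam hf hf0 hε
  obtain ⟨A, K, ρ, hK, hρ, hT⟩ := exists_nearly_extremal g hε (omegaOf_pos hlam hβ).le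
    (omegaOf_lt_one hlam hβ)
  refine ⟨A / ε, K, ρ, lam * (2 * Real.pi * Real.exp (-ε) * Real.exp (2 * g.eval 0) / (1 + ε)),
    -g.coeff 1, hK, hρ, by positivity, fun s hs N hN hsmall q hq hqN horth => ?_⟩
  have hs' : ∀ x ∈ s, x < m - 2 * lam := fun x hx => (hs x hx).trans_lt hβ
  have hω : ∀ x ∈ s, 0 ≤ omegaOf m lam x ∧ omegaOf m lam x ≤ omegaOf m lam β := fun x hx =>
    ⟨(omegaOf_pos hlam (hs' x hx)).le, omegaOf_mono hlam (hs x hx) hβ⟩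
  obtain ⟨T, hTN, hT0, hT1, hTI⟩ := hT (omegaOf m lam) s hω N hN (by
    rw [div_mul_eq_mul_div, div_mul_eq_mul_div, div_le_one hε] at hsmall
    exact hsmall)
  have hmaps : ∀ θ : ℝ, m + lam * (2 * Real.cos θ) ∈ Icc (m - 2 * lam) (m + 2 * lam) := by
    intro θ
    constructor <;> nlinarith [Real.neg_one_le_cos θ, Real.cos_le_one θ]
  set Ψ := ∏ x ∈ s, joukowski m lam x with hΨ
  have hΨ0 : 0 < Ψ := Finset.prod_pos fun x hx => hlam.trans (lt_joukowski (hs' x hx))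
  set W : ℝ → ℝ := fun θ => (∏ x ∈ s, (m + lam * (2 * Real.cos θ) - x)) *
    f (m + lam * (2 * Real.cos θ)) * |Real.sin θ| with hWdef
  have hWc : Continuous W := by
    have : Continuous fun θ : ℝ => f (m + lam * (2 * Real.cos θ)) :=
      hf.comp_continuous (by fun_prop) hmaps
    have h2 : Continuous fun θ : ℝ => ∏ x ∈ s, (m + lam * (2 * Real.cos θ) - x) := by fun_prop
    exact (h2.mul this).mul Real.continuous_sin.abs
  have hWeq : ∀ θ, W θ = Ψ * (‖blaschkeProd (omegaOf m lam) s (Complex.exp (θ * Complex.I))‖ ^ 2 *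
      |Real.sin θ|) * f (m + lam * (2 * Real.cos θ)) := fun θ => by
    simp only [hWdef]; rw [prod_add_mul_cos_sub hlam hs']; ring
  have hW0 : ∀ θ, 0 ≤ W θ := fun θ => by
    have := hf0 _ (hmaps θ)
    rw [hWeq]; positivity
  have hlo : ∀ θ : ℝ, Ψ * Real.exp (-ε) *
      (‖Complex.exp (aeval (Complex.exp (θ * Complex.I)) g)‖ ^ 2 *
        ‖blaschkeProd (omegaOf m lam) s (Complex.exp (θ * Complex.I))‖ ^ 2 * |Real.sin θ|)
      ≤ W θ := fun θ => by
    rw [hWeq]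
    refine le_trans (le_of_eq ?_) (mul_le_mul_of_nonneg_left (hg θ).1 (by positivity))
    ring
  have hhi : ∀ θ : ℝ, W θ ≤ Ψ * Real.exp ε *
      (‖Complex.exp (aeval (Complex.exp (θ * Complex.I)) g)‖ ^ 2 *
        ‖blaschkeProd (omegaOf m lam) s (Complex.exp (θ * Complex.I))‖ ^ 2 * |Real.sin θ|) :=
    fun θ => by
    rw [hWeq]
    refine le_trans (mul_le_mul_of_nonneg_left (hg θ).2 (by positivity)) (le_of_eq ?_)
    ring
  have hup := hTI (Ψ * Real.exp ε) W (by positivity) hWc hW0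
    (fun θ => by simp only [hWdef, Real.cos_neg, Real.sin_neg, abs_neg]) hhi
  set E := Real.exp (2 * g.eval 0) with hE
  have hE0 : 0 < E := Real.exp_pos _
  obtain ⟨q', hq', hq'N, hq'eval, hq'coeff⟩ := exists_transplant m hlam hq (by omega)
  rw [hqN] at hq'N hq'eval hq'coeff
  have hchange : ∀ u : ℝ → ℝ, Continuous u →
      ∫ y in (m - 2 * lam)..(m + 2 * lam), u y * ((∏ x ∈ s, (y - x)) * f y)
        = lam * ∫ θ in (0 : ℝ)..2 * Real.pi, u (m + lam * (2 * Real.cos θ)) * W θ := by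
    intro u hu
    rw [integral_eq_circle hlam]
    · simp only [hWdef, mul_assoc]
    · have : ContinuousOn (fun y => ∏ x ∈ s, (y - x)) (Icc (m - 2 * lam) (m + 2 * lam)) :=
        (continuous_finsetProd s fun x _ => continuous_id.sub continuous_const).continuousOn
      exact hu.continuousOn.mul (this.mul hf)
  have hmain := abs_orthogonal_sub_le hWc hW0
    (D := Real.pi * (Ψ * Real.exp (-ε)) * E / (1 + ε)) (by positivity) hδ0.le hδ1
    (le_integral_norm_sq_mul hε (by positivity) hWc hlo) hN hTN hT0
    (hup.trans ?_) hq' hq'N ?_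
  · rw [hchange (fun y => q.eval y ^ 2) (by fun_prop)]
    simp only [hq'eval, mul_pow, mul_assoc (_ ^ 2 : ℝ)]
    rw [intervalIntegral.integral_const_mul]
    set J := ∫ θ in (0 : ℝ)..2 * Real.pi, q'.eval (2 * Real.cos θ) ^ 2 * W θ
    refine ⟨?_, ?_⟩
    · set D := Real.pi * (Ψ * Real.exp (-ε)) * E / (1 + ε) with hD
      have hD0 : 0 < D := by positivity
      rw [show lam * ((lam ^ N) ^ 2 * J) - lam * (2 * Real.pi * Real.exp (-ε) * E / (1 + ε)) *
          lam ^ (2 * N) * Ψ = lam ^ (2 * N + 1) * (J - 2 * D) by rw [hD]; ring,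
        show η * (lam * (2 * Real.pi * Real.exp (-ε) * E / (1 + ε)) *
          lam ^ (2 * N) * Ψ) = lam ^ (2 * N + 1) * (η * (2 * D)) by rw [hD]; ring,
        abs_mul, abs_of_pos (by positivity)]
      refine mul_le_mul_of_nonneg_left (hmain.1.trans ?_) (by positivity)
      nlinarith
    · rw [hq'coeff, ← mul_sub, abs_mul, abs_of_pos hlam, ← hT1]
      exact (mul_le_mul_of_nonneg_left hmain.2 hlam.le).trans hδ3
  · have h1 : Real.exp ε = Real.exp (-ε) * Real.exp (2 * ε) := by rw [← Real.exp_add]; ring_nf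
    rw [h1, div_mul_eq_mul_div, le_div_iff₀ (by positivity)]
    calc _ = Real.pi * (Ψ * Real.exp (-ε)) * E * (Real.exp (2 * ε) * (1 + ε) ^ 4) := by ring
      _ ≤ _ := mul_le_mul_of_nonneg_left hεδ (by positivity)
  · intro r hr
    have h1 := horth (r.comp (C lam⁻¹ * (X - C m))) (by
      rw [natDegree_comp, natDegree_C_mul (by positivity), natDegree_X_sub_C, mul_one]; exact hr)
    rw [hchange (fun y => q.eval y * (r.comp (C lam⁻¹ * (X - C m))).eval y) (by fun_prop)] at h1
    simp only [eval_comp, eval_mul, eval_C, eval_sub, eval_X, add_sub_cancel_left, hq'eval,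
      inv_mul_cancel_left₀ hlam.ne', mul_assoc (lam ^ N)] at h1
    rw [intervalIntegral.integral_const_mul] at h1
    simpa [hlam.ne'] using h1

end Asymptotics

section Concentration
open Polynomial Set

lemma pow_le_integral_sq {m lam : ℝ} (hlam : 0 < lam) {r : ℝ[X]} (hr : r.Monic) :
    lam ^ (2 * r.natDegree + 1)
      ≤ ∫ x in (m - 2 * lam)..(m + 2 * lam), r.eval x ^ 2 := by
  set V := r.comp (C lam * X + C m) with hV
  have hdeg : V.natDegree = r.natDegree := by
    rw [hV, natDegree_comp, natDegree_linear hlam.ne', mul_one]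
  have hcoeff : V.coeff r.natDegree = lam ^ r.natDegree := by
    rw [← hdeg, coeff_natDegree, hV, leadingCoeff_comp (by rw [natDegree_linear hlam.ne']; simp),
      leadingCoeff_linear hlam.ne', hr.leadingCoeff, one_mul, ← hV, hdeg]
  obtain ⟨R, hR0, hR⟩ := exists_aeval_exp_eq V r.natDegree hdeg.le
  have h := le_integral_norm_sq_mul (g := 0) (ω := 0) (s := ∅) (W := fun θ => |Real.sin θ|)
    one_pos zero_le_one (by fun_prop) (fun θ => by simp [blaschkeProd]) R
  rw [integral_eq_circle hlam (by fun_prop), pow_succ', pow_mul']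
  refine mul_le_mul_of_nonneg_left (le_trans ?_ (h.trans (le_of_eq ?_))) hlam.le
  · rw [hR0, hcoeff]
    simp only [eval_zero, mul_zero, Real.exp_zero, mul_one]
    nlinarith [Real.pi_gt_three, sq_nonneg (lam ^ r.natDegree)]
  · refine intervalIntegral.integral_congr fun θ _ => ?_
    simp only [hR, norm_mul, norm_pow, Complex.norm_exp_ofReal_mul_I, one_pow, one_mul,
      Complex.norm_real, Real.norm_eq_abs, sq_abs, hV, eval_comp, eval_add, eval_mul,
      eval_C, eval_X]
    rw [add_comm m]

lemma le_integral_prod_mul {a e δ w₀ : ℝ} (hδ : 0 < δ) (hδe : a + δ ≤ e) {w : ℝ → ℝ}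
    (hw : ContinuousOn w (Icc a e)) (hw0 : 0 ≤ w₀) (hmin : ∀ x ∈ Icc a e, w₀ ≤ w x)
    (s : Finset ℝ) {Z : Finset ℝ} (hZ : ∀ y ∈ Z, e ≤ y) :
    w₀ * (∏ y ∈ Z, (y - (a + δ))) * (δ / 4) ^ (2 * s.card + 1)
      ≤ ∫ x in a..e, ((∏ z ∈ s, (x - z)) ^ 2 * ∏ y ∈ Z, (y - x)) * w x := by
  have hrcont : Continuous fun x : ℝ => ∏ z ∈ s, (x - z) := by fun_prop
  have hqcont : Continuous fun x : ℝ => ∏ y ∈ Z, (y - x) := by fun_prop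
  have hq0 : ∀ x ∈ Icc a e, 0 ≤ ∏ y ∈ Z, (y - x) := fun x hx =>
    Finset.prod_nonneg fun y hy => by linarith [hx.2, hZ y hy]
  have hae : a < e := by linarith
  set Q := ∏ y ∈ Z, (y - (a + δ)) with hQ
  have hQ0 : 0 ≤ Q := hq0 _ ⟨by linarith, by linarith⟩
  have hpoly := pow_le_integral_sq (m := a + δ / 2) (by positivity : 0 < δ / 4)
    (monic_prod_of_monic s (fun z => X - C z) fun z _ => monic_X_sub_C z)
  rw [natDegree_prod_of_monic _ _ fun z _ => monic_X_sub_C z] at hpoly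
  simp only [natDegree_X_sub_C, Finset.sum_const, smul_eq_mul, mul_one, eval_prod, eval_sub,
    eval_X, eval_C] at hpoly
  rw [show a + δ / 2 - 2 * (δ / 4) = a by ring,
    show a + δ / 2 + 2 * (δ / 4) = a + δ by ring] at hpoly
  have hint := intervalIntegrable_eval_mul hae hw
    (((hrcont.pow 2).mul hqcont).continuousOn)
  have hsub : Icc a (a + δ) ⊆ Icc a e := Icc_subset_Icc_right (by linarith)
  calc w₀ * Q * (δ / 4) ^ (2 * s.card + 1)
      ≤ w₀ * Q * ∫ x in a..(a + δ), (∏ z ∈ s, (x - z)) ^ 2 :=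
        mul_le_mul_of_nonneg_left hpoly (by positivity)
    _ = ∫ x in a..(a + δ), w₀ * Q * (∏ z ∈ s, (x - z)) ^ 2 :=
        (intervalIntegral.integral_const_mul _ _).symm
    _ ≤ ∫ x in a..(a + δ), ((∏ z ∈ s, (x - z)) ^ 2 * ∏ y ∈ Z, (y - x)) * w x := by
        refine intervalIntegral.integral_mono_on (by linarith)
          (Continuous.intervalIntegrable (by fun_prop) _ _)
          (hint.mono_set (by
            rw [uIcc_of_le (by linarith), uIcc_of_le hae.le]; exact hsub)) fun x hx => ?_
        have h1 : Q ≤ ∏ y ∈ Z, (y - x) := Finset.prod_le_prod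
          (fun y hy => by linarith [hZ y hy]) fun y hy => by linarith [hx.2]
        have h2 : w₀ ≤ w x := hmin x (hsub hx)
        calc w₀ * Q * (∏ z ∈ s, (x - z)) ^ 2
            ≤ w x * (∏ y ∈ Z, (y - x)) * (∏ z ∈ s, (x - z)) ^ 2 := by
              gcongr
              exact hw0.trans h2
          _ = _ := by ring
    _ ≤ _ := by
        refine intervalIntegral.integral_mono_interval le_rfl (by linarith) (by linarith) ?_ hint
        rw [Filter.EventuallyLE, ae_restrict_iff' measurableSet_Ioc]
        refine Filter.Eventually.of_forall fun x hx => ?_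
        have hx' := Ioc_subset_Icc_self hx
        exact mul_nonneg (mul_nonneg (sq_nonneg _) (hq0 x hx')) (hw0.trans (hmin x hx'))

lemma integral_sub_mul_prod_mul_le {a e η M : ℝ} (hae : a < e) (hη : 0 ≤ η) (hηe : a + η ≤ e)
    {w : ℝ → ℝ} (hw : ContinuousOn w (Icc a e)) (hw0 : ∀ x ∈ Icc a e, 0 ≤ w x)
    (hM : ∀ x ∈ Icc a e, w x ≤ M) {s Z : Finset ℝ} (hs : ∀ x ∈ s, x ∈ Icc a e)
    (hZ : ∀ y ∈ Z, e ≤ y) :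
    ∫ x in a..e, (x - a) * ((∏ z ∈ s, (x - z)) ^ 2 * ∏ y ∈ Z, (y - x)) * w x
      ≤ (η * ∫ x in a..e, ((∏ z ∈ s, (x - z)) ^ 2 * ∏ y ∈ Z, (y - x)) * w x) +
        (e - a) * ((e - a) * (((e - a) ^ s.card) ^ 2 * ∏ y ∈ Z, (y - (a + η))) * M) := by
  have hrcont : Continuous fun x : ℝ => ∏ z ∈ s, (x - z) := by fun_prop
  have hqcont : Continuous fun x : ℝ => ∏ y ∈ Z, (y - x) := by fun_prop
  have hq0 : ∀ x ∈ Icc a e, 0 ≤ ∏ y ∈ Z, (y - x) := fun x hx =>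
    Finset.prod_nonneg fun y hy => by linarith [hx.2, hZ y hy]
  have hM0 : 0 ≤ M := (hw0 a ⟨le_rfl, hae.le⟩).trans (hM a ⟨le_rfl, hae.le⟩)
  have hL0 : 0 < e - a := sub_pos.mpr hae
  have hQ0 : 0 ≤ ∏ y ∈ Z, (y - (a + η)) := hq0 _ ⟨by linarith, hηe⟩
  have hint : IntervalIntegrable (fun x => ((∏ z ∈ s, (x - z)) ^ 2 * ∏ y ∈ Z, (y - x)) * w x)
      volume a e := intervalIntegrable_eval_mul hae hw ((hrcont.pow 2).mul hqcont).continuousOn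
  have hint' : IntervalIntegrable
      (fun x => (x - a) * ((∏ z ∈ s, (x - z)) ^ 2 * ∏ y ∈ Z, (y - x)) * w x) volume a e :=
    intervalIntegrable_eval_mul hae hw
      ((continuous_id.sub continuous_const).mul ((hrcont.pow 2).mul hqcont)).continuousOn
  have hpt : ∀ x ∈ Icc a e, (x - a) * ((∏ z ∈ s, (x - z)) ^ 2 * ∏ y ∈ Z, (y - x)) * w x
      ≤ η * (((∏ z ∈ s, (x - z)) ^ 2 * ∏ y ∈ Z, (y - x)) * w x) +
        (e - a) * (((e - a) ^ s.card) ^ 2 * ∏ y ∈ Z, (y - (a + η))) * M := by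
    intro x hx
    have h1 := hw0 x hx
    have h2 := hq0 x hx
    have h3 : 0 ≤ x - a := sub_nonneg.mpr hx.1
    have h4 : 0 ≤ ((∏ z ∈ s, (x - z)) ^ 2 * ∏ y ∈ Z, (y - x)) * w x := by positivity
    rcases le_total x (a + η) with h | h
    · have h0 : 0 ≤ (e - a) * (((e - a) ^ s.card) ^ 2 * ∏ y ∈ Z, (y - (a + η))) * M := by
        positivity
      have h5 := mul_le_mul_of_nonneg_right (by linarith : x - a ≤ η) h4
      rw [mul_assoc]
      linarith
    · have h5 : ∏ y ∈ Z, (y - x) ≤ ∏ y ∈ Z, (y - (a + η)) := Finset.prod_le_prod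
        (fun y hy => by linarith [hx.2, hZ y hy]) fun y _ => by linarith
      have h6 : (∏ z ∈ s, (x - z)) ^ 2 ≤ ((e - a) ^ s.card) ^ 2 := by
        rw [← sq_abs, Finset.abs_prod, ← Finset.prod_const]
        gcongr with z hz
        rw [abs_le]
        constructor <;> linarith [hx.1, hx.2, (hs z hz).1, (hs z hz).2]
      have h7 : w x ≤ M := hM x hx
      have h8 : x - a ≤ e - a := by linarith [hx.2]
      have h9 : (x - a) * ((∏ z ∈ s, (x - z)) ^ 2 * ∏ y ∈ Z, (y - x)) * w x
        ≤ (e - a) * (((e - a) ^ s.card) ^ 2 * ∏ y ∈ Z, (y - (a + η))) * M := by gcongr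
      linarith [mul_nonneg hη h4]
  refine (intervalIntegral.integral_mono_on hae.le hint'
    ((hint.const_mul η).add intervalIntegrable_const) hpt).trans (le_of_eq ?_)
  rw [intervalIntegral.integral_add (hint.const_mul η) intervalIntegrable_const,
    intervalIntegral.integral_const_mul, intervalIntegral.integral_const, smul_eq_mul]

/-- A varying weight that decreases geometrically fast concentrates the mass at the left
endpoint. -/
theorem exists_concentration {a e d ε : ℝ} (hae : a < e) (hed : e ≤ d) {w : ℝ → ℝ}
    (hw : ContinuousOn w (Icc a e)) (hw0 : ∀ x ∈ Icc a e, 0 < w x) (hε : 0 < ε) :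
    ∃ A K θ : ℝ, 0 < K ∧ 0 ≤ θ ∧ θ < 1 ∧ ∀ s Z : Finset ℝ, (∀ x ∈ s, x ∈ Icc a e) →
      (∀ y ∈ Z, y ∈ Icc e d) → A * K ^ s.card * θ ^ Z.card ≤ 1 →
      ∫ x in a..e, (x - a) * ((∏ z ∈ s, (x - z)) ^ 2 * ∏ y ∈ Z, (y - x)) * w x
        ≤ ε * ∫ x in a..e, ((∏ z ∈ s, (x - z)) ^ 2 * ∏ y ∈ Z, (y - x)) * w x := by
  obtain ⟨δ, hδ0, hδε, hδL⟩ : ∃ δ : ℝ, 0 < δ ∧ 2 * δ ≤ ε / 2 ∧ a + 2 * δ ≤ e := by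
    refine ⟨min (ε / 4) ((e - a) / 2), by have := sub_pos.mpr hae; positivity, ?_, ?_⟩
    · linarith [min_le_left (ε / 4) ((e - a) / 2)]
    · linarith [min_le_right (ε / 4) ((e - a) / 2)]
  have hne : (Icc a e).Nonempty := nonempty_Icc.mpr hae.le
  obtain ⟨x₀, hx₀, hmin⟩ := isCompact_Icc.exists_isMinOn hne hw
  obtain ⟨x₁, hx₁, hmax⟩ := isCompact_Icc.exists_isMaxOn hne hw
  have hw0' := hw0 x₀ hx₀
  have hw1' := hw0 x₁ hx₁
  set w₀ := w x₀
  set M := w x₁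
  set L := e - a with hL
  have hL0 : 0 < L := sub_pos.mpr hae
  have hda : 0 < d - a := by linarith
  set θ := 1 - δ / (d - a) with hθ
  have hθ1 : δ / (d - a) ≤ 1 := (div_le_one hda).mpr (by linarith)
  refine ⟨L ^ 2 * M / (ε / 2 * w₀ * (δ / 4)), (L / (δ / 4)) ^ 2, θ, by positivity,
    by linarith, by rw [hθ]; linarith [div_pos hδ0 hda], fun s Z hs hZ hsmall => ?_⟩
  set Q := ∏ y ∈ Z, (y - (a + δ)) with hQ
  have hQ0 : 0 ≤ Q := Finset.prod_nonneg fun y hy => by linarith [(hZ y hy).1]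
  set k := s.card
  have hθQ : ∏ y ∈ Z, (y - (a + 2 * δ)) ≤ θ ^ Z.card * Q := by
    rw [hQ, ← Finset.prod_const, ← Finset.prod_mul_distrib]
    refine Finset.prod_le_prod (fun y hy => by linarith [(hZ y hy).1]) fun y hy => ?_
    have h1 : δ / (d - a) * (y - (a + δ)) ≤ δ := by
      rw [div_mul_eq_mul_div, div_le_iff₀ hda]
      nlinarith [(hZ y hy).2]
    rw [hθ]; linarith
  have hIlow := le_integral_prod_mul hδ0 (by linarith) hw hw0'.le (fun x hx => hmin hx) s
    fun y hy => (hZ y hy).1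
  have hIup := integral_sub_mul_prod_mul_le hae (by positivity : 0 ≤ 2 * δ) hδL hw
    (fun x hx => (hw0 x hx).le) (fun x hx => hmax hx) hs fun y hy => (hZ y hy).1
  have hfinal : (e - a) * ((e - a) * (((e - a) ^ k) ^ 2 * ∏ y ∈ Z, (y - (a + 2 * δ))) * M)
      ≤ ε / 2 * (w₀ * Q * (δ / 4) ^ (2 * k + 1)) := by
    have h0 : ((L / (δ / 4)) ^ 2) ^ k * (δ / 4) ^ (2 * k + 1) = (L ^ k) ^ 2 * (δ / 4) := by
      rw [pow_succ (δ / 4), pow_mul (δ / 4), ← mul_assoc, ← mul_pow, div_pow,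
        div_mul_cancel₀ _ (by positivity), pow_right_comm]
    have h1 : L * (L * ((L ^ k) ^ 2 * (θ ^ Z.card * Q)) * M)
        = (L ^ 2 * M / (ε / 2 * w₀ * (δ / 4)) * ((L / (δ / 4)) ^ 2) ^ k * θ ^ Z.card) *
          (ε / 2 * (w₀ * Q * (δ / 4) ^ (2 * k + 1))) := by
      have h2 : L ^ 2 * M / (ε / 2 * w₀ * (δ / 4)) * (ε / 2 * w₀ * (δ / 4)) = L ^ 2 * M :=
        div_mul_cancel₀ _ (by positivity)
      linear_combination (-(L ^ k) ^ 2 * θ ^ Z.card * Q) * h2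
        - (L ^ 2 * M / (ε / 2 * w₀ * (δ / 4)) * θ ^ Z.card * (ε / 2 * w₀) * Q) * h0
    refine le_trans ?_ (h1.le.trans (mul_le_of_le_one_left (by positivity) hsmall))
    gcongr
  have hI0 : 0 ≤ ∫ x in a..e, ((∏ z ∈ s, (x - z)) ^ 2 * ∏ y ∈ Z, (y - x)) * w x :=
    le_trans (by positivity) hIlow
  nlinarith

end Concentration

section MarginalFilter
open Filter Topology

/-- Multi-indices `n` with `n.2 → ∞` and `n.1 / n.2 → 0`. -/
def marginalFilter : Filter (ℕ × ℕ) :=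
  comap (fun n => ((n.2 : ℝ), (n.1 : ℝ) / n.2)) (atTop ×ˢ 𝓝 0)

lemma tendsto_marginalFilter_iff {ι : Type*} {l : Filter ι} {u : ι → ℕ × ℕ} :
    Tendsto u l marginalFilter ↔ Tendsto (fun k => ((u k).2 : ℝ)) l atTop ∧
      Tendsto (fun k => ((u k).1 : ℝ) / (u k).2) l (𝓝 0) := by
  rw [marginalFilter, tendsto_comap_iff, tendsto_prod_iff']
  rfl

lemma tendsto_snd_marginalFilter : Tendsto (fun n : ℕ × ℕ => (n.2 : ℝ)) marginalFilter atTop :=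
  (tendsto_marginalFilter_iff.mp tendsto_id).1

lemma tendsto_ratio_marginalFilter :
    Tendsto (fun n : ℕ × ℕ => (n.1 : ℝ) / n.2) marginalFilter (𝓝 0) :=
  (tendsto_marginalFilter_iff.mp tendsto_id).2

lemma eventually_le_snd (M : ℕ) : ∀ᶠ n in marginalFilter, M ≤ n.2 := by
  filter_upwards [tendsto_snd_marginalFilter.eventually_ge_atTop (M : ℝ)] with n hn
  exact_mod_cast hn

lemma eventually_mul_fst_le_snd (p : ℕ) : ∀ᶠ n in marginalFilter, p * n.1 ≤ n.2 := by
  filter_upwards [eventually_le_snd 1, tendsto_ratio_marginalFilter.eventually_le_const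
    (by positivity : (0 : ℝ) < 1 / (p + 1))] with n h1 h2
  have h3 : (0 : ℝ) < n.2 := by exact_mod_cast h1
  rw [div_le_div_iff₀ h3 (by positivity)] at h2
  have h4 : n.1 * (p + 1) ≤ n.2 := by exact_mod_cast (by linarith : (n.1 : ℝ) * (p + 1) ≤ n.2)
  nlinarith

lemma tendsto_shift {u : ℕ × ℕ → ℕ × ℕ} (h1 : ∀ n, (u n).1 ≤ n.1 + 1)
    (h2 : ∀ n, n.2 ≤ (u n).2 + 1) :
    Tendsto u marginalFilter marginalFilter := by
  have hsnd := tendsto_snd_marginalFilter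
  refine tendsto_marginalFilter_iff.mpr ⟨?_, ?_⟩
  · refine tendsto_atTop_mono (fun n => ?_) (tendsto_atTop_add_const_right _ (-1 : ℝ) hsnd)
    have : (n.2 : ℝ) ≤ (u n).2 + 1 := by exact_mod_cast h2 n
    linarith
  · have h : Tendsto (fun n : ℕ × ℕ => 2 * ((n.1 : ℝ) / n.2 + 1 / n.2)) marginalFilter (𝓝 0) := by
      simpa using (tendsto_ratio_marginalFilter.add (hsnd.const_div_atTop 1)).const_mul 2
    refine squeeze_zero' (Eventually.of_forall fun n => by positivity) ?_ h
    filter_upwards [eventually_le_snd 2] with n hn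
    have h3 : (2 : ℝ) ≤ n.2 := by exact_mod_cast hn
    have h4 : (n.2 : ℝ) ≤ (u n).2 + 1 := by exact_mod_cast h2 n
    have h5 : ((u n).1 : ℝ) ≤ n.1 + 1 := by exact_mod_cast h1 n
    rw [← add_div, ← mul_div_assoc, div_le_div_iff₀ (by linarith) (by linarith)]
    nlinarith [(u n).1.cast_nonneg (α := ℝ), n.1.cast_nonneg (α := ℝ)]

lemma tendsto_add_evec (j : Fin 2) : Tendsto (fun n => n + evec j) marginalFilter marginalFilter :=
  tendsto_shift (fun n => by unfold evec; split_ifs <;> simp)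
    fun n => by unfold evec; split_ifs <;> simp; omega

lemma tendsto_sub_evec (j : Fin 2) : Tendsto (fun n => n - evec j) marginalFilter marginalFilter :=
  tendsto_shift (fun n => by unfold evec; split_ifs <;> simp; omega)
    fun n => by unfold evec; split_ifs <;> simp; omega

lemma eventually_mul_pow_le_one (A : ℝ) {K θ : ℝ} (hK : 0 < K) (hθ0 : 0 ≤ θ) (hθ1 : θ < 1) :
    ∀ᶠ n in marginalFilter, ∀ k ≤ n.1, A * K ^ k * θ ^ n.2 ≤ 1 := by
  have hK' : 0 < max 1 K := lt_max_of_lt_left one_pos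
  obtain ⟨p, hp⟩ := exists_pow_lt_of_lt_one (inv_pos.mpr hK') hθ1
  obtain ⟨M, hM⟩ := exists_pow_lt_of_lt_one (by positivity : (0 : ℝ) < (|A| + 1)⁻¹) hθ1
  filter_upwards [eventually_mul_fst_le_snd (2 * p), eventually_le_snd (2 * M)] with n h1 h2 k hk
  have h3 : p * n.1 + M ≤ n.2 := by
    have := mul_assoc 2 p n.1
    omega
  have h4 : K ^ k ≤ max 1 K ^ n.1 := (pow_le_pow_left₀ hK.le (le_max_right _ _) k).trans
    (pow_le_pow_right₀ (le_max_left _ _) hk)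
  have h5 : max 1 K ^ n.1 * θ ^ (p * n.1) ≤ 1 := by
    rw [pow_mul, ← mul_pow]
    refine pow_le_one₀ (by positivity) ?_
    calc max 1 K * θ ^ p ≤ max 1 K * (max 1 K)⁻¹ := by gcongr
      _ = 1 := mul_inv_cancel₀ hK'.ne'
  have h6 : (|A| + 1) * θ ^ M ≤ 1 := by
    calc (|A| + 1) * θ ^ M ≤ (|A| + 1) * (|A| + 1)⁻¹ := by gcongr
      _ = 1 := mul_inv_cancel₀ (by positivity)
  calc A * K ^ k * θ ^ n.2 ≤ (|A| + 1) * max 1 K ^ n.1 * θ ^ (p * n.1 + M) := by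
        gcongr ?_ * ?_ * ?_
        · linarith [le_abs_self A]
        · exact pow_le_pow_of_le_one hθ0 hθ1.le h3
    _ = (max 1 K ^ n.1 * θ ^ (p * n.1)) * ((|A| + 1) * θ ^ M) := by rw [pow_add]; ring
    _ ≤ 1 := mul_le_one₀ h5 (by positivity) h6

lemma tendsto_marginalFilter {n : ℕ → ℕ × ℕ}
    (hsum : Tendsto (fun k => (n k).1 + (n k).2) atTop atTop)
    (hratio : Tendsto (fun k => ((n k).1 : ℝ) / (((n k).1 : ℝ) + ((n k).2 : ℝ))) atTop (𝓝 0)) :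
    Tendsto n atTop marginalFilter := by
  have hev : ∀ᶠ k in atTop, ((n k).1 : ℝ) + (n k).2 ≤ 2 * (n k).2 ∧ (1 : ℝ) ≤ (n k).2 := by
    filter_upwards [hsum.eventually_ge_atTop 1,
      hratio.eventually_le_const (by norm_num : (0 : ℝ) < 1 / 2)] with k h1 h2
    have h3 : (1 : ℝ) ≤ (n k).1 + (n k).2 := by exact_mod_cast h1
    rw [div_le_div_iff₀ (by linarith) (by norm_num)] at h2
    have h4 : (0 : ℝ) < (n k).2 := by linarith
    exact ⟨by linarith, by exact_mod_cast h4⟩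
  refine tendsto_marginalFilter_iff.mpr ⟨?_, ?_⟩
  · have h := (tendsto_natCast_atTop_atTop (R := ℝ)).comp hsum
    refine tendsto_atTop_mono' _ ?_ (h.atTop_div_const (by norm_num : (0 : ℝ) < 2))
    filter_upwards [hev] with k hk
    simp only [Function.comp, Nat.cast_add]
    linarith [hk.1]
  · have h := hratio.const_mul 2
    rw [mul_zero] at h
    refine squeeze_zero' (Eventually.of_forall fun k => by positivity) ?_ h
    filter_upwards [hev] with k hk
    rw [← mul_div_assoc, div_le_div_iff₀ (by linarith [hk.2])
      (by linarith [hk.2, (n k).1.cast_nonneg (α := ℝ)])]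
    nlinarith [hk.1, (n k).1.cast_nonneg (α := ℝ)]

lemma tendsto_sub_of_forall_near {α : Type*} {l : Filter α} {u : α → α} (hu : Tendsto u l l)
    {F : α → ℝ} (hF : ∀ η > 0, ∃ t, ∀ᶠ n in l, |F n - t| ≤ η) :
    Tendsto (fun n => F (u n) - F n) l (𝓝 0) := by
  rw [Metric.tendsto_nhds]
  intro ε hε
  obtain ⟨t, ht⟩ := hF (ε / 4) (by positivity)
  filter_upwards [ht, hu.eventually ht] with n h1 h2
  rw [Real.dist_eq, sub_zero]
  rw [abs_le] at h1 h2
  rw [abs_lt]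
  constructor <;> linarith [h1.1, h1.2, h2.1, h2.2]

lemma tendsto_div_of_forall_near {α : Type*} {l : Filter α} {u : α → α} (hu : Tendsto u l l)
    {F : α → ℝ} (hF : ∀ η > 0, ∃ t, 0 < t ∧ ∀ᶠ n in l, |F n - t| ≤ η * t) :
    Tendsto (fun n => F (u n) / F n) l (𝓝 1) := by
  rw [Metric.tendsto_nhds]
  intro ε hε
  obtain ⟨t, ht0, ht⟩ := hF (min (1 / 2) (ε / 8)) (by positivity)
  filter_upwards [ht, hu.eventually ht] with n h1 h2
  have h3 := mul_le_mul_of_nonneg_right (min_le_left (1 / 2) (ε / 8)) ht0.le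
  have h4 := mul_le_mul_of_nonneg_right (min_le_right (1 / 2) (ε / 8)) ht0.le
  have h5 := abs_le.mp h1
  have h6 := abs_le.mp h2
  have h7 : 0 < F n := by linarith [h5.1]
  rw [Real.dist_eq, div_sub_one h7.ne', abs_div, abs_of_pos h7, div_lt_iff₀ h7, abs_lt]
  have h8 : ε * (t / 2) ≤ ε * F n := mul_le_mul_of_nonneg_left (by linarith [h5.1]) hε.le
  have h9 : 0 < ε * t := by positivity
  constructor <;> linarith [h5.1, h5.2, h6.1, h6.2]

end MarginalFilter

section Zeros
open Polynomial Set Filter Topology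

variable {S : AngelescoSystem α₁ β₁ α₂ β₂} {P : ℕ × ℕ → ℝ[X]} {Z : ℕ × ℕ → Fin 2 → Finset ℝ}

lemma IsTypeII.integral_mul_pow_eq (h₁ : α₁ < β₁) (h₃ : α₂ < β₂) (hP : IsTypeII S P) (n : ℕ × ℕ)
    (i : Fin 2) {u : ℝ[X]} (hu : u.Monic) (hdeg : u.natDegree = nComp n i) :
    ∫ x, (P n).eval x * x ^ nComp n i ∂S.μ i
      = ∫ x in (iLo α₁ α₂ i)..(iHi β₁ β₂ i), (P n * u).eval x * S.f i x := by
  rw [S.integral_μ i (iLo_lt_iHi h₁ h₃ i)]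
  have hd : (X ^ nComp n i - u).degree < (nComp n i : WithBot ℕ) := by
    have := degree_sub_lt_left (p := X ^ nComp n i) (q := u)
      (by rw [degree_X_pow, degree_eq_natDegree hu.ne_zero, hdeg]) (pow_ne_zero _ X_ne_zero)
      (by rw [(monic_X_pow _).leadingCoeff, hu.leadingCoeff])
    rwa [degree_X_pow] at this
  have h := hP.orthogonal h₁ h₃ n i _ hd
  rw [← sub_eq_zero, ← intervalIntegral.integral_sub, ← h]
  · refine intervalIntegral.integral_congr fun x _ => ?_
    simp only [eval_mul, eval_sub, eval_pow, eval_X]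
    ring
  · refine (S.intervalIntegrable h₁ h₃ i (P n * X ^ nComp n i)).congr fun x _ => ?_
    simp only [eval_mul, eval_pow, eval_X]
  · exact S.intervalIntegrable h₁ h₃ i (P n * u)

lemma prod_sub_eq_neg_one_pow_mul (s : Finset ℝ) (x : ℝ) :
    ∏ y ∈ s, (x - y) = (-1) ^ s.card * ∏ y ∈ s, (y - x) := by
  rw [← Finset.prod_const, ← Finset.prod_mul_distrib]
  exact Finset.prod_congr rfl fun y _ => by ring

lemma IsZeroSet.eval_eq (hZ : IsZeroSet α₁ β₁ α₂ β₂ P Z) (n : ℕ × ℕ) (x : ℝ) :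
    (P n).eval x = (∏ y ∈ Z n 0, (x - y)) * ∏ y ∈ Z n 1, (x - y) := by
  rw [(hZ n).2.1]
  simp [eval_prod]

lemma IsZeroSet.coeff_eq (hZ : IsZeroSet α₁ β₁ α₂ β₂ P Z) {n : ℕ × ℕ} (hn : 1 ≤ n.1 + n.2) :
    (P n).coeff (n.1 + n.2 - 1) = -(∑ x ∈ Z n 0, x + ∑ y ∈ Z n 1, y) := by
  have h0 : (Z n 0).card = n.1 := (hZ n).2.2 0
  have h1 : (Z n 1).card = n.2 := (hZ n).2.2 1
  have hdeg : (P n).natDegree = n.1 + n.2 := by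
    rw [(hZ n).2.1, natDegree_prod_X_sub, h0, h1]
  have hmonic : ∀ s : Finset ℝ, (∏ y ∈ s, (X - C y) : ℝ[X]).Monic := fun s =>
    monic_prod_of_monic _ _ fun y _ => monic_X_sub_C y
  rw [← hdeg, ← nextCoeff_of_natDegree_pos (by omega), (hZ n).2.1,
    (hmonic _).nextCoeff_mul (hmonic _), prod_X_sub_C_nextCoeff, prod_X_sub_C_nextCoeff]
  ring

/-- The zeros in the first interval collapse onto its left endpoint. -/
lemma IsTypeII.eventually_zeros_le (h₁ : α₁ < β₁) (h₂ : β₁ < α₂) (h₃ : α₂ < β₂)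
    (hP : IsTypeII S P) (hZ : IsZeroSet α₁ β₁ α₂ β₂ P Z) {ε : ℝ} (hε : 0 < ε) :
    ∀ᶠ n in marginalFilter, ∀ x ∈ Z n 0, x ≤ α₁ + ε := by
  obtain ⟨A, K, θ, hK, hθ0, hθ1, h⟩ := exists_concentration h₁ (h₂.trans h₃).le
    (S.continuousOn_f 0) (S.posf 0) hε
  filter_upwards [eventually_mul_pow_le_one A hK hθ0 hθ1] with n hn x hx
  have hc0 : (Z n 0).card = n.1 := (hZ n).2.2 0
  have hc1 : (Z n 1).card = n.2 := (hZ n).2.2 1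
  have hm0 : ∀ z ∈ Z n 0, z ∈ Ioo α₁ β₁ := (hZ n).1 0
  have hm1 : ∀ y ∈ Z n 1, y ∈ Ioo α₂ β₂ := (hZ n).1 1
  have hle := h ((Z n 0).erase x) (Z n 1)
    (fun z hz => Ioo_subset_Icc_self (hm0 z (Finset.mem_of_mem_erase hz)))
    (fun y hy => ⟨h₂.le.trans (hm1 y hy).1.le, (hm1 y hy).2.le⟩)
    (by rw [hc1]; exact hn _ (hc0 ▸ Finset.card_erase_le))
  set r : ℝ[X] := ∏ z ∈ (Z n 0).erase x, (X - C z) with hr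
  have hreval : ∀ t : ℝ, r.eval t = ∏ z ∈ (Z n 0).erase x, (t - z) := fun t => by
    rw [hr]; simp [eval_prod]
  set Q : ℝ[X] := ∏ y ∈ Z n 1, (C y - X) with hQ
  have hQeval : ∀ t : ℝ, Q.eval t = ∏ y ∈ Z n 1, (y - t) := fun t => by
    rw [hQ]; simp [eval_prod]
  simp only [← hreval, ← hQeval] at hle
  have horth := hP.orthogonal h₁ h₃ n 0 r (by
    have h0 : r.natDegree = (Z n 0).card - 1 := by
      rw [hr, natDegree_prod_of_monic _ _ fun z _ => monic_X_sub_C z]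
      simp [Finset.card_erase_of_mem hx]
    have h1 := Finset.card_pos.mpr ⟨x, hx⟩
    refine degree_le_natDegree.trans_lt ?_
    rw [h0, ← (hZ n).2.2 0]
    exact_mod_cast (by omega))
  have hpt : ∀ t : ℝ, (P n * r).eval t * S.f 0 t = (-1) ^ n.2 *
      ((t - α₁) * (r.eval t ^ 2 * Q.eval t) * S.f 0 t
        - (x - α₁) * ((r.eval t ^ 2 * Q.eval t) * S.f 0 t)) := fun t => by
    rw [eval_mul, hZ.eval_eq, ← Finset.mul_prod_erase _ _ hx, ← hreval,
      prod_sub_eq_neg_one_pow_mul, hc1, ← hQeval]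
    ring
  have hpos : 0 < ∫ t in α₁..β₁, r.eval t ^ 2 * Q.eval t * S.f 0 t := by
    have := integral_eval_mul_pos h₁ (S.continuousOn_f 0) (S.posf 0) (G := r ^ 2 * Q)
      (mul_ne_zero (pow_ne_zero _ (Finset.prod_ne_zero_iff.mpr fun z _ => X_sub_C_ne_zero z))
        (Finset.prod_ne_zero_iff.mpr fun y _ => by
          rw [← neg_sub, neg_ne_zero]; exact X_sub_C_ne_zero y)) fun t ht => by
        rw [eval_mul, eval_pow, hQeval]
        refine mul_nonneg (sq_nonneg _) (Finset.prod_nonneg fun y hy => ?_)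
        linarith [(hm1 y hy).1, ht.2]
    simpa only [eval_mul, eval_pow] using this
  simp only [hpt] at horth
  have hc : Continuous fun t : ℝ => r.eval t ^ 2 * Q.eval t := by fun_prop
  rw [intervalIntegral.integral_const_mul, intervalIntegral.integral_sub,
    intervalIntegral.integral_const_mul, mul_eq_zero, or_iff_right (by positivity), sub_eq_zero]
    at horth
  · have h0 : (x - α₁) * ∫ t in α₁..β₁, r.eval t ^ 2 * Q.eval t * S.f 0 t
        ≤ ε * ∫ t in α₁..β₁, r.eval t ^ 2 * Q.eval t * S.f 0 t := horth.symm.le.trans hle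
    linarith [le_of_mul_le_mul_right h0 hpos]
  · exact intervalIntegrable_eval_mul h₁ (S.continuousOn_f 0) (by fun_prop)
  · exact (intervalIntegrable_eval_mul h₁ (S.continuousOn_f 0) hc.continuousOn).const_mul _

lemma IsTypeII.tendsto_sum_sub (h₁ : α₁ < β₁) (h₂ : β₁ < α₂) (h₃ : α₂ < β₂) (hP : IsTypeII S P)
    (hZ : IsZeroSet α₁ β₁ α₂ β₂ P Z) (j : Fin 2) {g : ℝ → ℝ} (hg : MonotoneOn g (Icc α₁ β₁))
    (hgc : ContinuousOn g (Icc α₁ β₁)) :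
    Tendsto (fun n => ∑ x ∈ Z (n + evec j) 0, g x - ∑ x ∈ Z n 0, g x) marginalFilter
      (𝓝 ((if j = 0 then 1 else 0) * g α₁)) := by
  rw [Metric.tendsto_nhds]
  intro ε hε
  have hα : α₁ ∈ Icc α₁ β₁ := ⟨le_rfl, h₁.le⟩
  obtain ⟨δ, hδ0, hδ⟩ := Metric.continuousOn_iff.mp hgc α₁ hα ε hε
  set e := min β₁ (α₁ + δ / 2) with he
  have hαe : α₁ ≤ e := le_min h₁.le (by linarith)
  have heβ : e ∈ Icc α₁ β₁ := ⟨hαe, min_le_left _ _⟩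
  have hge : g e - g α₁ < ε := by
    have := hδ e heβ (by
      rw [Real.dist_eq, abs_of_nonneg (by linarith)]
      linarith [min_le_right β₁ (α₁ + δ / 2)])
    exact (abs_lt.mp this).2
  have hev := hP.eventually_zeros_le h₁ h₂ h₃ hZ (half_pos hδ0)
  have hmem : ∀ n, (∀ x ∈ Z n 0, x ≤ α₁ + δ / 2) → ∀ x ∈ Z n 0, x ∈ Icc α₁ e := fun n hn x hx => by
    have h : x ∈ Ioo α₁ β₁ := (hZ n).1 0 x hx
    exact ⟨h.1.le, le_min h.2.le (hn x hx)⟩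
  filter_upwards [hev, (tendsto_add_evec j).eventually hev] with n hn hn'
  obtain ⟨hi1, hi2⟩ := hP.interlace h₁ h₂ h₃ hZ n j 0
  have h := abs_sum_sub_sum_le_of_interlaced hαe (hg.mono (Icc_subset_Icc_right heβ.2)) (Z n 0)
    (Z (n + evec j) 0) (hmem n hn) (hmem _ hn') hi2 hi1
  have hcard : ((Z (n + evec j) 0).card : ℝ) - (Z n 0).card = if j = 0 then 1 else 0 := by
    rw [(hZ n).2.2 0, (hZ _).2.2 0]
    fin_cases j <;> simp [nComp, evec]
  rw [hcard] at h
  rw [Real.dist_eq]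
  exact h.trans_lt hge

/-- Asymptotics of the second factor of the multiple orthogonal polynomials. -/
lemma IsTypeII.exists_asymptotics (h₁ : α₁ < β₁) (h₂ : β₁ < α₂) (h₃ : α₂ < β₂)
    (hP : IsTypeII S P) (hZ : IsZeroSet α₁ β₁ α₂ β₂ P Z) {m lam : ℝ} (hm : m = (α₂ + β₂) / 2)
    (hlam : lam = (β₂ - α₂) / 4) {η : ℝ} (hη : 0 < η) :
    ∃ D t : ℝ, 0 < D ∧ ∀ᶠ n in marginalFilter,
      |(∫ x, (P n).eval x * x ^ nComp n 1 ∂S.μ 1)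
          - D * lam ^ (2 * n.2) * ∏ x ∈ Z n 0, joukowski m lam x|
        ≤ η * (D * lam ^ (2 * n.2) * ∏ x ∈ Z n 0, joukowski m lam x) ∧
      |-∑ y ∈ Z n 1, y + n.2 * m - lam * (t - ∑ x ∈ Z n 0, omegaOf m lam x)| ≤ η := by
  have hlo : m - 2 * lam = α₂ := by rw [hm, hlam]; ring
  have hhi : m + 2 * lam = β₂ := by rw [hm, hlam]; ring
  have hw : ContinuousOn (S.f 1) (Icc (m - 2 * lam) (m + 2 * lam)) := by
    rw [hlo, hhi]; exact S.continuousOn_f 1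
  have hw0 : ∀ x ∈ Icc (m - 2 * lam) (m + 2 * lam), 0 < S.f 1 x := by
    rw [hlo, hhi]; exact S.posf 1
  obtain ⟨A, K, ρ, D, t, hK, hρ, hD, h⟩ := _root_.exists_asymptotics (β := β₁)
    (by rw [hlam]; linarith) (by rwa [hlo]) hw hw0 hη
  rw [hlo, hhi] at h
  refine ⟨D, t, hD, ?_⟩
  filter_upwards [eventually_mul_pow_le_one A hK (inv_nonneg.mpr (by linarith))
    (inv_lt_one_of_one_lt₀ hρ), eventually_le_snd 2] with n hn hn2
  have hc0 : (Z n 0).card = n.1 := (hZ n).2.2 0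
  have hc1 : (Z n 1).card = n.2 := (hZ n).2.2 1
  set q : ℝ[X] := ∏ y ∈ Z n 1, (X - C y) with hq
  have hqm : q.Monic := monic_prod_of_monic _ _ fun y _ => monic_X_sub_C y
  have hqN : q.natDegree = n.2 := by
    rw [hq, natDegree_prod_of_monic _ _ fun y _ => monic_X_sub_C y]
    simp [hc1]
  have hqeval : ∀ x : ℝ, q.eval x = ∏ y ∈ Z n 1, (x - y) := fun x => by
    rw [hq]; simp [eval_prod]
  have hmain := h (Z n 0) (fun x hx => ((hZ n).1 0 x hx).2.le) n.2 hn2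
    (by rw [hc0]; exact hn _ le_rfl) q hqm hqN fun r hr => by
      have := hP.orthogonal h₁ h₃ n 1 r (degree_le_natDegree.trans_lt (by exact_mod_cast hr))
      refine Eq.trans (intervalIntegral.integral_congr fun x _ => ?_) this
      simp only [eval_mul, hZ.eval_eq, hqeval]
      ring
  refine ⟨?_, ?_⟩
  · rw [hP.integral_mul_pow_eq h₁ h₃ n 1 hqm hqN]
    convert hmain.1 using 3
    refine intervalIntegral.integral_congr fun x _ => ?_
    simp only [eval_mul, hZ.eval_eq, hqeval]
    ring
  · have hcoeff : q.coeff (n.2 - 1) = -∑ y ∈ Z n 1, y := by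
      rw [← hqN, ← nextCoeff_of_natDegree_pos (by omega), hq, prod_X_sub_C_nextCoeff]
    rw [← hcoeff]
    exact hmain.2

end Zeros

section Limits
open Polynomial Set Filter Topology

variable {S : AngelescoSystem α₁ β₁ α₂ β₂} {P : ℕ × ℕ → ℝ[X]} {Z : ℕ × ℕ → Fin 2 → Finset ℝ}

lemma acoef_add_evec (S : AngelescoSystem α₁ β₁ α₂ β₂) (P : ℕ × ℕ → ℝ[X]) (n : ℕ × ℕ) (j : Fin 2) :
    acoef S P (n + evec j) j = (∫ x, (P (n + evec j)).eval x * x ^ nComp (n + evec j) j ∂S.μ j) /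
      ∫ x, (P n).eval x * x ^ nComp n j ∂S.μ j := by
  have h1 : n + evec j - evec j = n := by ext <;> simp
  have h2 : nComp (n + evec j) j - 1 = nComp n j := by fin_cases j <;> simp [nComp, evec]
  rw [acoef, h1, h2]

lemma tendsto_sum_omegaOf_sub (h₁ : α₁ < β₁) (h₂ : β₁ < α₂) (h₃ : α₂ < β₂) (hP : IsTypeII S P)
    (hZ : IsZeroSet α₁ β₁ α₂ β₂ P Z) {m lam : ℝ} (hlam : 0 < lam) (hβ : β₁ < m - 2 * lam)
    (j : Fin 2) :
    Tendsto (fun n => ∑ x ∈ Z (n + evec j) 0, omegaOf m lam x - ∑ x ∈ Z n 0, omegaOf m lam x)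
      marginalFilter (𝓝 ((if j = 0 then 1 else 0) * omegaOf m lam α₁)) :=
  hP.tendsto_sum_sub h₁ h₂ h₃ hZ j
    (fun _ _ _ hy hxy => omegaOf_mono hlam hxy (hy.2.trans_lt hβ))
    (continuousOn_const.div continuous_joukowski.continuousOn fun _ hx =>
      (hlam.trans (lt_joukowski (hx.2.trans_lt hβ))).ne')

theorem IsTypeII.tendsto_bcoef (h₁ : α₁ < β₁) (h₂ : β₁ < α₂) (h₃ : α₂ < β₂) (hP : IsTypeII S P)
    {m lam : ℝ} (hm : m = (α₂ + β₂) / 2) (hlam : lam = (β₂ - α₂) / 4) (j : Fin 2) :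
    Tendsto (fun n => bcoef S P n j) marginalFilter
      (𝓝 (if j = 0 then α₁ + lam * omegaOf m lam α₁ else m)) := by
  obtain ⟨Z, hZ⟩ := hP.exists_isZeroSet h₁ h₂ h₃
  have hlam0 : 0 < lam := by rw [hlam]; linarith
  have hβ : β₁ < m - 2 * lam := by rw [hm, hlam]; linarith
  have hF := tendsto_sub_of_forall_near (tendsto_add_evec j)
    (F := fun n : ℕ × ℕ =>
      -∑ y ∈ Z n 1, y + n.2 * m + lam * ∑ x ∈ Z n 0, omegaOf m lam x) fun η hη => by
    obtain ⟨D, t, -, h⟩ := hP.exists_asymptotics h₁ h₂ h₃ hZ hm hlam hη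
    refine ⟨lam * t, h.mono fun n hn => ?_⟩
    rw [show ∀ a b c : ℝ, a + lam * b - lam * c = a - lam * (c - b) from fun a b c => by ring]
    exact hn.2
  have hx := hP.tendsto_sum_sub h₁ h₂ h₃ hZ j (monotoneOn_id) continuousOn_id
  have hω := tendsto_sum_omegaOf_sub h₁ h₂ h₃ hP hZ hlam0 hβ j
  have hlim := ((hx.add (hω.const_mul lam)).sub hF).add_const (if j = 0 then 0 else m)
  refine Tendsto.congr' ?_ (hlim.trans (le_of_eq ?_))
  · filter_upwards [eventually_le_snd 1] with n hn
    have h := hZ.coeff_eq (n := n + evec j) (by simp; omega)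
    have hidx : (n + evec j).1 + (n + evec j).2 - 1 = n.1 + n.2 := by
      fin_cases j <;> simp [evec]
    have hsnd : (((n + evec j).2 : ℕ) : ℝ) = n.2 + if j = 0 then 0 else 1 := by
      fin_cases j <;> simp [evec]
    rw [hidx] at h
    rw [bcoef, h, hZ.coeff_eq (by omega), hsnd]
    simp only [id]
    split_ifs <;> ring
  · congr 1
    simp only [id]
    split_ifs <;> ring

theorem IsTypeII.tendsto_acoef_one (h₁ : α₁ < β₁) (h₂ : β₁ < α₂) (h₃ : α₂ < β₂)
    (hP : IsTypeII S P) {m lam : ℝ} (hm : m = (α₂ + β₂) / 2) (hlam : lam = (β₂ - α₂) / 4) :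
    Tendsto (fun n => acoef S P (n + evec 1) 1) marginalFilter (𝓝 (lam ^ 2)) := by
  obtain ⟨Z, hZ⟩ := hP.exists_isZeroSet h₁ h₂ h₃
  have hlam0 : 0 < lam := by rw [hlam]; linarith
  have hβ : β₁ < m - 2 * lam := by rw [hm, hlam]; linarith
  have hψ : ∀ n : ℕ × ℕ, ∀ x ∈ Z n 0, 0 < joukowski m lam x := fun n x hx =>
    hlam0.trans (lt_joukowski (((hZ n).1 0 x hx).2.trans hβ))
  set E : ℕ × ℕ → ℝ := fun n => lam ^ (2 * n.2) * ∏ x ∈ Z n 0, joukowski m lam x with hE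
  have hE0 : ∀ n, 0 < E n := fun n => mul_pos (by positivity) (Finset.prod_pos (hψ n))
  set H : ℕ × ℕ → ℝ := fun n => ∫ x, (P n).eval x * x ^ nComp n 1 ∂S.μ 1 with hH
  have hG := tendsto_div_of_forall_near (tendsto_add_evec 1)
      (F := fun n => H n / E n) fun η hη => by
    obtain ⟨D, t, hD, h⟩ := hP.exists_asymptotics h₁ h₂ h₃ hZ hm hlam hη
    refine ⟨D, hD, h.mono fun n hn => ?_⟩
    have := hn.1
    rw [mul_assoc D] at this
    rw [div_sub' (hE0 n).ne', abs_div, abs_of_pos (hE0 n), div_le_iff₀ (hE0 n), mul_comm (E n)]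
    linarith
  have hg : Tendsto (fun n => ∑ x ∈ Z (n + evec 1) 0, -Real.log (joukowski m lam x) -
      ∑ x ∈ Z n 0, -Real.log (joukowski m lam x)) marginalFilter (𝓝 0) := by
    have := hP.tendsto_sum_sub h₁ h₂ h₃ hZ 1 (g := fun x => -Real.log (joukowski m lam x))
      (fun x _ y hy hxy => neg_le_neg (Real.log_le_log
        (hlam0.trans (lt_joukowski (hy.2.trans_lt hβ)))
        (joukowski_antitone hlam0 hxy (hy.2.trans_lt hβ))))
      (ContinuousOn.log continuous_joukowski.continuousOn fun x hx =>
        (hlam0.trans (lt_joukowski (hx.2.trans_lt hβ))).ne').neg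
    simpa using this
  have hexp := ((Real.continuous_exp.tendsto _).comp hg.neg).const_mul (lam ^ 2)
  rw [neg_zero, Real.exp_zero, mul_one] at hexp
  have hlim := hG.mul hexp
  rw [one_mul] at hlim
  refine hlim.congr fun n => ?_
  have hEr : E (n + evec 1) = E n * (lam ^ 2 * Real.exp
      (-(∑ x ∈ Z (n + evec 1) 0, -Real.log (joukowski m lam x) -
        ∑ x ∈ Z n 0, -Real.log (joukowski m lam x)))) := by
    rw [Finset.sum_neg_distrib, Finset.sum_neg_distrib, neg_sub, sub_neg_eq_add, neg_add_eq_sub,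
      Real.exp_sub, Real.exp_sum, Real.exp_sum,
      Finset.prod_congr rfl fun x hx => Real.exp_log (hψ (n + evec 1) x hx),
      Finset.prod_congr rfl fun x hx => Real.exp_log (hψ n x hx)]
    have := Finset.prod_pos (hψ n)
    simp only [hE]
    rw [show (n + evec 1).2 = n.2 + 1 from rfl]
    field_simp
    ring
  rw [acoef_add_evec]
  simp only [Function.comp]
  change H (n + evec 1) / E (n + evec 1) / (H n / E n) * _ = H (n + evec 1) / H n
  rw [div_div_div_eq, div_mul_eq_mul_div, mul_assoc, ← hEr, mul_comm (E (n + evec 1)) (H n),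
    mul_div_mul_right _ _ (hE0 _).ne']

end Limits

section FirstCoefficient
open Polynomial Set Filter Topology

variable {S : AngelescoSystem α₁ β₁ α₂ β₂} {P : ℕ × ℕ → ℝ[X]} {Z : ℕ × ℕ → Fin 2 → Finset ℝ}

lemma IsTypeII.integral_mul_mul_eq (h₁ : α₁ < β₁) (h₃ : α₂ < β₂) (hP : IsTypeII S P)
    (hZ : IsZeroSet α₁ β₁ α₂ β₂ P Z) (n : ℕ × ℕ) {u : ℝ[X]} (hu : u.Monic)
    (hdeg : u.natDegree = n.1) :
    ∫ x in α₁..β₁, (∏ z ∈ Z n 0, (x - z)) * u.eval x * (∏ y ∈ Z n 1, (y - x)) * S.f 0 x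
      = (-1) ^ n.2 * ∫ x, (P n).eval x * x ^ nComp n 0 ∂S.μ 0 := by
  have hc1 : (Z n 1).card = n.2 := (hZ n).2.2 1
  rw [hP.integral_mul_pow_eq h₁ h₃ n 0 hu hdeg, ← intervalIntegral.integral_const_mul]
  refine intervalIntegral.integral_congr fun x _ => ?_
  simp only [eval_mul, hZ.eval_eq, prod_sub_eq_neg_one_pow_mul (Z n 1), hc1]
  have : ((-1 : ℝ) ^ n.2) * (-1) ^ n.2 = 1 := by rw [← mul_pow]; simp
  linear_combination (-(∏ z ∈ Z n 0, (x - z)) * u.eval x * (∏ y ∈ Z n 1, (y - x)) * S.f 0 x) * this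

lemma IsTypeII.abs_integral_eq (h₁ : α₁ < β₁) (h₂ : β₁ < α₂) (h₃ : α₂ < β₂) (hP : IsTypeII S P)
    (hZ : IsZeroSet α₁ β₁ α₂ β₂ P Z) (n : ℕ × ℕ) :
    |∫ x, (P n).eval x * x ^ nComp n 0 ∂S.μ 0|
      = ∫ x in α₁..β₁, ((∏ z ∈ Z n 0, (x - z)) ^ 2 * ∏ y ∈ Z n 1, (y - x)) * S.f 0 x := by
  have hc0 : (Z n 0).card = n.1 := (hZ n).2.2 0
  have h := hP.integral_mul_mul_eq h₁ h₃ hZ n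
    (monic_prod_of_monic (Z n 0) (fun z => X - C z) fun z _ => monic_X_sub_C z)
    (by rw [natDegree_prod_of_monic _ _ fun z _ => monic_X_sub_C z]; simp [hc0])
  simp only [eval_prod, eval_sub, eval_X, eval_C, ← sq] at h
  have hpos : 0 ≤ ∫ x in α₁..β₁, ((∏ z ∈ Z n 0, (x - z)) ^ 2 * ∏ y ∈ Z n 1, (y - x)) * S.f 0 x :=
    intervalIntegral.integral_nonneg h₁.le fun x hx => mul_nonneg (mul_nonneg (sq_nonneg _)
      (Finset.prod_nonneg fun y hy => sub_nonneg.mpr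
        ((hx.2.trans h₂.le).trans ((hZ n).1 1 y hy).1.le))) (S.posf 0 x hx).le
  rw [← abs_of_nonneg hpos, h, abs_mul, abs_pow, abs_neg, abs_one, one_pow, one_mul]

lemma IsTypeII.abs_integral_le (h₁ : α₁ < β₁) (h₂ : β₁ < α₂) (h₃ : α₂ < β₂) (hP : IsTypeII S P)
    (hZ : IsZeroSet α₁ β₁ α₂ β₂ P Z) (n : ℕ × ℕ) {u : ℝ[X]} (hu : u.Monic)
    (hdeg : u.natDegree = n.1) :
    |∫ x, (P n).eval x * x ^ nComp n 0 ∂S.μ 0|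
      ≤ ∫ x in α₁..β₁, (u.eval x ^ 2 * ∏ y ∈ Z n 1, (y - x)) * S.f 0 x := by
  have hc0 : (Z n 0).card = n.1 := (hZ n).2.2 0
  have h := hP.integral_mul_mul_eq h₁ h₃ hZ n
    (monic_prod_of_monic (Z n 0) (fun z => X - C z) fun z _ => monic_X_sub_C z)
    (by rw [natDegree_prod_of_monic _ _ fun z _ => monic_X_sub_C z]; simp [hc0])
  simp only [eval_prod, eval_sub, eval_X, eval_C, ← sq] at h
  have hu' := hP.integral_mul_mul_eq h₁ h₃ hZ n hu hdeg
  rw [hP.abs_integral_eq h₁ h₂ h₃ hZ n]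
  have hpos : 0 ≤ ∫ x in α₁..β₁,
      ((u.eval x - ∏ z ∈ Z n 0, (x - z)) ^ 2 * ∏ y ∈ Z n 1, (y - x)) * S.f 0 x :=
    intervalIntegral.integral_nonneg h₁.le fun x hx => mul_nonneg (mul_nonneg (sq_nonneg _)
      (Finset.prod_nonneg fun y hy => sub_nonneg.mpr
        ((hx.2.trans h₂.le).trans ((hZ n).1 1 y hy).1.le))) (S.posf 0 x hx).le
  have hint : ∀ v : ℝ → ℝ, Continuous v →
      IntervalIntegrable (fun x => v x * S.f 0 x) volume α₁ β₁ := fun v hv =>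
    intervalIntegrable_eval_mul h₁ (S.continuousOn_f 0) hv.continuousOn
  have hpt : ∀ x, ((u.eval x - ∏ z ∈ Z n 0, (x - z)) ^ 2 * ∏ y ∈ Z n 1, (y - x)) * S.f 0 x
      = (u.eval x ^ 2 * ∏ y ∈ Z n 1, (y - x)) * S.f 0 x
        - 2 * ((∏ z ∈ Z n 0, (x - z)) * u.eval x * (∏ y ∈ Z n 1, (y - x)) * S.f 0 x)
        + ((∏ z ∈ Z n 0, (x - z)) ^ 2 * ∏ y ∈ Z n 1, (y - x)) * S.f 0 x := fun x => by ring
  have hpc : Continuous fun x : ℝ => ∏ z ∈ Z n 0, (x - z) := by fun_prop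
  have hqc : Continuous fun x : ℝ => ∏ y ∈ Z n 1, (y - x) := by fun_prop
  have hi1 : IntervalIntegrable (fun x => (u.eval x ^ 2 * ∏ y ∈ Z n 1, (y - x)) * S.f 0 x)
      volume α₁ β₁ := hint _ ((u.continuous.pow 2).mul hqc)
  have hi2 : IntervalIntegrable (fun x => 2 * ((∏ z ∈ Z n 0, (x - z)) * u.eval x *
      (∏ y ∈ Z n 1, (y - x)) * S.f 0 x)) volume α₁ β₁ :=
    (hint _ ((hpc.mul u.continuous).mul hqc)).const_mul 2
  have hi3 : IntervalIntegrable (fun x => ((∏ z ∈ Z n 0, (x - z)) ^ 2 *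
      ∏ y ∈ Z n 1, (y - x)) * S.f 0 x) volume α₁ β₁ := hint _ ((hpc.pow 2).mul hqc)
  simp only [hpt] at hpos
  rw [intervalIntegral.integral_add (hi1.sub hi2) hi3, intervalIntegral.integral_sub hi1 hi2,
    intervalIntegral.integral_const_mul, hu', ← h] at hpos
  linarith

lemma IsTypeII.prod_sub_le (h₁ : α₁ < β₁) (h₂ : β₁ < α₂) (h₃ : α₂ < β₂) (hP : IsTypeII S P)
    (hZ : IsZeroSet α₁ β₁ α₂ β₂ P Z) (n : ℕ × ℕ) {x : ℝ} (hx : x ∈ Icc α₁ β₁) :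
    ∏ y ∈ Z (n + evec 0) 1, (y - x)
      ≤ (β₂ - α₁) / (α₂ - β₁) * ∏ y ∈ Z n 1, (y - x) := by
  have hmem : ∀ n, ∀ y ∈ Z n 1, y ∈ Icc α₂ β₂ := fun n y hy =>
    Ioo_subset_Icc_self ((hZ n).1 1 y hy)
  have hpos : ∀ y ∈ Icc α₂ β₂, 0 < y - x := fun y hy => by linarith [hx.2, hy.1]
  obtain ⟨hi1, hi2⟩ := hP.interlace h₁ h₂ h₃ hZ n 0 1
  have h := abs_sum_sub_sum_le_of_interlaced h₃.le (g := fun y => Real.log (y - x))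
    (fun y hy _ _ hyz => Real.log_le_log (hpos y hy) (by linarith)) (Z n 1) (Z (n + evec 0) 1)
    (hmem n) (hmem _) hi2 hi1
  rw [(hZ n).2.2 1, (hZ _).2.2 1, show nComp (n + evec 0) 1 = nComp n 1 from rfl, sub_self,
    zero_mul, sub_zero] at h
  have h' := (le_abs_self _).trans h
  have hα := hpos α₂ ⟨le_rfl, h₃.le⟩
  have hβ := hpos β₂ ⟨h₃.le, le_rfl⟩
  rw [← Real.log_prod fun y hy => (hpos y (hmem _ y hy)).ne',
    ← Real.log_prod fun y hy => (hpos y (hmem _ y hy)).ne', sub_le_iff_le_add,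
    ← Real.log_div hβ.ne' hα.ne',
    ← Real.log_mul (div_pos hβ hα).ne' (Finset.prod_pos fun y hy => hpos y (hmem _ y hy)).ne',
    Real.log_le_log_iff (Finset.prod_pos fun y hy => hpos y (hmem _ y hy))
      (mul_pos (div_pos hβ hα) (Finset.prod_pos fun y hy => hpos y (hmem _ y hy)))] at h'
  refine h'.trans (mul_le_mul_of_nonneg_right ?_
    (Finset.prod_nonneg fun y hy => (hpos y (hmem _ y hy)).le))
  exact div_le_div₀ (by linarith) (by linarith [hx.1]) (by linarith) (by linarith [hx.2])

theorem IsTypeII.tendsto_acoef_zero (h₁ : α₁ < β₁) (h₂ : β₁ < α₂) (h₃ : α₂ < β₂)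
    (hP : IsTypeII S P) :
    Tendsto (fun n => acoef S P (n + evec 0) 0) marginalFilter (𝓝 0) := by
  obtain ⟨Z, hZ⟩ := hP.exists_isZeroSet h₁ h₂ h₃
  rw [Metric.tendsto_nhds]
  intro ε hε
  set c := (β₂ - α₁) / (α₂ - β₁) with hc
  have hc0 : 0 < c := div_pos (by linarith) (by linarith)
  have hL0 : 0 < β₁ - α₁ := sub_pos.mpr h₁
  obtain ⟨A, K, θ, hK, hθ0, hθ1, h⟩ := exists_concentration h₁ (h₂.trans h₃).le
    (S.continuousOn_f 0) (S.posf 0) (by positivity : 0 < ε / (2 * (c * (β₁ - α₁))))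
  filter_upwards [eventually_mul_pow_le_one A hK hθ0 hθ1] with n hn
  have hc0' : (Z n 0).card = n.1 := (hZ n).2.2 0
  have hc1 : (Z n 1).card = n.2 := (hZ n).2.2 1
  have hm0 : ∀ z ∈ Z n 0, z ∈ Ioo α₁ β₁ := (hZ n).1 0
  have hm1 : ∀ n, ∀ y ∈ Z n 1, y ∈ Ioo α₂ β₂ := fun n => (hZ n).1 1
  have hle := h (Z n 0) (Z n 1) (fun z hz => Ioo_subset_Icc_self (hm0 z hz))
    (fun y hy => ⟨h₂.le.trans (hm1 n y hy).1.le, (hm1 n y hy).2.le⟩)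
    (by rw [hc0', hc1]; exact hn _ le_rfl)
  rw [← hP.abs_integral_eq h₁ h₂ h₃ hZ n] at hle
  have hp : (∏ z ∈ Z n 0, (X - C z) : ℝ[X]).Monic :=
    monic_prod_of_monic _ _ fun z _ => monic_X_sub_C z
  have hnum := hP.abs_integral_le h₁ h₂ h₃ hZ (n + evec 0) ((monic_X_sub_C α₁).mul hp) (by
    rw [(monic_X_sub_C α₁).natDegree_mul hp, natDegree_prod_of_monic _ _ fun z _ => monic_X_sub_C z]
    simp [hc0', evec, add_comm])
  simp only [eval_mul, eval_prod, eval_sub, eval_X, eval_C] at hnum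
  have hmono : ∫ x in α₁..β₁, (((x - α₁) * ∏ z ∈ Z n 0, (x - z)) ^ 2 *
        ∏ y ∈ Z (n + evec 0) 1, (y - x)) * S.f 0 x
      ≤ ∫ x in α₁..β₁, c * (β₁ - α₁) *
        ((x - α₁) * ((∏ z ∈ Z n 0, (x - z)) ^ 2 * ∏ y ∈ Z n 1, (y - x)) * S.f 0 x) := by
    refine intervalIntegral.integral_mono_on h₁.le
      (intervalIntegrable_eval_mul h₁ (S.continuousOn_f 0) (by fun_prop))
      ((intervalIntegrable_eval_mul h₁ (S.continuousOn_f 0) (by fun_prop)).const_mul _)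
      fun x hx => ?_
    have h4 : 0 ≤ x - α₁ := sub_nonneg.mpr hx.1
    have h5 : x - α₁ ≤ β₁ - α₁ := by linarith [hx.2]
    have h6 := hP.prod_sub_le h₁ h₂ h₃ hZ n hx
    have h7 := S.posf 0 x hx
    have h8 : 0 ≤ ∏ y ∈ Z n 1, (y - x) := Finset.prod_nonneg fun y hy => sub_nonneg.mpr
      ((hx.2.trans h₂.le).trans (hm1 n y hy).1.le)
    calc (((x - α₁) * ∏ z ∈ Z n 0, (x - z)) ^ 2 * ∏ y ∈ Z (n + evec 0) 1, (y - x)) * S.f 0 x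
        ≤ (((x - α₁) * ∏ z ∈ Z n 0, (x - z)) ^ 2 * (c * ∏ y ∈ Z n 1, (y - x))) * S.f 0 x := by
          gcongr
      _ = (x - α₁) * ((x - α₁) * (∏ z ∈ Z n 0, (x - z)) ^ 2 * c * (∏ y ∈ Z n 1, (y - x)) *
            S.f 0 x) := by ring
      _ ≤ (β₁ - α₁) * ((x - α₁) * (∏ z ∈ Z n 0, (x - z)) ^ 2 * c * (∏ y ∈ Z n 1, (y - x)) *
            S.f 0 x) := mul_le_mul_of_nonneg_right h5 (by positivity)
      _ = _ := by ring
  rw [intervalIntegral.integral_const_mul] at hmono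
  have hfin : c * (β₁ - α₁) * (ε / (2 * (c * (β₁ - α₁)))) = ε / 2 := by field_simp
  have hbound := hnum.trans (hmono.trans (mul_le_mul_of_nonneg_left hle (by positivity)))
  rw [← mul_assoc, hfin] at hbound
  rw [dist_zero_right, Real.norm_eq_abs, acoef_add_evec, abs_div]
  exact (div_le_of_le_mul₀ (abs_nonneg _) (by positivity) hbound).trans_lt (by linarith)

end FirstCoefficient

/-- Ray limits of recurrence coefficients of an Angelesco system along fully marginal
sequences `c = 0`: explicit values of the limits. -/
theorem stmt2 (h₁ : α₁ < β₁) (h₂ : β₁ < α₂) (h₃ : α₂ < β₂)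
    (S : AngelescoSystem α₁ β₁ α₂ β₂) (P : ℕ × ℕ → Polynomial ℝ) (hP : IsTypeII S P)
    (n : ℕ → ℕ × ℕ)
    (hsum : Filter.Tendsto (fun k => (n k).1 + (n k).2) Filter.atTop Filter.atTop)
    (hratio : Filter.Tendsto (fun k => ((n k).1 : ℝ) / (((n k).1 : ℝ) + ((n k).2 : ℝ)))
      Filter.atTop (nhds 0)) :
    Filter.Tendsto (fun k => bcoef S P (n k) 1) Filter.atTop (nhds ((α₂ + β₂) / 2)) ∧
    Filter.Tendsto (fun k => bcoef S P (n k) 0) Filter.atTop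
      (nhds ((α₁ + (α₂ + β₂) / 2) / 2 - Real.sqrt ((α₂ - α₁) * (β₂ - α₁)) / 2)) ∧
    ((∀ k, 1 ≤ (n k).2) →
      Filter.Tendsto (fun k => acoef S P (n k) 1) Filter.atTop
        (nhds (((β₂ - α₂) / 4) ^ 2))) ∧
    ((∀ k, 1 ≤ (n k).1) →
      Filter.Tendsto (fun k => acoef S P (n k) 0) Filter.atTop (nhds 0)) := by
  obtain ⟨m, hm⟩ : ∃ m, m = (α₂ + β₂) / 2 := ⟨_, rfl⟩
  obtain ⟨lam, hlam⟩ : ∃ lam, lam = (β₂ - α₂) / 4 := ⟨_, rfl⟩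
  have hn := tendsto_marginalFilter hsum hratio
  have hshift : ∀ (j : Fin 2), (∀ k, 1 ≤ nComp (n k) j) → ∀ k, n k - evec j + evec j = n k := by
    intro j hj k
    have := hj k
    ext <;> fin_cases j <;> simp_all [nComp, evec]
  refine ⟨?_, ?_, fun h => ?_, fun h => ?_⟩
  · simpa [hm, Function.comp_def] using (hP.tendsto_bcoef h₁ h₂ h₃ hm hlam 1).comp hn
  · have hlam0 : 0 < lam := by rw [hlam]; linarith
    have hα : α₁ < m - 2 * lam := by rw [hm, hlam]; linarith
    have hval : α₁ + lam * omegaOf m lam α₁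
        = (α₁ + (α₂ + β₂) / 2) / 2 - Real.sqrt ((α₂ - α₁) * (β₂ - α₁)) / 2 := by
      have h := joukowski_add_div hlam0 hα
      have hdisc : (m - α₁) ^ 2 - 4 * lam ^ 2 = (α₂ - α₁) * (β₂ - α₁) := by rw [hm, hlam]; ring
      rw [omegaOf, ← mul_div_assoc, ← sq, eq_sub_of_add_eq' h, joukowski, hdisc, hm]
      ring
    rw [← hval]
    simpa [Function.comp_def] using (hP.tendsto_bcoef h₁ h₂ h₃ hm hlam 0).comp hn
  · rw [← hlam]
    refine ((hP.tendsto_acoef_one h₁ h₂ h₃ hm hlam).comp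
      ((tendsto_sub_evec 1).comp hn)).congr fun k => ?_
    simp only [Function.comp_apply, hshift 1 h k]
  · refine ((hP.tendsto_acoef_zero h₁ h₂ h₃).comp
      ((tendsto_sub_evec 0).comp hn)).congr fun k => ?_
    simp only [Function.comp_apply, hshift 0 h k]
end
end

section
/- Let α < β be real numbers, let w be a holomorphic function on ℂ∖[α,β] with w(z)² = (z−α)(z−β) and w(x) > 0 for x > β, and set φ(z) := ½(z − (α+β)/2 + w(z)). Then φ is injective on ℂ∖[α,β], its image is exactly {w ∈ ℂ : |w| > (β−α)/4}, and φ(z) − z → −(α+β)/2 as |z| → ∞ (in particular φ(z) = z + O(1) at infinity). -/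
noncomputable section

/-- The complement in the plane of a compact real interval is preconnected. -/
theorem isPreconnected_compl_ofReal_image_Icc (α β : ℝ) :
    IsPreconnected (Complex.ofReal '' Set.Icc α β)ᶜ := by
  have hU : IsPreconnected {z : ℂ | 0 < z.im} := (convex_halfSpace_im_gt 0).isPreconnected
  have hL : IsPreconnected {z : ℂ | z.im < 0} := (convex_halfSpace_im_lt 0).isPreconnected
  have hR : IsPreconnected {z : ℂ | β < z.re} := (convex_halfSpace_re_gt β).isPreconnected
  have hl : IsPreconnected {z : ℂ | z.re < α} := (convex_halfSpace_re_lt α).isPreconnected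
  have h := ((hU.union (⟨β + 1, 1⟩ : ℂ) (by simp) (by simp) hR).union (⟨β + 1, -1⟩ : ℂ)
    (by simp) (by simp) hL).union (⟨α - 1, 1⟩ : ℂ) (by simp) (by simp) hl
  convert h using 1
  ext z
  simp only [Set.mem_compl_iff, Set.mem_image, Set.mem_Icc, Set.mem_union, Set.mem_ofPred_eq]
  constructor
  · intro hz
    by_contra! hn
    obtain ⟨⟨⟨h1, h2⟩, h3⟩, h4⟩ := hn
    exact hz ⟨z.re, ⟨h4, h2⟩, Complex.ext rfl (by simpa using le_antisymm h3 h1)⟩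
  · rintro h ⟨x, ⟨h1, h2⟩, rfl⟩
    simp only [Complex.ofReal_re, Complex.ofReal_im, lt_irrefl] at h
    grind

/-- Points of the circle of radius `R` are mapped by the Joukowski map `u ↦ u + R² / u` to
the interval `[-2R, 2R]`. -/
theorem add_sq_div_eq_ofReal_of_norm_eq {R : ℝ} (hR : 0 < R) {u : ℂ} (hu : ‖u‖ = R) :
    u + (R : ℂ) ^ 2 / u = ((2 * u.re : ℝ) : ℂ) := by
  have hu0 : u ≠ 0 := by
    rintro rfl
    simp at hu
    exact hR.ne hu
  have h : (R : ℂ) ^ 2 / u = (starRingEnd ℂ) u := by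
    rw [div_eq_iff hu0, mul_comm, Complex.mul_conj, Complex.normSq_eq_norm_sq, hu]
    push_cast
    rfl
  rw [h, Complex.add_conj]

/-- If the Joukowski map takes `u` into the interval `[-2R, 2R]`, then `‖u‖ = R`. -/
theorem norm_eq_of_add_sq_div_eq_ofReal {R s : ℝ} (hR : 0 < R) {u : ℂ} (hu : u ≠ 0)
    (hs : |s| ≤ 2 * R) (h : u + (R : ℂ) ^ 2 / u = (s : ℂ)) : ‖u‖ = R := by
  have hq : u * u + (R : ℂ) * R = s * u := by
    rw [← h]
    field_simp
  have hre := congrArg Complex.re hq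
  have him := congrArg Complex.im hq
  simp only [Complex.add_re, Complex.add_im, Complex.mul_re, Complex.mul_im,
    Complex.ofReal_re, Complex.ofReal_im] at hre him
  have hs2 : s ^ 2 ≤ (2 * R) ^ 2 := sq_le_sq' (abs_le.1 hs).1 (abs_le.1 hs).2
  have hn : ‖u‖ ^ 2 = R ^ 2 := by
    rw [← Complex.normSq_eq_norm_sq, Complex.normSq_apply]
    by_cases hb : u.im = 0
    · rw [hb] at hre ⊢
      have h1 : (u.re - s / 2) ^ 2 = 0 := le_antisymm (by nlinarith) (sq_nonneg _)
      have h2 : u.re - s / 2 = 0 := by simpa using h1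
      have h3 : s = 2 * u.re := by linarith
      subst h3
      nlinarith
    · have h3 : s = 2 * u.re := by
        apply mul_right_cancel₀ hb
        linarith
      subst h3
      nlinarith
  exact (sq_eq_sq₀ (norm_nonneg u) hR.le).1 hn

/-- The map `φ(z) = ½(z − (α+β)/2 + w(z))` is the conformal map of `ℂ∖[α,β]` onto the
exterior of the disk of radius `(β−α)/4` centered at `0`, with `φ(z) − z → −(α+β)/2`
at infinity. -/
theorem stmt6 (α β : ℝ) (hαβ : α < β) (w : ℂ → ℂ)
    (hholo : DifferentiableOn ℂ w (Complex.ofReal '' Set.Icc α β)ᶜ)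
    (hsq : ∀ z ∉ Complex.ofReal '' Set.Icc α β, w z ^ 2 = (z - (α : ℂ)) * (z - (β : ℂ)))
    (hpos : ∀ x : ℝ, β < x → 0 < (w (x : ℂ)).re ∧ (w (x : ℂ)).im = 0) :
    Set.InjOn (fun z => (z - ((α : ℂ) + (β : ℂ)) / 2 + w z) / 2)
      (Complex.ofReal '' Set.Icc α β)ᶜ ∧
    (fun z => (z - ((α : ℂ) + (β : ℂ)) / 2 + w z) / 2) ''
        (Complex.ofReal '' Set.Icc α β)ᶜ
      = {u : ℂ | (β - α) / 4 < ‖u‖} ∧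
    Filter.Tendsto (fun z => (z - ((α : ℂ) + (β : ℂ)) / 2 + w z) / 2 - z)
      (Filter.cocompact ℂ) (nhds (-(((α : ℂ) + (β : ℂ)) / 2))) := by
  set K : Set ℂ := Complex.ofReal '' Set.Icc α β with hK
  set φ : ℂ → ℂ := fun z => (z - ((α : ℂ) + (β : ℂ)) / 2 + w z) / 2 with hφ
  obtain ⟨R, hR⟩ : ∃ R : ℝ, R = (β - α) / 4 := ⟨_, rfl⟩
  have hR0 : 0 < R := by linarith
  have hRC : (R : ℂ) = ((β : ℂ) - α) / 4 := by rw [hR]; push_cast; rfl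
  have hRC0 : (R : ℂ) ≠ 0 := by exact_mod_cast hR0.ne'
  have hquad : ∀ z ∉ K, φ z * (z - ((α : ℂ) + β) / 2 - φ z) = (R : ℂ) ^ 2 := by
    intro z hz
    simp only [hφ, hRC]
    linear_combination (-1 / 4 : ℂ) * hsq z hz
  have hne : ∀ z ∉ K, φ z ≠ 0 := by
    intro z hz h0
    have := hquad z hz
    rw [h0, zero_mul] at this
    exact pow_ne_zero 2 hRC0 this.symm
  have hinv : ∀ z ∉ K, φ z + (R : ℂ) ^ 2 / φ z = z - ((α : ℂ) + β) / 2 := by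
    intro z hz
    rw [← hquad z hz, mul_div_cancel_left₀ _ (hne z hz)]
    ring
  have hnorm_ne : ∀ z ∉ K, ‖φ z‖ ≠ R := by
    intro z hz h
    apply hz
    have h1 := hinv z hz
    rw [add_sq_div_eq_ofReal_of_norm_eq hR0 h] at h1
    have h2 := abs_le.1 ((Complex.abs_re_le_norm (φ z)).trans_eq h)
    refine ⟨2 * (φ z).re + (α + β) / 2, ⟨by linarith [h2.1], by linarith [h2.2]⟩, ?_⟩
    push_cast at h1 ⊢
    linear_combination h1
  have hcont : ContinuousOn (fun z => ‖φ z‖) Kᶜ := by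
    have := hholo.continuousOn
    fun_prop
  have hbase : ((β + 1 : ℝ) : ℂ) ∈ Kᶜ := by
    rintro ⟨x, hx, hxe⟩
    have : x = β + 1 := by exact_mod_cast hxe
    linarith [hx.2]
  have hbase_norm : R < ‖φ ((β + 1 : ℝ) : ℂ)‖ := by
    refine lt_of_lt_of_le ?_ (Complex.re_le_norm _)
    have hw := (hpos (β + 1) (by linarith)).1
    have : φ ((β + 1 : ℝ) : ℂ) =
        (((β + 1 - (α + β) / 2 : ℝ) : ℂ) + w ((β + 1 : ℝ) : ℂ)) / ((2 : ℝ) : ℂ) := by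
      simp only [hφ]
      push_cast
      ring
    rw [this, Complex.div_ofReal_re, Complex.add_re, Complex.ofReal_re]
    linarith
  have hgt : ∀ z ∉ K, R < ‖φ z‖ := by
    intro z hz
    by_contra! hle
    obtain ⟨y, hy, hyR⟩ := (isPreconnected_compl_ofReal_image_Icc α β).intermediate_value
      (Set.mem_compl hz) hbase hcont ⟨hle, hbase_norm.le⟩
    exact hnorm_ne y hy hyR
  refine ⟨?_, ?_, ?_⟩
  · intro x hx y hy hxy
    change φ x = φ y at hxy
    have h1 := hinv x hx
    rw [hxy, hinv y hy] at h1
    linear_combination -h1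
  · ext u
    rw [← hR]
    constructor
    · rintro ⟨z, hz, rfl⟩
      exact hgt z hz
    · intro hu
      change R < ‖u‖ at hu
      have hu0 : u ≠ 0 := norm_pos_iff.1 (hR0.trans hu)
      obtain ⟨z, hz⟩ : ∃ z : ℂ, u + (R : ℂ) ^ 2 / u = z - ((α : ℂ) + β) / 2 :=
        ⟨_, (add_sub_cancel_right _ _).symm⟩
      have hzK : z ∉ K := by
        rintro ⟨x, hx, rfl⟩
        refine hu.ne' (norm_eq_of_add_sq_div_eq_ofReal (s := x - (α + β) / 2) hR0 hu0 ?_ ?_)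
        · rw [abs_le]
          constructor <;> linarith [hx.1, hx.2]
        · rw [hz]
          push_cast
          rfl
      refine ⟨z, hzK, ?_⟩
      have h1 := hquad z hzK
      have h2 : u * (z - ((α : ℂ) + β) / 2 - u) = (R : ℂ) ^ 2 := by
        rw [← hz]
        field_simp
        ring
      have h3 : (φ z - u) * (φ z * u - (R : ℂ) ^ 2) = 0 := by
        linear_combination φ z * h2 - u * h1
      rcases mul_eq_zero.1 h3 with h | h
      · exact sub_eq_zero.1 h
      · exfalso
        have h4 := congrArg norm (sub_eq_zero.1 h)
        rw [norm_mul, norm_pow, Complex.norm_real, Real.norm_of_nonneg hR0.le] at h4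
        nlinarith [hgt z hzK]
  · have hKc : IsCompact K := isCompact_Icc.image Complex.continuous_ofReal
    have hev : ∀ᶠ z in Filter.cocompact ℂ, z ∉ K := hKc.compl_mem_cocompact
    have hlow : Filter.Tendsto (fun z => ‖φ z‖) (Filter.cocompact ℂ) Filter.atTop := by
      refine Filter.tendsto_atTop_mono' _ ?_ (Filter.tendsto_atTop_add_const_right _
        (-‖((α : ℂ) + β) / 2‖ - R) (tendsto_norm_cocompact_atTop (E := ℂ)))
      filter_upwards [hev] with z hz
      have h1 : ‖(R : ℂ) ^ 2 / φ z‖ ≤ R := by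
        rw [norm_div, norm_pow, Complex.norm_real, Real.norm_of_nonneg hR0.le,
          div_le_iff₀ (hR0.trans (hgt z hz))]
        nlinarith [hgt z hz]
      have h2 := norm_add_le (φ z) ((R : ℂ) ^ 2 / φ z)
      rw [hinv z hz] at h2
      linarith [norm_sub_norm_le z (((α : ℂ) + β) / 2)]
    have hφinf : Filter.Tendsto φ (Filter.cocompact ℂ) (Bornology.cobounded ℂ) :=
      tendsto_norm_atTop_iff_cobounded.1 hlow
    have hdiv : Filter.Tendsto (fun z => -(((α : ℂ) + β) / 2) - (R : ℂ) ^ 2 * (φ z)⁻¹)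
        (Filter.cocompact ℂ) (nhds (-(((α : ℂ) + β) / 2))) := by
      simpa using ((Filter.tendsto_inv₀_cobounded.comp hφinf).const_mul
        ((R : ℂ) ^ 2)).const_sub (-(((α : ℂ) + β) / 2))
    refine hdiv.congr' ?_
    filter_upwards [hev] with z hz
    change _ = φ z - z
    rw [← div_eq_mul_inv]
    linear_combination -hinv z hz
end
end

section
/- Let α < b′ be real numbers, let f : ℝ → ℝ be continuously differentiable on an open interval containing [α, b′], and let λ ∈ ℝ. Define G(β) := log((β−α)/4) − λ·∫_α^β f(x) / (π·√((β−x)(x−α))) dx for β ∈ (α, b′). Then for every β ∈ (α, b′), G is differentiable at β with derivative G′(β) = 1/(β−α) − (λ/(2π))·∫_{−1}^{1} f′( ((β−α)/2)·x + (β+α)/2 ) · √((1+x)/(1−x)) dx. -/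
open MeasureTheory

noncomputable section

/-- The affine map carrying `[-1, 1]` onto `[α, t]` sends `[-1, 1]` into `[α, t]`. -/
lemma affine_mem_Icc {α t s : ℝ} (ht : α ≤ t) (hs : s ∈ Set.Icc (-1 : ℝ) 1) :
    (t - α) / 2 * s + (t + α) / 2 ∈ Set.Icc α t := by
  constructor <;> nlinarith [hs.1, hs.2]

/-- The arcsine integral over `[α, t]`, rescaled to `[-1, 1]`. -/
lemma integral_div_pi_mul_sqrt_eq (f : ℝ → ℝ) {α t : ℝ} (ht : α < t) :
    ∫ x in α..t, f x / (Real.pi * Real.sqrt ((t - x) * (x - α))) =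
      Real.pi⁻¹ * ∫ s in (-1 : ℝ)..1,
        f ((t - α) / 2 * s + (t + α) / 2) * Real.sqrt (1 - s ^ 2)⁻¹ := by
  have hc : 0 < (t - α) / 2 := by linarith
  have hne : t - α ≠ 0 := (sub_pos.2 ht).ne'
  have key := intervalIntegral.smul_integral_comp_mul_add (a := (-1 : ℝ)) (b := 1)
    (fun x => f x / (Real.pi * Real.sqrt ((t - x) * (x - α)))) ((t - α) / 2) ((t + α) / 2)
  rw [show (t - α) / 2 * (-1) + (t + α) / 2 = α by ring,
    show (t - α) / 2 * 1 + (t + α) / 2 = t by ring] at key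
  rw [← key, smul_eq_mul, ← intervalIntegral.integral_const_mul,
    ← intervalIntegral.integral_const_mul]
  congr 1
  ext s
  rw [show (t - ((t - α) / 2 * s + (t + α) / 2)) * ((t - α) / 2 * s + (t + α) / 2 - α) =
      ((t - α) / 2) ^ 2 * (1 - s ^ 2) by ring, Real.sqrt_mul (by positivity),
    Real.sqrt_sq hc.le, Real.sqrt_inv]
  field_simp

/-- On `[-1, 1]` the weights `(1 + s) / √(1 - s²)` and `√((1 + s) / (1 - s))` agree. -/
lemma one_add_mul_sqrt_one_sub_sq_inv {s : ℝ} (hs : s ∈ Set.Icc (-1 : ℝ) 1) :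
    (1 + s) * Real.sqrt (1 - s ^ 2)⁻¹ = Real.sqrt ((1 + s) / (1 - s)) := by
  have h1 : 0 ≤ 1 + s := by linarith [hs.1]
  rw [show 1 - s ^ 2 = (1 + s) * (1 - s) by ring, Real.sqrt_inv, Real.sqrt_mul h1,
    Real.sqrt_div h1]
  rcases h1.eq_or_lt with h | h
  · simp [← h]
  · have h2 := Real.sqrt_pos.2 h
    nth_rewrite 1 [← Real.mul_self_sqrt h1]
    rw [mul_inv, div_eq_mul_inv]
    field_simp

/-- Differentiation under the integral sign for the rescaled arcsine integral. -/
lemma hasDerivAt_integral_comp_affine {f : ℝ → ℝ} {α b u v β : ℝ} (hu : u < α) (hv : b < v)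
    (hf : ContDiffOn ℝ 1 f (Set.Ioo u v)) (hβ : β ∈ Set.Ioo α b) :
    HasDerivAt
      (fun t => ∫ s in (-1 : ℝ)..1,
        f ((t - α) / 2 * s + (t + α) / 2) * Real.sqrt (1 - s ^ 2)⁻¹)
      (∫ s in (-1 : ℝ)..1, deriv f ((β - α) / 2 * s + (β + α) / 2) * ((1 + s) / 2) *
        Real.sqrt (1 - s ^ 2)⁻¹) β := by
  have hsub : Set.Icc α b ⊆ Set.Ioo u v := fun x hx => ⟨hu.trans_le hx.1, hx.2.trans_lt hv⟩
  have hcd : ContinuousOn (deriv f) (Set.Ioo u v) :=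
    hf.continuousOn_deriv_of_isOpen isOpen_Ioo le_rfl
  obtain ⟨C, hC⟩ := isCompact_Icc.exists_bound_of_continuousOn (hcd.mono hsub)
  have hmem : ∀ t ∈ Set.Ioo α b, ∀ s ∈ Set.Icc (-1 : ℝ) 1,
      (t - α) / 2 * s + (t + α) / 2 ∈ Set.Icc α b := fun t ht s hs =>
    Set.Icc_subset_Icc_right ht.2.le (affine_mem_Icc ht.1.le hs)
  have huIcc : Set.uIcc (-1 : ℝ) 1 = Set.Icc (-1) 1 := Set.uIcc_of_le (by norm_num)
  have hIoc : ∀ s ∈ Set.uIoc (-1 : ℝ) 1, s ∈ Set.Icc (-1 : ℝ) 1 := fun s hs =>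
    huIcc ▸ Set.uIoc_subset_uIcc hs
  have hw := Polynomial.Chebyshev.intervalIntegrable_sqrt_one_sub_sq_inv
  have hint : ∀ g : ℝ → ℝ, ContinuousOn g (Set.Ioo u v) → ∀ t ∈ Set.Ioo α b,
      ContinuousOn (fun s => g ((t - α) / 2 * s + (t + α) / 2)) (Set.uIcc (-1) 1) :=
    fun g hg t ht => hg.comp (by fun_prop) fun s hs => hsub (hmem t ht s (huIcc ▸ hs))
  have hF : ∀ t ∈ Set.Ioo α b, IntervalIntegrable (fun s =>
      f ((t - α) / 2 * s + (t + α) / 2) * Real.sqrt (1 - s ^ 2)⁻¹) volume (-1) 1 :=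
    fun t ht => hw.continuousOn_mul (hint f hf.continuousOn t ht)
  have hF' : IntervalIntegrable (fun s => deriv f ((β - α) / 2 * s + (β + α) / 2) *
      ((1 + s) / 2) * Real.sqrt (1 - s ^ 2)⁻¹) volume (-1) 1 :=
    hw.continuousOn_mul ((hint _ hcd β hβ).mul (by fun_prop))
  have hnhds : Set.Ioo α b ∈ nhds β := Ioo_mem_nhds hβ.1 hβ.2
  refine (intervalIntegral.hasDerivAt_integral_of_dominated_loc_of_deriv_le
    (F' := fun t s => deriv f ((t - α) / 2 * s + (t + α) / 2) * ((1 + s) / 2) *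
      Real.sqrt (1 - s ^ 2)⁻¹)
    (bound := fun s => C * Real.sqrt (1 - s ^ 2)⁻¹) hnhds
    ?_ (hF β hβ) hF'.def'.aestronglyMeasurable ?_ (hw.const_mul C) ?_).2
  · filter_upwards [hnhds] with t ht
    exact (hF t ht).def'.aestronglyMeasurable
  · refine Filter.Eventually.of_forall fun s hs t ht => ?_
    have hs' := hIoc s hs
    have hd := hC _ (hmem t ht s hs')
    have h1 : ‖(1 + s) / 2‖ ≤ 1 := by
      rw [Real.norm_eq_abs, abs_le]
      constructor <;> linarith [hs'.1, hs'.2]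
    rw [norm_mul, norm_mul, Real.norm_of_nonneg (Real.sqrt_nonneg _)]
    gcongr
    calc _ ≤ C * 1 := mul_le_mul hd h1 (norm_nonneg _) ((norm_nonneg _).trans hd)
      _ = C := mul_one C
  · refine Filter.Eventually.of_forall fun s hs t ht => ?_
    have hd : DifferentiableAt ℝ f ((t - α) / 2 * s + (t + α) / 2) :=
      (hf.differentiableOn one_ne_zero).differentiableAt
        (isOpen_Ioo.mem_nhds (hsub (hmem t ht s (hIoc s hs))))
    have ha : HasDerivAt (fun t : ℝ => (t - α) / 2 * s + (t + α) / 2) ((1 + s) / 2) t := by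
      convert! ((((hasDerivAt_id t).sub_const α).div_const 2).mul_const s).add
        (((hasDerivAt_id t).add_const α).div_const 2) using 1
      ring
    exact (hd.hasDerivAt.comp t ha).mul_const _

/-- Differentiation of the Mhaskar–Saff functional
`G(β) = log((β−α)/4) − λ ∫_α^β f(x) dx/(π√((β−x)(x−α)))`. -/
theorem stmt7 (α b' : ℝ) (hab : α < b') (f : ℝ → ℝ) (lam : ℝ)
    (u v : ℝ) (hu : u < α) (hv : b' < v)
    (hf : ContDiffOn ℝ 1 f (Set.Ioo u v)) :
    ∀ β ∈ Set.Ioo α b',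
      HasDerivAt
        (fun t => Real.log ((t - α) / 4)
          - lam * ∫ x in α..t, f x / (Real.pi * Real.sqrt ((t - x) * (x - α))))
        (1 / (β - α)
          - lam / (2 * Real.pi) *
            ∫ x in (-1 : ℝ)..1,
              deriv f ((β - α) / 2 * x + (β + α) / 2) * Real.sqrt ((1 + x) / (1 - x)))
        β := by
  intro β hβ
  have hpos : 0 < β - α := sub_pos.2 hβ.1
  have hlog : HasDerivAt (fun t => Real.log ((t - α) / 4)) (1 / (β - α)) β := by
    convert! (((hasDerivAt_id β).sub_const α).div_const 4).log (by simp; linarith) using 1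
    simp
    field_simp
  have hint : HasDerivAt
      (fun t => ∫ x in α..t, f x / (Real.pi * Real.sqrt ((t - x) * (x - α))))
      (Real.pi⁻¹ * ∫ s in (-1 : ℝ)..1, deriv f ((β - α) / 2 * s + (β + α) / 2) *
        ((1 + s) / 2) * Real.sqrt (1 - s ^ 2)⁻¹) β := by
    refine ((hasDerivAt_integral_comp_affine hu hv hf hβ).const_mul _).congr_of_eventuallyEq ?_
    filter_upwards [Ioi_mem_nhds hβ.1] with t ht
    exact integral_div_pi_mul_sqrt_eq f ht
  have hweight : ∫ s in (-1 : ℝ)..1, deriv f ((β - α) / 2 * s + (β + α) / 2) *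
        ((1 + s) / 2) * Real.sqrt (1 - s ^ 2)⁻¹ =
      2⁻¹ * ∫ x in (-1 : ℝ)..1,
        deriv f ((β - α) / 2 * x + (β + α) / 2) * Real.sqrt ((1 + x) / (1 - x)) := by
    rw [← intervalIntegral.integral_const_mul]
    refine intervalIntegral.integral_congr fun s hs => ?_
    rw [Set.uIcc_of_le (by norm_num)] at hs
    simp only [← one_add_mul_sqrt_one_sub_sq_inv hs]
    ring
  rw [hweight] at hint
  convert! hlog.sub (hint.const_mul lam) using 1
  field_simp
end
end

section
/- Let α < β be real numbers and let t < α. Then ∫_α^β 1 / ((y−t)·√((y−α)(β−y))) dy = π / √((α−t)(β−t)). Equivalently, the Cauchy transform of the arcsine distribution ω of [α,β] (with density 1/(π√((y−α)(β−y)))) satisfies ∫ dω(y)/(y−t) = 1/√((α−t)(β−t)) for every real t < α. -/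
open MeasureTheory

noncomputable section

/-- On `(α, β)`, an antiderivative of `1 / ((y - t) √((y - α) (β - y)))` is the arcsine of the
Möbius map sending `α`, `β` to `-1`, `1`, divided by `√((α - t) (β - t))`. -/
lemma hasDerivAt_arcsin_mobius_div {α β t y : ℝ} (ht : t < α) (hα : α < y) (hβ : y < β) :
    HasDerivAt (fun y ↦ Real.arcsin
        (((α - t + (β - t)) * (y - t) - 2 * ((α - t) * (β - t))) / ((β - α) * (y - t)))
          / Real.sqrt ((α - t) * (β - t)))
      (1 / ((y - t) * Real.sqrt ((y - α) * (β - y)))) y := by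
  have ha : 0 < α - t := sub_pos.2 ht
  have hb : 0 < β - t := by linarith
  have hu : 0 < y - t := by linarith
  have hc : 0 < β - α := by linarith
  have hp : 0 < (y - α) * (β - y) := mul_pos (by linarith) (by linarith)
  have hab : 0 < (α - t) * (β - t) := mul_pos ha hb
  set g := ((α - t + (β - t)) * (y - t) - 2 * ((α - t) * (β - t))) / ((β - α) * (y - t)) with hg
  have hs : 0 < Real.sqrt ((α - t) * (β - t)) := Real.sqrt_pos.2 hab
  have hr : 0 < Real.sqrt ((y - α) * (β - y)) := Real.sqrt_pos.2 hp
  have hs2 := Real.sq_sqrt hab.le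
  have hr2 := Real.sq_sqrt hp.le
  set s := Real.sqrt ((α - t) * (β - t))
  set r := Real.sqrt ((y - α) * (β - y))
  have key : 1 - g ^ 2 = (2 * s * r / ((β - α) * (y - t))) ^ 2 := by
    rw [div_pow (2 * s * r), mul_pow (2 * s), mul_pow 2 s, hs2, hr2, hg]
    field_simp
    ring
  have hpos : 0 < 2 * s * r / ((β - α) * (y - t)) := by positivity
  have hlt : 0 < 1 - g ^ 2 := key ▸ pow_pos hpos 2
  have hsqrt : Real.sqrt (1 - g ^ 2) = 2 * s * r / ((β - α) * (y - t)) := by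
    rw [key, Real.sqrt_sq hpos.le]
  have hsub : HasDerivAt (fun y ↦ y - t) 1 y := (hasDerivAt_id y).sub_const t
  have hmob := ((hsub.const_mul (α - t + (β - t))).sub_const
    (2 * ((α - t) * (β - t)))).fun_div (hsub.const_mul (β - α)) (by positivity)
  have harcsin := Real.hasDerivAt_arcsin (x := g) (by rintro h; simp [h] at hlt)
    (by rintro h; simp [h] at hlt)
  have h := (harcsin.comp y hmob).div_const s
  refine h.congr_deriv ?_
  rw [hsqrt]
  field_simp
  rw [hs2]
  ring

/-- The Cauchy transform of the arcsine distribution of `[α,β]` at a point `t < α`: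
`∫_α^β dy/((y−t)√((y−α)(β−y))) = π/√((α−t)(β−t))`. -/
theorem stmt9 (α β t : ℝ) (hαβ : α < β) (ht : t < α) :
    (∫ y in α..β, 1 / ((y - t) * Real.sqrt ((y - α) * (β - y))))
      = Real.pi / Real.sqrt ((α - t) * (β - t)) := by
  have ha : α - t ≠ 0 := by linarith
  have hb : β - t ≠ 0 := by linarith
  have hc : β - α ≠ 0 := by linarith
  have hcont : ContinuousOn (fun y ↦ Real.arcsin
        (((α - t + (β - t)) * (y - t) - 2 * ((α - t) * (β - t))) / ((β - α) * (y - t)))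
          / Real.sqrt ((α - t) * (β - t))) (Set.Icc α β) := by
    refine (Real.continuous_arcsin.comp_continuousOn ?_).div_const _
    refine ContinuousOn.div (by fun_prop) (by fun_prop) fun y hy ↦ mul_ne_zero hc ?_
    linarith [hy.1]
  have hderiv := fun y (hy : y ∈ Set.Ioo α β) ↦ hasDerivAt_arcsin_mobius_div ht hy.1 hy.2
  have hint : IntervalIntegrable (fun y ↦ 1 / ((y - t) * Real.sqrt ((y - α) * (β - y))))
      volume α β := by
    rw [intervalIntegrable_iff_integrableOn_Ioc_of_le hαβ.le]
    refine intervalIntegral.integrableOn_deriv_of_nonneg hcont hderiv fun y hy ↦ ?_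
    have hu : 0 ≤ y - t := by linarith [hy.1]
    positivity
  rw [intervalIntegral.integral_eq_sub_of_hasDerivAt_of_le hαβ.le hcont hderiv hint]
  have hβ : ((α - t + (β - t)) * (β - t) - 2 * ((α - t) * (β - t))) / ((β - α) * (β - t)) = 1 := by
    field_simp
    ring
  have hα : ((α - t + (β - t)) * (α - t) - 2 * ((α - t) * (β - t))) / ((β - α) * (α - t)) = -1 := by
    field_simp
    ring
  rw [hβ, hα, Real.arcsin_one, Real.arcsin_neg_one]
  ring
end
end

section
/- Let a ∈ ℂ, ε > 0, M > 0, and let f be holomorphic on {z ∈ ℂ : |z − a| > ε} with |f(z)| ≤ M for all such z and f(z) → 1 as |z| → ∞. Then for every δ ≥ 4ε and every z with |z − a| ≥ δ: |f(z) − 1| ≤ 4(M+1)·ε/δ. -/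
noncomputable section

open Filter Topology Metric

/-- Inverting at `a`, a function holomorphic on `{z | ε < ‖z - a‖}` with limit `c` at infinity
extends holomorphically to the disk of radius `ε⁻¹`, with value `c` at the origin. -/
lemma differentiableOn_update_comp_add_inv {a c : ℂ} {ε : ℝ} (hε : 0 < ε) {f : ℂ → ℂ}
    (hholo : DifferentiableOn ℂ f {z : ℂ | ε < ‖z - a‖})
    (hlim : Tendsto f (cocompact ℂ) (𝓝 c)) :
    DifferentiableOn ℂ (Function.update (fun w => f (a + w⁻¹)) 0 c) (ball 0 ε⁻¹) := by
  refine ((Complex.differentiableOn_compl_singleton_and_continuousAt_iff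
    (ball_mem_nhds 0 (inv_pos.2 hε))).1 ⟨?_, ?_⟩)
  · have hcomp : DifferentiableOn ℂ (fun w => f (a + w⁻¹)) (ball 0 ε⁻¹ \ {0}) := by
      refine hholo.comp (t := {z : ℂ | ε < ‖z - a‖}) (f := fun w : ℂ => a + w⁻¹) ?_ ?_
      · exact fun w hw =>
          ((differentiableAt_inv (𝕜 := ℂ) hw.2).const_add a).differentiableWithinAt
      · rintro w ⟨hw, hw0⟩
        have : ε < ‖w‖⁻¹ :=
          (lt_inv_comm₀ hε (norm_pos_iff.2 hw0)).2 (by simpa using hw)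
        simpa using this
    exact hcomp.congr fun w hw => Function.update_of_ne hw.2 _ _
  · rw [continuousAt_update_same]
    refine hlim.comp ?_
    rw [← cobounded_eq_cocompact]
    exact (tendsto_const_add_cobounded a).comp tendsto_inv₀_nhdsNE_zero

/-- Schwarz lemma at infinity. -/
lemma norm_sub_le_mul_div_of_tendsto_cocompact {a c : ℂ} {ε K : ℝ} (hε : 0 < ε) (hK : 0 ≤ K)
    {f : ℂ → ℂ} (hholo : DifferentiableOn ℂ f {z : ℂ | ε < ‖z - a‖})
    (hbdd : ∀ z : ℂ, ε < ‖z - a‖ → ‖f z - c‖ ≤ K)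
    (hlim : Tendsto f (cocompact ℂ) (𝓝 c)) {z : ℂ} (hz : ε < ‖z - a‖) :
    ‖f z - c‖ ≤ K * ε / ‖z - a‖ := by
  have hza : 0 < ‖z - a‖ := hε.trans hz
  have hmaps : Set.MapsTo (Function.update (fun w => f (a + w⁻¹)) 0 c) (ball 0 ε⁻¹)
      (closedBall (Function.update (fun w => f (a + w⁻¹)) 0 c 0) K) := by
    intro w hw
    rw [Function.update_self, mem_closedBall, dist_eq_norm]
    rcases eq_or_ne w 0 with rfl | hw0
    · simpa using hK
    · rw [Function.update_of_ne hw0]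
      apply hbdd
      have : ε < ‖w‖⁻¹ := (lt_inv_comm₀ hε (norm_pos_iff.2 hw0)).2 (by simpa using hw)
      simpa using this
  have hmem : (z - a)⁻¹ ∈ ball (0 : ℂ) ε⁻¹ := by
    rw [mem_ball_zero_iff, norm_inv]
    exact inv_strictAnti₀ hε hz
  have key := Complex.dist_le_div_mul_dist_of_mapsTo_ball
    (differentiableOn_update_comp_add_inv hε hholo hlim) hmaps hmem
  rw [Function.update_self, Function.update_of_ne (inv_ne_zero (norm_pos_iff.1 hza)), inv_inv,
    add_sub_cancel, dist_eq_norm, dist_zero_right, norm_inv, div_inv_eq_mul] at key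
  exact key

/-- Quantitative estimate: a function holomorphic and bounded off a small disk and
tending to `1` at infinity is quantitatively close to `1` away from the disk. -/
theorem stmt11 (a : ℂ) (ε M : ℝ) (hε : 0 < ε) (hM : 0 < M)
    (f : ℂ → ℂ)
    (hholo : DifferentiableOn ℂ f {z : ℂ | ε < ‖z - a‖})
    (hbdd : ∀ z : ℂ, ε < ‖z - a‖ → ‖f z‖ ≤ M)
    (hlim : Filter.Tendsto f (Filter.cocompact ℂ) (nhds 1)) :
    ∀ δ : ℝ, 4 * ε ≤ δ → ∀ z : ℂ, δ ≤ ‖z - a‖ → ‖f z - 1‖ ≤ 4 * (M + 1) * ε / δ := by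
  intro δ hδ z hz
  have hδ0 : 0 < δ := by linarith
  have hbdd' : ∀ w : ℂ, ε < ‖w - a‖ → ‖f w - 1‖ ≤ M + 1 := fun w hw =>
    (norm_sub_le _ _).trans (by simpa using hbdd w hw)
  calc ‖f z - 1‖ ≤ (M + 1) * ε / ‖z - a‖ :=
        norm_sub_le_mul_div_of_tendsto_cocompact hε (by positivity) hholo hbdd' hlim
          (by linarith)
    _ ≤ 4 * (M + 1) * ε / δ := by
        gcongr
        linarith
end
end
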